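/- Let n ≥ 1, let T be an n-periodic 2-triangulation on the 4n-gon, and let e ∈ T be a 2-relevant edge with rotation orbit ẽ = {e, e+n, e+2n, e+3n}. Then there are exactly two n-periodic 2-triangulations on the 4n-gon containing T ∖ ẽ; namely, if T' is any n-periodic 2-triangulation on the 4n-gon with T ∖ ẽ ⊆ T', then either T' = T or T' = (T ∖ ẽ) ∪ f̃, where f is the unique edge (up to rotation) with f ∉ T such that (T ∖ ẽ) ∪ f̃ is an n-periodic 2-triangulation. -/

import Mathlib

/- Edges on the universal cover of the half-cylinder, modeled by the integers.
   An edge is an unordered pair of distinct integers, represented as an ordered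
   pair `(a, b)` with `a < b` (validity). -/

namespace Multitriangulation

abbrev Edge := ℤ × ℤ

/-- Translate an edge by `t`: `[a,b] + t = [a+t, b+t]`. -/
def shift (e : Edge) (t : ℤ) : Edge := (e.1 + t, e.2 + t)

/-- Two edges (as unordered pairs of integers) cross:
their endpoints strictly interleave. -/
def Crosses (e f : Edge) : Prop :=
  (min e.1 e.2 < min f.1 f.2 ∧ min f.1 f.2 < max e.1 e.2 ∧ max e.1 e.2 < max f.1 f.2) ∨
  (min f.1 f.2 < min e.1 e.2 ∧ min e.1 e.2 < max f.1 f.2 ∧ max f.1 f.2 < max e.1 e.2)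

/-- A finite set of edges is an `l`-crossing if it consists of `l` pairwise
crossing edges. -/
def IsCrossing (l : ℕ) (S : Finset Edge) : Prop :=
  S.card = l ∧ ∀ e ∈ S, ∀ f ∈ S, e ≠ f → Crosses e f

/-- A set of edges is `l`-crossing-free if no `l` of its edges pairwise cross. -/
def CrossingFree (l : ℕ) (E : Set Edge) : Prop :=
  ¬ ∃ S : Finset Edge, ↑S ⊆ E ∧ IsCrossing l S

/-- A set of edges is `n`-periodic if `e ∈ E ↔ e + n ∈ E`. -/
def Periodic (n : ℕ) (E : Set Edge) : Prop := ∀ e, e ∈ E ↔ shift e (n : ℤ) ∈ E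

/-- All members are genuine edges `[a,b]` with `a < b`. -/
def ValidEdges (E : Set Edge) : Prop := ∀ e ∈ E, e.1 < e.2

/-- An `n`-periodic `k`-triangulation on `ℤ`: an `n`-periodic
`(k+1)`-crossing-free set of edges that is maximal under inclusion among
`n`-periodic `(k+1)`-crossing-free sets of edges. -/
def IsTriangulation (n k : ℕ) (T : Set Edge) : Prop :=
  ValidEdges T ∧ Periodic n T ∧ CrossingFree (k+1) T ∧
  ∀ T', ValidEdges T' → Periodic n T' → CrossingFree (k+1) T' → T ⊆ T' → T' = T

/-- Interleaving of representatives `0 ≤ a < b < m`, `0 ≤ c < d < m`: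
`a<c<b<d` or `c<a<d<b` (formulated symmetrically via `min`/`max`). -/
def crossIndex (a b c d : ℕ) : Prop :=
  (min a b < min c d ∧ min c d < max a b ∧ max a b < max c d) ∨
  (min c d < min a b ∧ min a b < max c d ∧ max c d < max a b)

/-- Two edges of the `m`-gon (vertices labeled by `ZMod m`) cross: their
endpoints interleave in cyclic order, via the representatives in `[0, m)`. -/
def PolyCrosses {m : ℕ} (e f : Sym2 (ZMod m)) : Prop :=
  ∃ x y z w : ZMod m, e = s(x, y) ∧ f = s(z, w) ∧ crossIndex x.val y.val z.val w.val

/-- A finite set of polygon edges is an `l`-crossing if it consists of `l`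
pairwise crossing edges. -/
def PolyIsCrossing {m : ℕ} (l : ℕ) (S : Finset (Sym2 (ZMod m))) : Prop :=
  S.card = l ∧ ∀ e ∈ S, ∀ f ∈ S, e ≠ f → PolyCrosses e f

/-- A set of polygon edges is `l`-crossing-free. -/
def PolyCrossingFree {m : ℕ} (l : ℕ) (E : Set (Sym2 (ZMod m))) : Prop :=
  ¬ ∃ S : Finset (Sym2 (ZMod m)), ↑S ⊆ E ∧ PolyIsCrossing l S

/-- Invariance under the rotation `v ↦ v + n`. -/
def PolyPeriodic (n : ℕ) {m : ℕ} (T : Set (Sym2 (ZMod m))) : Prop :=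
  ∀ e, e ∈ T ↔ Sym2.map (· + (n : ZMod m)) e ∈ T

/-- All members are genuine edges (pairs of distinct vertices). -/
def PolyValid {m : ℕ} (T : Set (Sym2 (ZMod m))) : Prop := ∀ e ∈ T, ¬ e.IsDiag

/-- A `2`-triangulation on the `m`-gon: a 3-crossing-free set of edges,
maximal under inclusion among 3-crossing-free sets of edges. -/
def IsPolyTriangulation {m : ℕ} (T : Set (Sym2 (ZMod m))) : Prop :=
  PolyValid T ∧ PolyCrossingFree 3 T ∧
  ∀ T', PolyValid T' → PolyCrossingFree 3 T' → T ⊆ T' → T' = T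

/-- An edge of the `4n`-gon is 2-relevant: its endpoints have representatives
`0 ≤ a < b < 4n` with `2 < b − a < 4n − 2`. -/
def PolyRelevant (n : ℕ) (e : Sym2 (ZMod (4 * n))) : Prop :=
  ∃ a b : ℕ, a < b ∧ b < 4 * n ∧
    e = s(((a : ZMod (4 * n))), ((b : ZMod (4 * n)))) ∧
    2 < b - a ∧ b - a < 4 * n - 2

/-- The rotation orbit `ẽ = {e, e+n, e+2n, e+3n}` of an edge of the `4n`-gon. -/
def tilde (n : ℕ) (e : Sym2 (ZMod (4 * n))) : Set (Sym2 (ZMod (4 * n))) :=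
  {e, Sym2.map (· + ((n : ℕ) : ZMod (4 * n))) e,
    Sym2.map (· + ((2 * n : ℕ) : ZMod (4 * n))) e,
    Sym2.map (· + ((3 * n : ℕ) : ZMod (4 * n))) e}

/-- An `n`-periodic 2-triangulation on the `4n`-gon. -/
def IsPeriodicPolyTriangulation (n : ℕ) (T : Set (Sym2 (ZMod (4 * n)))) : Prop :=
  IsPolyTriangulation T ∧ PolyPeriodic n T

section

/-! ### Abstract flips in simplicial complexes -/

/-- A facet (inclusion-maximal face) of the complex with face predicate `F`. -/
def Facet {X : Type*} (F : Set X → Prop) (T : Set X) : Prop :=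
  F T ∧ ∀ x, F (insert x T) → x ∈ T

/-- Every element of a facet outside `C` can be flipped in exactly one way. -/
def FlipProp {X : Type*} (F : Set X → Prop) (C : Set X) : Prop :=
  ∀ T, Facet F T → ∀ e ∈ T, e ∉ C → ∃ f, f ≠ e ∧
    ∀ y, (y ∉ T \ {e} ∧ F (insert y (T \ {e}))) ↔ (y = e ∨ y = f)

/-- Non-crossing sets of pairs: lattice-path like sets. -/
def NC (J : Set (ℤ × ℤ)) : Prop :=
  ∀ p ∈ J, ∀ q ∈ J, ¬ (p.1 < q.1 ∧ p.2 < q.2)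

/-- Maximal non-crossing sets relative to their rows and columns. -/
def MaxJ (J : Set (ℤ × ℤ)) : Prop :=
  ∀ p ∈ J, ∀ q ∈ J, NC (insert (p.1, q.2) J) → (p.1, q.2) ∈ J

theorem NC.mono {J K : Set (ℤ × ℤ)} (h : J ⊆ K) (hK : NC K) : NC J :=
  fun p hp q hq => hK p (h hp) q (h hq)

theorem NC_insert {J : Set (ℤ × ℤ)} {x : ℤ × ℤ} (hJ : NC J) 
    (h : ∀ q ∈ J, ¬ (x.1 < q.1 ∧ x.2 < q.2) ∧ ¬ (q.1 < x.1 ∧ q.2 < x.2)) : NC (insert x J) := by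
  intro p hp q hq
  rcases hp with rfl | hp <;> rcases hq with rfl | hq
  · omega
  · exact (h q hq).1
  · exact (h p hp).2
  · exact hJ p hp q hq

theorem NC_insert_iff {J : Set (ℤ × ℤ)} {x : ℤ × ℤ} : NC (insert x J) ↔ NC J ∧
    ∀ q ∈ J, ¬ (x.1 < q.1 ∧ x.2 < q.2) ∧ ¬ (q.1 < x.1 ∧ q.2 < x.2) := by
  constructor
  · intro h
    exact ⟨h.mono (Set.subset_insert _ _), fun q hq =>
      ⟨h x (Set.mem_insert _ _) q (Set.mem_insert_of_mem _ hq),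
       h q (Set.mem_insert_of_mem _ hq) x (Set.mem_insert _ _)⟩⟩
  · rintro ⟨h, h'⟩
    exact NC_insert h h'

theorem NC_swap {J : Set (ℤ × ℤ)} (hJ : NC J) : NC (Prod.swap ⁻¹' J) := by
  intro p hp q hq h
  exact hJ _ hp _ hq ⟨h.2, h.1⟩

theorem swap_insert (J : Set (ℤ × ℤ)) (a b : ℤ) :
    (Prod.swap ⁻¹' (insert (a, b) J) : Set (ℤ × ℤ)) = insert (b, a) (Prod.swap ⁻¹' J) := by
  ext ⟨x, y⟩
  simp [Prod.ext_iff, and_comm]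

theorem swap_swap (J : Set (ℤ × ℤ)) :
    (Prod.swap ⁻¹' (Prod.swap ⁻¹' J) : Set (ℤ × ℤ)) = J := by
  ext ⟨x, y⟩
  simp

theorem NC_swap_iff {J : Set (ℤ × ℤ)} : NC (Prod.swap ⁻¹' J) ↔ NC J :=
  ⟨fun h => by simpa [swap_swap] using NC_swap h, NC_swap⟩

theorem finite_swap {J : Set (ℤ × ℤ)} (hf : J.Finite) : (Prod.swap ⁻¹' J : Set (ℤ × ℤ)).Finite :=
  hf.preimage Prod.swap_injective.injOn

theorem MaxJ_swap {J : Set (ℤ × ℤ)} (hJ : MaxJ J) : MaxJ (Prod.swap ⁻¹' J) := by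
  rintro ⟨p1, p2⟩ hp ⟨q1, q2⟩ hq h
  have := hJ _ hq _ hp
  simp only [Prod.swap] at this
  apply this
  rw [← NC_swap_iff, swap_insert]
  exact h

/-- Column insertion, existence. -/
theorem ins_exists {J : Set (ℤ × ℤ)} (hf : J.Finite) (hJ : NC J) (a : ℤ)
    (h : ∃ p ∈ J, p.1 < a) : ∃ p ∈ J, NC (insert (a, p.2) J) := by
  obtain ⟨p, ⟨hpJ, hpa⟩, hmin⟩ := Set.exists_min_image {p ∈ J | p.1 < a} Prod.snd
    (hf.subset (fun _ h => h.1)) (by obtain ⟨p, h1, h2⟩ := h; exact ⟨p, h1, h2⟩)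
  refine ⟨p, hpJ, NC_insert hJ fun q hq => ⟨fun hh => ?_, fun hh => ?_⟩⟩
  · have := hJ p hpJ q hq
    simp only at hh; omega
  · have := hmin q ⟨hq, hh.1⟩
    simp only at hh; omega

/-- Column insertion, uniqueness. -/
theorem ins_unique_lt {J : Set (ℤ × ℤ)} (hf : J.Finite) (hJ : NC J) (hm : MaxJ J) (a : ℤ)
    (ha : ∀ p ∈ J, p.1 ≠ a) {p q : ℤ × ℤ} (hp : p ∈ J) (hq : q ∈ J)
    (h1 : NC (insert (a, p.2) J)) (h2 : NC (insert (a, q.2) J)) (hlt : p.2 < q.2) : False := by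
  rw [NC_insert_iff] at h1 h2
  have hqa : q.1 < a := by
    have := ha q hq
    have := (h1.2 q hq).1
    simp only at this; omega
  obtain ⟨c, ⟨hcJ, hca⟩, hmax⟩ := Set.exists_max_image {p ∈ J | p.1 < a} Prod.fst
    (hf.subset (fun _ h => h.1)) ⟨q, hq, hqa⟩
  have : (c.1, p.2) ∈ J := by
    apply hm c hcJ p hp
    refine NC_insert hJ fun r hr => ⟨fun hh => ?_, fun hh => ?_⟩
    · simp only at hh
      have h3 := (h1.2 r hr).1
      have h4 := hmax r
      have h5 := ha r hr
      simp only at h3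
      have : ¬ r.1 < a := fun h => by have := h4 ⟨hr, h⟩; omega
      omega
    · simp only at hh
      have h3 := (h2.2 r hr).2
      simp only at h3; omega
  have := (h2.2 _ this).2
  simp only at this; omega

theorem ins_unique {J : Set (ℤ × ℤ)} (hf : J.Finite) (hJ : NC J) (hm : MaxJ J) (a : ℤ)
    (ha : ∀ p ∈ J, p.1 ≠ a) {p q : ℤ × ℤ} (hp : p ∈ J) (hq : q ∈ J)
    (h1 : NC (insert (a, p.2) J)) (h2 : NC (insert (a, q.2) J)) : p.2 = q.2 := by
  rcases lt_trichotomy p.2 q.2 with h | h | h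
  · exact (ins_unique_lt hf hJ hm a ha hp hq h1 h2 h).elim
  · exact h
  · exact (ins_unique_lt hf hJ hm a ha hq hp h2 h1 h).elim

/-- The predecessor of an element on a maximal path. -/
theorem path_pred {J : Set (ℤ × ℤ)} (hf : J.Finite) (hJ : NC J) (hm : MaxJ J) {e : ℤ × ℤ}
    (he : e ∈ J) (h : ∃ q ∈ J, q.1 - q.2 < e.1 - e.2) :
    ∃ p ∈ J, ((p.1 = e.1 ∧ e.2 < p.2) ∨ (p.1 < e.1 ∧ p.2 = e.2)) ∧
      ∀ q ∈ J, q.1 - q.2 ≤ p.1 - p.2 ∨ e.1 - e.2 ≤ q.1 - q.2 := by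
  obtain ⟨p, ⟨hpJ, hpe⟩, hmax⟩ := Set.exists_max_image {q ∈ J | q.1 - q.2 < e.1 - e.2}
    (fun q => q.1 - q.2) (hf.subset (fun _ h => h.1))
    (by obtain ⟨p, h1, h2⟩ := h; exact ⟨p, h1, h2⟩)
  have hmx : ∀ q ∈ J, q.1 - q.2 ≤ p.1 - p.2 ∨ e.1 - e.2 ≤ q.1 - q.2 := by
    intro q hq
    by_cases hh : q.1 - q.2 < e.1 - e.2
    · exact Or.inl (hmax q ⟨hq, hh⟩)
    · right; omega
  refine ⟨p, hpJ, ?_, hmx⟩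
  have h1 := hJ p hpJ e he
  have h2 := hJ e he p hpJ
  by_contra hcon
  have h3 : p.1 < e.1 ∧ e.2 < p.2 := by omega
  have : (p.1, e.2) ∈ J := by
    apply hm p hpJ e he
    refine NC_insert hJ fun q hq => ⟨fun hh => ?_, fun hh => ?_⟩
    · simp only at hh
      have := hJ p hpJ q hq
      have := hJ e he q hq
      have := hmx q hq
      omega
    · simp only at hh
      have := hJ q hq p hpJ
      omega
  have := hmx _ this
  simp only at this; omega

theorem path_succ {J : Set (ℤ × ℤ)} (hf : J.Finite) (hJ : NC J) (hm : MaxJ J) {e : ℤ × ℤ}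
    (he : e ∈ J) (h : ∃ q ∈ J, e.1 - e.2 < q.1 - q.2) :
    ∃ p ∈ J, ((p.2 = e.2 ∧ e.1 < p.1) ∨ (p.2 < e.2 ∧ p.1 = e.1)) ∧
      ∀ q ∈ J, p.1 - p.2 ≤ q.1 - q.2 ∨ q.1 - q.2 ≤ e.1 - e.2 := by
  obtain ⟨q, hq, hqe⟩ := h
  obtain ⟨p, hp, h1, h2⟩ := path_pred (finite_swap hf) (NC_swap hJ) (MaxJ_swap hm)
    (e := e.swap) (by simpa using he) ⟨q.swap, by simpa using hq, by simp; omega⟩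
  refine ⟨p.swap, hp, by simpa using h1, fun r hr => ?_⟩
  have := h2 r.swap (by simpa using hr)
  simp at this ⊢
  omega

set_option maxHeartbeats 1000000 in
/-- Trichotomy (up to symmetry) for interior elements of a maximal path. -/
theorem path_cases {J : Set (ℤ × ℤ)} (hf : J.Finite) (hJ : NC J) (hm : MaxJ J) {e : ℤ × ℤ}
    (he : e ∈ J) (h1 : ∃ q ∈ J, q.1 - q.2 < e.1 - e.2) (h2 : ∃ q ∈ J, e.1 - e.2 < q.1 - q.2) :
    (∃ g, g ≠ e ∧ g ∉ J ∧ (∃ p ∈ J \ {e}, p.1 = g.1) ∧ (∃ p ∈ J \ {e}, p.2 = g.2) ∧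
      (∃ p ∈ J \ {e}, p.1 = e.1) ∧ (∃ p ∈ J \ {e}, p.2 = e.2) ∧ NC (insert g (J \ {e})) ∧
      ∀ p ∈ J, ∀ q ∈ J, (p.1, q.2) ∉ J \ {e} → NC (insert (p.1, q.2) (J \ {e})) →
        (p.1, q.2) = e ∨ (p.1, q.2) = g) ∨
    ((∃ p ∈ J \ {e}, p.1 = e.1) ∧ (∀ p ∈ J \ {e}, p.2 ≠ e.2) ∧ MaxJ (J \ {e})) ∨
    ((∃ p ∈ J \ {e}, p.2 = e.2) ∧ (∀ p ∈ J \ {e}, p.1 ≠ e.1) ∧ MaxJ (J \ {e})) := by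
  obtain ⟨p, hp, hp1, hp2⟩ := path_pred hf hJ hm he h1
  obtain ⟨s, hs, hs1, hs2⟩ := path_succ hf hJ hm he h2
  have hNC' : NC (J \ {e}) := hJ.mono Set.sdiff_subset
  have hpe : p ∈ J \ {e} := ⟨hp, fun h => by rw [Set.mem_singleton_iff] at h; subst h; omega⟩
  have hse : s ∈ J \ {e} := ⟨hs, fun h => by rw [Set.mem_singleton_iff] at h; subst h; omega⟩
  have hJps : ∀ q ∈ J \ {e}, q.1 - q.2 ≤ p.1 - p.2 ∨ s.1 - s.2 ≤ q.1 - q.2 := by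
    intro q hq
    have h3 := hp2 q hq.1
    have h4 := hs2 q hq.1
    have h5 := hJ q hq.1 e he
    have h6 := hJ e he q hq.1
    have h7 : q.1 ≠ e.1 ∨ q.2 ≠ e.2 := by
      by_contra hcon
      push Not at hcon
      exact hq.2 (Prod.ext hcon.1 hcon.2)
    omega
  -- comparison with all elements of `J`
  have hcmpP : ∀ q ∈ J, ¬ (p.1 < q.1 ∧ p.2 < q.2) ∧ ¬ (q.1 < p.1 ∧ q.2 < p.2) :=
    fun q hq => ⟨hJ p hp q hq, hJ q hq p hp⟩
  have hcmpS : ∀ q ∈ J, ¬ (s.1 < q.1 ∧ s.2 < q.2) ∧ ¬ (q.1 < s.1 ∧ q.2 < s.2) :=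
    fun q hq => ⟨hJ s hs q hq, hJ q hq s hs⟩
  have hcmpE : ∀ q ∈ J, ¬ (e.1 < q.1 ∧ e.2 < q.2) ∧ ¬ (q.1 < e.1 ∧ q.2 < e.2) :=
    fun q hq => ⟨hJ e he q hq, hJ q hq e he⟩
  -- maximality of the truncated path in the straight cases
  have hmax' : (p.1 = e.1 ∧ s.1 = e.1) ∨ (p.2 = e.2 ∧ s.2 = e.2) → MaxJ (J \ {e}) := by
    intro hst x hx y hy hxy
    have hxe : (x.1, y.2) ∈ J := by
      apply hm x hx.1 y hy.1
      rw [NC_insert_iff] at hxy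
      refine NC_insert hJ fun q hq => ?_
      by_cases hqe : q = e
      · subst hqe
        have h3 := hxy.2 p hpe
        have h4 := hxy.2 s hse
        simp only at h3 h4 ⊢
        omega
      · exact hxy.2 q ⟨hq, hqe⟩
    refine ⟨hxe, fun hc => ?_⟩
    have hc : (x.1, y.2) = e := hc
    have hc1 : x.1 = e.1 := by rw [← hc]
    have hc2 : y.2 = e.2 := by rw [← hc]
    have := hJps x hx
    have := hJps y hy
    have := hcmpP x hx.1
    have := hcmpP y hy.1
    have := hcmpS x hx.1
    have := hcmpS y hy.1
    omega
  -- the corner case, generic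
  have hcorner : ∀ g : ℤ × ℤ, (p.1 = e.1 ∧ s.2 = e.2 ∧ g = (s.1, p.2)) ∨
      (p.2 = e.2 ∧ s.1 = e.1 ∧ g = (p.1, s.2)) → g ≠ e ∧ g ∉ J ∧ NC (insert g (J \ {e})) ∧
      ∀ p ∈ J, ∀ q ∈ J, (p.1, q.2) ∉ J \ {e} → NC (insert (p.1, q.2) (J \ {e})) →
        (p.1, q.2) = e ∨ (p.1, q.2) = g := by
    intro g hg
    have hgc : (p.1 = e.1 ∧ s.2 = e.2 ∧ g.1 = s.1 ∧ g.2 = p.2) ∨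
      (p.2 = e.2 ∧ s.1 = e.1 ∧ g.1 = p.1 ∧ g.2 = s.2) := by
      rcases hg with ⟨h3, h4, rfl⟩ | ⟨h3, h4, rfl⟩ <;> simp [h3, h4]
    refine ⟨fun h => by subst h; omega, fun h => ?_, ?_, ?_⟩
    · have := hcmpE g h
      omega
    · refine NC_insert hNC' fun q hq => ?_
      have := hJps q hq
      have := hcmpP q hq.1
      have := hcmpS q hq.1
      have := hcmpE q hq.1
      omega
    · intro x hx y hy hn hxy
      by_cases hxe : (x.1, y.2) = e
      · exact Or.inl hxe
      right
      have hnJ : (x.1, y.2) ∉ J := fun h => hn ⟨h, hxe⟩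
      have hinc : (x.1 < e.1 ∧ y.2 < e.2) ∨ (e.1 < x.1 ∧ e.2 < y.2) := by
        by_contra hcon
        apply hnJ
        apply hm x hx y hy
        rw [NC_insert_iff] at hxy
        refine NC_insert hJ fun q hq => ?_
        by_cases hqe : q = e
        · subst hqe
          simp only; omega
        · exact hxy.2 q ⟨hq, hqe⟩
      rw [NC_insert_iff] at hxy
      have h3 := hxy.2 p hpe
      have h4 := hxy.2 s hse
      simp only at h3 h4
      have hxx : x ≠ e := by rintro rfl; omega
      have hyy : y ≠ e := by rintro rfl; omega
      have hgx : x.1 = g.1 := by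
        have k1 := hJps x ⟨hx, hxx⟩
        have k2 := hcmpP x hx
        have k3 := hcmpS x hx
        clear hcmpE hcmpP hcmpS hJps
        rcases hgc with hgc | hgc <;> rcases hinc with hinc | hinc <;> rcases k1 with k1 | k1 <;>
          omega
      have hgy : y.2 = g.2 := by
        have k1 := hJps y ⟨hy, hyy⟩
        have k2 := hcmpP y hy
        have k3 := hcmpS y hy
        clear hcmpE hcmpP hcmpS hJps
        rcases hgc with hgc | hgc <;> rcases hinc with hinc | hinc <;> rcases k1 with k1 | k1 <;>
          omega
      exact Prod.ext hgx hgy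
  rcases hp1 with ⟨h3, h4⟩ | ⟨h3, h4⟩ <;> rcases hs1 with ⟨h5, h6⟩ | ⟨h5, h6⟩
  · left
    obtain ⟨k1, k2, k3, k4⟩ := hcorner (s.1, p.2) (Or.inl ⟨h3, h5, rfl⟩)
    exact ⟨(s.1, p.2), k1, k2, ⟨s, hse, rfl⟩, ⟨p, hpe, rfl⟩, ⟨p, hpe, h3⟩, ⟨s, hse, h5⟩, k3, k4⟩
  · right; left
    refine ⟨⟨p, hpe, h3⟩, fun q hq h => ?_, hmax' (Or.inl ⟨h3, h6⟩)⟩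
    have := hJps q hq
    have := hcmpP q hq.1
    have := hcmpS q hq.1
    omega
  · right; right
    refine ⟨⟨p, hpe, h4⟩, fun q hq h => ?_, hmax' (Or.inr ⟨h4, h5⟩)⟩
    have := hJps q hq
    have := hcmpP q hq.1
    have := hcmpS q hq.1
    omega
  · left
    obtain ⟨k1, k2, k3, k4⟩ := hcorner (p.1, s.2) (Or.inr ⟨h4, h6, rfl⟩)
    exact ⟨(p.1, s.2), k1, k2, ⟨p, hpe, rfl⟩, ⟨s, hse, rfl⟩, ⟨s, hse, h6⟩, ⟨p, hpe, h4⟩, k3, k4⟩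

end

section

/-- Projection of a set of elements of the path complex. -/
def prj {X : Type*} (u v : ℤ → X) (S : Set (X ⊕ ℤ × ℤ)) : Set X :=
  {x | Sum.inl x ∈ S ∨ ∃ p, Sum.inr p ∈ S ∧ (x = u p.1 ∨ x = v p.2)}

/-- The path complex over a complex `F`. -/
def FJ {X : Type*} (F : Set X → Prop) (u v : ℤ → X) (U V : Set ℤ) (S : Set (X ⊕ ℤ × ℤ)) : Prop :=
  (∀ x, Sum.inl x ∈ S → (∀ a ∈ U, x ≠ u a) ∧ ∀ b ∈ V, x ≠ v b) ∧
  (∀ p, Sum.inr p ∈ S → p.1 ∈ U ∧ p.2 ∈ V) ∧ F (prj u v S) ∧ NC (Sum.inr ⁻¹' S)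

/-- Standing assumptions for the path complex. -/
structure Dat {X : Type*} (F : Set X → Prop) (C : Set X) (u v : ℤ → X) (U V : Set ℤ)
    (a0 a1 b0 b1 : ℤ) : Prop where
  mono : ∀ S S', S ⊆ S' → F S' → F S
  fin : ∀ S, F S → S.Finite
  hu : Function.Injective u
  hv : Function.Injective v
  huv : ∀ a b, u a ≠ v b
  ha0 : a0 ∈ U
  ha1 : a1 ∈ U
  hb0 : b0 ∈ V
  hb1 : b1 ∈ V
  hU : ∀ a ∈ U, a0 ≤ a ∧ a ≤ a1
  hV : ∀ b ∈ V, b0 ≤ b ∧ b ≤ b1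
  ca0 : ∀ S, F S → F (insert (u a0) S)
  ca1 : ∀ S, F S → F (insert (u a1) S)
  cb0 : ∀ S, F S → F (insert (v b0) S)
  cb1 : ∀ S, F S → F (insert (v b1) S)
  hCu : ∀ a ∈ U, u a ∈ C → a = a0 ∨ a = a1
  hCv : ∀ b ∈ V, v b ∈ C → b = b0 ∨ b = b1

section
variable {X : Type*} {F : Set X → Prop} {C : Set X} {u v : ℤ → X} {U V : Set ℤ}
  {a0 a1 b0 b1 : ℤ}

theorem prj_insert_inl (x : X) (S : Set (X ⊕ ℤ × ℤ)) :
    prj u v (insert (Sum.inl x) S) = insert x (prj u v S) := by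
  ext z
  simp [prj, or_assoc]

theorem prj_insert_inr (p : ℤ × ℤ) (S : Set (X ⊕ ℤ × ℤ)) :
    prj u v (insert (Sum.inr p) S) = insert (u p.1) (insert (v p.2) (prj u v S)) := by
  ext z
  simp only [prj, Set.mem_insert_iff, Set.mem_ofPred_eq, reduceCtorEq, false_or, Sum.inr.injEq]
  constructor
  · rintro (h | ⟨q, rfl | h, h' | h'⟩)
    · tauto
    · tauto
    · tauto
    · exact Or.inr (Or.inr (Or.inr ⟨q, h, Or.inl h'⟩))
    · exact Or.inr (Or.inr (Or.inr ⟨q, h, Or.inr h'⟩))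
  · rintro (h | h | h | ⟨q, h, h'⟩)
    · exact Or.inr ⟨p, Or.inl rfl, Or.inl h⟩
    · exact Or.inr ⟨p, Or.inl rfl, Or.inr h⟩
    · exact Or.inl h
    · exact Or.inr ⟨q, Or.inr h, h'⟩

theorem prj_mono {S S' : Set (X ⊕ ℤ × ℤ)} (h : S ⊆ S') : prj u v S ⊆ prj u v S' := by
  rintro x (hx | ⟨p, hp, hx⟩)
  · exact Or.inl (h hx)
  · exact Or.inr ⟨p, h hp, hx⟩

theorem inr_preimage_inl (x : X) (S : Set (X ⊕ ℤ × ℤ)) :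
    (Sum.inr ⁻¹' (insert (Sum.inl x) S) : Set (ℤ × ℤ)) = Sum.inr ⁻¹' S := by
  ext z; simp

theorem inr_preimage_inr (p : ℤ × ℤ) (S : Set (X ⊕ ℤ × ℤ)) :
    (Sum.inr ⁻¹' (insert (Sum.inr p) S) : Set (ℤ × ℤ)) = insert p (Sum.inr ⁻¹' S) := by
  ext z; simp

theorem FJ_mono (D : Dat F C u v U V a0 a1 b0 b1) {S S' : Set (X ⊕ ℤ × ℤ)} (h : S ⊆ S')
    (hS : FJ F u v U V S') : FJ F u v U V S :=
  ⟨fun x hx => hS.1 x (h hx), fun p hp => hS.2.1 p (h hp),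
    D.mono _ _ (prj_mono h) hS.2.2.1, hS.2.2.2.mono (Set.preimage_mono h)⟩

theorem FJ_insert_inl {S : Set (X ⊕ ℤ × ℤ)} (hS : FJ F u v U V S) {x : X}
    (h1 : ∀ a ∈ U, x ≠ u a) (h2 : ∀ b ∈ V, x ≠ v b) (h3 : F (insert x (prj u v S))) :
    FJ F u v U V (insert (Sum.inl x) S) := by
  refine ⟨?_, ?_, ?_, ?_⟩
  · rintro y (hy | hy)
    · cases hy; exact ⟨h1, h2⟩
    · exact hS.1 y hy
  · rintro p (hp | hp)
    · cases hp
    · exact hS.2.1 p hp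
  · rwa [prj_insert_inl]
  · rw [inr_preimage_inl]; exact hS.2.2.2

theorem FJ_insert_inr {S : Set (X ⊕ ℤ × ℤ)} (hS : FJ F u v U V S) {p : ℤ × ℤ}
    (h1 : p.1 ∈ U) (h2 : p.2 ∈ V) (h3 : F (insert (u p.1) (insert (v p.2) (prj u v S))))
    (h4 : NC (insert p (Sum.inr ⁻¹' S))) :
    FJ F u v U V (insert (Sum.inr p) S) := by
  refine ⟨?_, ?_, ?_, ?_⟩
  · rintro y (hy | hy)
    · cases hy
    · exact hS.1 y hy
  · rintro q (hq | hq)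
    · cases hq; exact ⟨h1, h2⟩
    · exact hS.2.1 q hq
  · rwa [prj_insert_inr]
  · rwa [inr_preimage_inr]

theorem mem_prj_u (D : Dat F C u v U V a0 a1 b0 b1) {S : Set (X ⊕ ℤ × ℤ)}
    (hS : FJ F u v U V S) {a : ℤ} (ha : a ∈ U) :
    u a ∈ prj u v S ↔ ∃ p, Sum.inr p ∈ S ∧ p.1 = a := by
  constructor
  · rintro (h | ⟨p, hp, h | h⟩)
    · exact ((hS.1 _ h).1 a ha rfl).elim
    · exact ⟨p, hp, (D.hu h).symm⟩
    · exact (D.huv _ _ h).elim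
  · rintro ⟨p, hp, rfl⟩
    exact Or.inr ⟨p, hp, Or.inl rfl⟩

theorem mem_prj_v (D : Dat F C u v U V a0 a1 b0 b1) {S : Set (X ⊕ ℤ × ℤ)}
    (hS : FJ F u v U V S) {b : ℤ} (hb : b ∈ V) :
    v b ∈ prj u v S ↔ ∃ p, Sum.inr p ∈ S ∧ p.2 = b := by
  constructor
  · rintro (h | ⟨p, hp, h | h⟩)
    · exact ((hS.1 _ h).2 b hb rfl).elim
    · exact (D.huv _ _ h.symm).elim
    · exact ⟨p, hp, (D.hv h).symm⟩
  · rintro ⟨p, hp, rfl⟩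
    exact Or.inr ⟨p, hp, Or.inr rfl⟩

theorem finite_J (D : Dat F C u v U V a0 a1 b0 b1) {S : Set (X ⊕ ℤ × ℤ)}
    (hS : FJ F u v U V S) : (Sum.inr ⁻¹' S : Set (ℤ × ℤ)).Finite := by
  have hP := D.fin _ hS.2.2.1
  have h1 : (u ⁻¹' prj u v S).Finite := hP.preimage D.hu.injOn
  have h2 : (v ⁻¹' prj u v S).Finite := hP.preimage D.hv.injOn
  refine (h1.prod h2).subset ?_
  intro p hp
  exact ⟨Or.inr ⟨p, hp, Or.inl rfl⟩, Or.inr ⟨p, hp, Or.inr rfl⟩⟩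

/-- Insertion of a projected element, existence. -/
theorem lift_exists (D : Dat F C u v U V a0 a1 b0 b1) {E : Set (X ⊕ ℤ × ℤ)}
    (hE : FJ F u v U V E) (he1 : Sum.inr (a0, b1) ∈ E) (he2 : Sum.inr (a1, b0) ∈ E)
    {z : X} (hz : z ∉ prj u v E) (hFz : F (insert z (prj u v E))) :
    ∃ y, y ∉ E ∧ FJ F u v U V (insert y E) ∧ z ∈ prj u v {y} := by
  have hf := finite_J D hE
  by_cases hu : ∃ a ∈ U, z = u a
  · obtain ⟨a, ha, rfl⟩ := hu
    have haa : a0 ≠ a := by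
      rintro rfl
      exact hz ((mem_prj_u D hE ha).2 ⟨_, he1, rfl⟩)
    obtain ⟨p, hp, hNC⟩ := ins_exists hf hE.2.2.2 a ⟨(a0, b1), he1, by
      have := D.hU a ha; simp only; omega⟩
    refine ⟨Sum.inr (a, p.2), fun h => hz ((mem_prj_u D hE ha).2 ⟨_, h, rfl⟩),
      FJ_insert_inr hE ha (hE.2.1 p hp).2 ?_ hNC, ?_⟩
    · rw [Set.insert_eq_of_mem (a := v _)]
      · exact hFz
      · exact Or.inr ⟨p, hp, Or.inr rfl⟩
    · exact Or.inr ⟨_, rfl, Or.inl rfl⟩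
  by_cases hv : ∃ b ∈ V, z = v b
  · obtain ⟨b, hb, rfl⟩ := hv
    have hbb : b0 ≠ b := by
      rintro rfl
      exact hz ((mem_prj_v D hE hb).2 ⟨_, he2, rfl⟩)
    obtain ⟨p, hp, hNC⟩ := ins_exists (finite_swap hf) (NC_swap hE.2.2.2) b ⟨(b0, a1), he2, by
      have := D.hV b hb; simp only; omega⟩
    rw [← swap_insert, NC_swap_iff] at hNC
    refine ⟨Sum.inr (p.2, b), fun h => hz ((mem_prj_v D hE hb).2 ⟨_, h, rfl⟩),
      FJ_insert_inr hE (hE.2.1 _ hp).1 hb ?_ hNC, ?_⟩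
    · rw [Set.insert_comm, Set.insert_eq_of_mem (a := u _)]
      · exact hFz
      · exact Or.inr ⟨_, hp, Or.inl rfl⟩
    · exact Or.inr ⟨_, rfl, Or.inr rfl⟩
  · push Not at hu hv
    exact ⟨Sum.inl z, fun h => hz (Or.inl h), FJ_insert_inl hE hu hv hFz, Or.inl rfl⟩

/-- Insertion of a projected element, uniqueness. -/
theorem lift_unique (D : Dat F C u v U V a0 a1 b0 b1) {E : Set (X ⊕ ℤ × ℤ)}
    (hE : FJ F u v U V E) (hm : MaxJ (Sum.inr ⁻¹' E))
    {z : X} (hz : z ∉ prj u v E)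
    (hz2 : ∀ w, w ∉ prj u v E → F (insert w (insert z (prj u v E))) → w = z)
    {y y' : X ⊕ ℤ × ℤ} (h1 : FJ F u v U V (insert y E)) (h2 : z ∈ prj u v {y})
    (h1' : FJ F u v U V (insert y' E)) (h2' : z ∈ prj u v {y'}) : y = y' := by
  have hf := finite_J D hE
  -- description of the possible `y`
  have key : ∀ y, FJ F u v U V (insert y E) → z ∈ prj u v {y} →
      (y = Sum.inl z ∧ (∀ a ∈ U, z ≠ u a) ∧ (∀ b ∈ V, z ≠ v b)) ∨
      (∃ a ∈ U, z = u a ∧ ∃ p ∈ Sum.inr ⁻¹' E, y = Sum.inr (a, p.2) ∧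
        NC (insert (a, p.2) (Sum.inr ⁻¹' E))) ∨
      (∃ b ∈ V, z = v b ∧ ∃ p ∈ Sum.inr ⁻¹' E, y = Sum.inr (p.1, b) ∧
        NC (insert (p.1, b) (Sum.inr ⁻¹' E))) := by
    intro y hy hzy
    rcases hzy with h | ⟨p, hp, h | h⟩
    · have h : y = Sum.inl z := h.symm
      subst h
      exact Or.inl ⟨rfl, (hy.1 z (Or.inl rfl)).1, (hy.1 z (Or.inl rfl)).2⟩
    · have hp : y = Sum.inr p := hp.symm
      subst hp
      right; left
      have hpU := hy.2.1 p (Or.inl rfl)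
      have hNC := hy.2.2.2
      have hF := hy.2.2.1
      rw [inr_preimage_inr] at hNC
      rw [prj_insert_inr, ← h, Set.insert_comm] at hF
      have hvp : v p.2 ∈ prj u v E := by
        by_contra hc
        have := hz2 _ hc hF
        rw [h] at this
        exact D.huv _ _ this.symm
      obtain ⟨q, hq, hqp⟩ := (mem_prj_v D hE hpU.2).1 hvp
      exact ⟨p.1, hpU.1, h, q, hq, by rw [hqp], by rw [hqp]; exact hNC⟩
    · have hp : y = Sum.inr p := hp.symm
      subst hp
      right; right
      have hpU := hy.2.1 p (Or.inl rfl)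
      have hNC := hy.2.2.2
      have hF := hy.2.2.1
      rw [inr_preimage_inr] at hNC
      rw [prj_insert_inr, ← h] at hF
      have hvp : u p.1 ∈ prj u v E := by
        by_contra hc
        have := hz2 _ hc hF
        rw [h] at this
        exact D.huv _ _ this
      obtain ⟨q, hq, hqp⟩ := (mem_prj_u D hE hpU.1).1 hvp
      exact ⟨p.2, hpU.2, h, q, hq, by rw [hqp], by rw [hqp]; exact hNC⟩
  rcases key y h1 h2 with ⟨rfl, hu, hv⟩ | ⟨a, ha, hza, p, hp, rfl, hNC⟩ | ⟨b, hb, hzb, p, hp, rfl, hNC⟩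
  · rcases key y' h1' h2' with ⟨rfl, _, _⟩ | ⟨a', ha', hza', _⟩ | ⟨b', hb', hzb', _⟩
    · rfl
    · exact (hu _ ha' hza').elim
    · exact (hv _ hb' hzb').elim
  · rcases key y' h1' h2' with ⟨_, hu, _⟩ | ⟨a', ha', hza', p', hp', rfl, hNC'⟩ | ⟨b', hb', hzb', _⟩
    · exact (hu _ ha hza).elim
    · have : a = a' := D.hu (hza.symm.trans hza')
      subst this
      have := ins_unique hf hE.2.2.2 hm a (by
        intro q hq hqa
        exact hz (by rw [hza, mem_prj_u D hE ha]; exact ⟨q, hq, hqa⟩)) hp hp' hNC hNC'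
      rw [this]
    · exact (D.huv _ _ (hza.symm.trans hzb')).elim
  · rcases key y' h1' h2' with ⟨_, _, hv⟩ | ⟨a', ha', hza', _⟩ | ⟨b', hb', hzb', p', hp', rfl, hNC'⟩
    · exact (hv _ hb hzb).elim
    · exact (D.huv _ _ (hza'.symm.trans hzb)).elim
    · have : b = b' := D.hv (hzb.symm.trans hzb')
      subst this
      rw [← NC_swap_iff, swap_insert] at hNC hNC'
      have := ins_unique (finite_swap hf) (NC_swap hE.2.2.2) (MaxJ_swap hm) b (by
        intro q hq hqa
        exact hz (by rw [hzb, mem_prj_v D hE hb]; exact ⟨_, hq, hqa⟩)) 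
        (p := p.swap) (q := p'.swap) (by simpa using hp) (by simpa using hp') hNC hNC'
      simp only [Prod.snd_swap] at this
      rw [this]

theorem facet_ends (D : Dat F C u v U V a0 a1 b0 b1) {T : Set (X ⊕ ℤ × ℤ)}
    (hT : Facet (FJ F u v U V) T) : Sum.inr (a0, b1) ∈ T ∧ Sum.inr (a1, b0) ∈ T := by
  constructor
  · apply hT.2
    refine FJ_insert_inr hT.1 D.ha0 D.hb1 (D.ca0 _ (D.cb1 _ hT.1.2.2.1)) ?_
    refine NC_insert hT.1.2.2.2 fun q hq => ?_
    have h := hT.1.2.1 q hq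
    have := D.hU _ h.1
    have := D.hV _ h.2
    simp only; omega
  · apply hT.2
    refine FJ_insert_inr hT.1 D.ha1 D.hb0 (D.ca1 _ (D.cb0 _ hT.1.2.2.1)) ?_
    refine NC_insert hT.1.2.2.2 fun q hq => ?_
    have h := hT.1.2.1 q hq
    have := D.hU _ h.1
    have := D.hV _ h.2
    simp only; omega

theorem facet_prj (D : Dat F C u v U V a0 a1 b0 b1) {T : Set (X ⊕ ℤ × ℤ)}
    (hT : Facet (FJ F u v U V) T) : Facet F (prj u v T) := by
  refine ⟨hT.1.2.2.1, fun z hz => ?_⟩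
  by_contra hc
  obtain ⟨y, h1, h2, -⟩ := lift_exists D hT.1 (facet_ends D hT).1 (facet_ends D hT).2 hc hz
  exact h1 (hT.2 y h2)

theorem facet_maxJ (D : Dat F C u v U V a0 a1 b0 b1) {T : Set (X ⊕ ℤ × ℤ)}
    (hT : Facet (FJ F u v U V) T) : MaxJ (Sum.inr ⁻¹' T) := by
  intro p hp q hq h
  apply hT.2
  refine FJ_insert_inr hT.1 (hT.1.2.1 p hp).1 (hT.1.2.1 q hq).2 ?_ h
  rw [Set.insert_eq_of_mem (a := v _), Set.insert_eq_of_mem (a := u _)]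
  · exact hT.1.2.2.1
  · exact Or.inr ⟨p, hp, Or.inl rfl⟩
  · exact Or.inr ⟨q, hq, Or.inr rfl⟩

/-- The generic flip step: the projection of `E` is a facet minus one element. -/
theorem lift_flip (D : Dat F C u v U V a0 a1 b0 b1) {E : Set (X ⊕ ℤ × ℤ)}
    (hE : FJ F u v U V E) (he1 : Sum.inr (a0, b1) ∈ E) (he2 : Sum.inr (a1, b0) ∈ E)
    (hm : MaxJ (Sum.inr ⁻¹' E)) {x f : X} (hxf : f ≠ x)
    (hG : ∀ y, (y ∉ prj u v E ∧ F (insert y (prj u v E))) ↔ (y = x ∨ y = f))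
    (hinc : ¬ F (insert x (insert f (prj u v E)))) {e : X ⊕ ℤ × ℤ}
    (heE : e ∉ E) (hFe : FJ F u v U V (insert e E)) :
    ∃ g, g ≠ e ∧ ∀ y, (y ∉ E ∧ FJ F u v U V (insert y E)) ↔ (y = e ∨ y = g) := by
  have hx := (hG x).2 (Or.inl rfl)
  have hf := (hG f).2 (Or.inr rfl)
  have hinc' : ¬ F (insert f (insert x (prj u v E))) := by rwa [Set.insert_comm]
  have hz2 : ∀ z, (z = x ∨ z = f) → ∀ w, w ∉ prj u v E →
      F (insert w (insert z (prj u v E))) → w = z := by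
    intro z hz w hw hF
    have hw' := (hG w).1 ⟨hw, D.mono _ _ (Set.insert_subset_insert (Set.subset_insert _ _)) hF⟩
    rcases hz with rfl | rfl <;> rcases hw' with rfl | rfl
    · rfl
    · exact (hinc' hF).elim
    · exact (hinc hF).elim
    · rfl
  obtain ⟨yx, x1, x2, x3⟩ := lift_exists D hE he1 he2 hx.1 hx.2
  obtain ⟨yf, f1, f2, f3⟩ := lift_exists D hE he1 he2 hf.1 hf.2
  have hne : yx ≠ yf := by
    rintro rfl
    apply hinc
    refine D.mono _ _ ?_ x2.2.2.1
    rintro w (rfl | rfl | hw)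
    · exact prj_mono (by simp) x3
    · exact prj_mono (by simp) f3
    · exact prj_mono (by simp) hw
  have hall : ∀ y, (y ∉ E ∧ FJ F u v U V (insert y E)) ↔ (y = yx ∨ y = yf) := by
    intro y
    constructor
    · rintro ⟨hy1, hy2⟩
      have : ∃ z ∈ prj u v {y}, z ∉ prj u v E := by
        by_contra hc
        push Not at hc
        apply hy1
        rcases y with z | p
        · rcases hc z (Or.inl rfl) with h | ⟨p, hp, h | h⟩
          · exact h
          · exact ((hy2.1 z (Or.inl rfl)).1 p.1 (hE.2.1 p hp).1 h).elim
          · exact ((hy2.1 z (Or.inl rfl)).2 p.2 (hE.2.1 p hp).2 h).elim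
        · have hp := hy2.2.1 p (Or.inl rfl)
          obtain ⟨q, hq, hq'⟩ := (mem_prj_u D hE hp.1).1 (hc _ (Or.inr ⟨p, rfl, Or.inl rfl⟩))
          obtain ⟨r, hr, hr'⟩ := (mem_prj_v D hE hp.2).1 (hc _ (Or.inr ⟨p, rfl, Or.inr rfl⟩))
          have hNC := hy2.2.2.2
          rw [inr_preimage_inr] at hNC
          have := hm q hq r hr
          rw [hq', hr'] at this
          exact this hNC
      obtain ⟨z, hz1, hz3⟩ := this
      have hz4 : z = x ∨ z = f := by
        apply (hG z).1 ⟨hz3, D.mono _ _ ?_ hy2.2.2.1⟩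
        rintro w (rfl | hw)
        · exact prj_mono (by simp) hz1
        · exact prj_mono (by simp) hw
      rcases hz4 with rfl | rfl
      · exact Or.inl (lift_unique D hE hm hz3 (hz2 _ (Or.inl rfl)) hy2 hz1 x2 x3)
      · exact Or.inr (lift_unique D hE hm hz3 (hz2 _ (Or.inr rfl)) hy2 hz1 f2 f3)
    · rintro (rfl | rfl)
      · exact ⟨x1, x2⟩
      · exact ⟨f1, f2⟩
  rcases (hall e).1 ⟨heE, hFe⟩ with rfl | rfl
  · exact ⟨yf, hne.symm, hall⟩
  · exact ⟨yx, hne, fun y => (hall y).trans or_comm⟩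

/-- The path complex inherits the flip property. -/
theorem FJ_flip (D : Dat F C u v U V a0 a1 b0 b1) (hF : FlipProp F C) :
    FlipProp (FJ F u v U V)
      {y | (∃ x ∈ C, y = Sum.inl x) ∨ y = Sum.inr (a0, b1) ∨ y = Sum.inr (a1, b0)} := by
  intro T hT e heT heC
  have hE : FJ F u v U V (T \ {e}) := FJ_mono D Set.sdiff_subset hT.1
  have hends := facet_ends D hT
  have hpT := facet_prj D hT
  have hmT := facet_maxJ D hT
  have hfin := finite_J D hT.1
  have hNC := hT.1.2.2.2
  simp only [Set.mem_ofPred_eq, not_or] at heC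
  obtain ⟨heC1, heC2, heC3⟩ := heC
  have he1 : Sum.inr (a0, b1) ∈ T \ {e} := ⟨hends.1, fun h => heC2 h.symm⟩
  have he2 : Sum.inr (a1, b0) ∈ T \ {e} := ⟨hends.2, fun h => heC3 h.symm⟩
  have heE : e ∉ T \ {e} := fun h => h.2 rfl
  have hFe : FJ F u v U V (insert e (T \ {e})) := by
    rw [Set.insert_diff_singleton, Set.insert_eq_of_mem heT]; exact hT.1
  -- the generic way to conclude
  have gen : ∀ x ∈ prj u v T, x ∉ C → prj u v (T \ {e}) = prj u v T \ {x} →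
      MaxJ (Sum.inr ⁻¹' (T \ {e})) → ∃ f, f ≠ e ∧
    ∀ y, (y ∉ T \ {e} ∧ FJ F u v U V (insert y (T \ {e}))) ↔ (y = e ∨ y = f) := by
    intro x hx hxC hpr hm
    obtain ⟨f, hfx, hfG⟩ := hF _ hpT x hx hxC
    rw [← hpr] at hfG
    refine lift_flip D hE he1 he2 hm hfx hfG ?_ heE hFe
    intro hc
    have hf := (hfG f).2 (Or.inr rfl)
    rw [Set.insert_comm, hpr, Set.insert_diff_singleton, Set.insert_eq_of_mem hx] at hc
    have := hpT.2 _ hc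
    exact hf.1 (by rw [hpr]; exact ⟨this, hfx⟩)
  rcases e with x | e
  · refine gen x (Or.inl heT) (fun h => heC1 ⟨x, h, rfl⟩) ?_ ?_
    · ext z
      constructor
      · rintro (h | ⟨p, hp, h⟩)
        · exact ⟨Or.inl h.1, fun hz => h.2 (by rw [Set.mem_singleton_iff] at hz; rw [hz]; rfl)⟩
        · refine ⟨Or.inr ⟨p, hp.1, h⟩, fun hz => ?_⟩
          rw [Set.mem_singleton_iff] at hz
          subst hz
          have hpU := hT.1.2.1 p hp.1
          rcases h with h | h
          · exact (hT.1.1 _ heT).1 _ hpU.1 h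
          · exact (hT.1.1 _ heT).2 _ hpU.2 h
      · rintro ⟨h | ⟨p, hp, h⟩, hz⟩
        · exact Or.inl ⟨h, fun h' => hz (Sum.inl_injective h')⟩
        · exact Or.inr ⟨p, ⟨hp, by simp⟩, h⟩
    · have : (Sum.inr ⁻¹' (T \ {Sum.inl x}) : Set (ℤ × ℤ)) = Sum.inr ⁻¹' T := by
        ext z; simp
      rw [this]; exact hmT
  · have hJe : (Sum.inr ⁻¹' (T \ {Sum.inr e}) : Set (ℤ × ℤ)) = Sum.inr ⁻¹' T \ {e} := by
      ext z; simp
    have heU := hT.1.2.1 e heT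
    have hU := D.hU _ heU.1
    have hV := D.hV _ heU.2
    have hne1 : ¬ (e.1 = a0 ∧ e.2 = b1) := fun h => heC2 (by rw [← h.1, ← h.2])
    have hne2 : ¬ (e.1 = a1 ∧ e.2 = b0) := fun h => heC3 (by rw [← h.1, ← h.2])
    rcases path_cases hfin hNC hmT heT ⟨_, hends.1, by simp only; omega⟩
      ⟨_, hends.2, by simp only; omega⟩ with
      ⟨g, g1, g2, ⟨p1, hp1, hpg1⟩, ⟨p2, hp2, hpg2⟩, ⟨p3, hp3, hpg3⟩, ⟨p4, hp4, hpg4⟩, g3, g4⟩ |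
      ⟨⟨p, hp, hpe⟩, hb, hm⟩ | ⟨⟨p, hp, hpe⟩, hb, hm⟩
    · -- corner
      have hpr : prj u v (T \ {Sum.inr e}) = prj u v T := by
        apply Set.Subset.antisymm (prj_mono Set.sdiff_subset)
        rintro z (h | ⟨p, hp, h⟩)
        · exact Or.inl ⟨h, by simp⟩
        · by_cases hpe : p = e
          · subst hpe
            rcases h with h | h
            · exact Or.inr ⟨p3, ⟨hp3.1, fun hh => hp3.2 (Sum.inr_injective hh)⟩,
                Or.inl (by rw [h, hpg3])⟩
            · exact Or.inr ⟨p4, ⟨hp4.1, fun hh => hp4.2 (Sum.inr_injective hh)⟩,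
                Or.inr (by rw [h, hpg4])⟩
          · exact Or.inr ⟨p, ⟨hp, fun hh => hpe (Sum.inr_injective hh)⟩, h⟩
      refine ⟨Sum.inr g, fun h => g1 (Sum.inr_injective h), fun y => ⟨?_, ?_⟩⟩
      · rintro ⟨hy1, hy2⟩
        rcases y with z | q
        · have h3 := hy2.2.2.1
          rw [prj_insert_inl, hpr] at h3
          rcases hpT.2 _ h3 with h | ⟨p, hp, h | h⟩
          · exact (hy1 ⟨h, by simp⟩).elim
          · exact ((hy2.1 z (Or.inl rfl)).1 p.1 (hT.1.2.1 p hp).1 h).elim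
          · exact ((hy2.1 z (Or.inl rfl)).2 p.2 (hT.1.2.1 p hp).2 h).elim
        · have h3 := hy2.2.2.1
          have h4 := hy2.2.2.2
          rw [prj_insert_inr, hpr] at h3
          rw [inr_preimage_inr, hJe] at h4
          have hq := hy2.2.1 q (Or.inl rfl)
          have hqu : u q.1 ∈ prj u v T := hpT.2 _ (D.mono _ _
            (Set.insert_subset_insert (Set.subset_insert _ _)) h3)
          have hqv : v q.2 ∈ prj u v T := hpT.2 _ (D.mono _ _ (Set.subset_insert _ _) h3)
          obtain ⟨r, hr, hr'⟩ := (mem_prj_u D hT.1 hq.1).1 hqu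
          obtain ⟨s, hs, hs'⟩ := (mem_prj_v D hT.1 hq.2).1 hqv
          have := g4 r hr s hs
          rw [hr', hs'] at this
          rcases this (by rw [← hJe]; exact hy1) h4 with h | h
          · left; rw [← h]
          · right; rw [← h]
      · rintro (rfl | rfl)
        · exact ⟨heE, hFe⟩
        · refine ⟨fun h => g2 h.1, FJ_insert_inr hE ?_ ?_ ?_ (by rw [hJe]; exact g3)⟩
          · rw [← hpg1]; exact (hT.1.2.1 _ hp1.1).1
          · rw [← hpg2]; exact (hT.1.2.1 _ hp2.1).2
          · rw [hpr, Set.insert_eq_of_mem (a := v _), Set.insert_eq_of_mem (a := u _)]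
            · exact hT.1.2.2.1
            · exact Or.inr ⟨p1, hp1.1, Or.inl (by rw [hpg1])⟩
            · exact Or.inr ⟨p2, hp2.1, Or.inr (by rw [hpg2])⟩
    · -- the row of `e` is a singleton
      refine gen (v e.2) (Or.inr ⟨e, heT, Or.inr rfl⟩) (fun h => ?_) ?_ (by rw [hJe]; exact hm)
      · rcases D.hCv _ heU.2 h with h | h
        · exact hb (a1, b0) ⟨hends.2, fun hh => hne2 (by cases hh; exact ⟨rfl, rfl⟩)⟩ h.symm
        · exact hb (a0, b1) ⟨hends.1, fun hh => hne1 (by cases hh; exact ⟨rfl, rfl⟩)⟩ h.symm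
      · ext z
        constructor
        · intro hz
          refine ⟨prj_mono Set.sdiff_subset hz, fun h => ?_⟩
          have h : z = v e.2 := h
          rw [h, mem_prj_v D hE heU.2] at hz
          obtain ⟨q, hq, hqe⟩ := hz
          exact hb q (by rw [← hJe]; exact hq) hqe
        · rintro ⟨h | ⟨q, hq, h⟩, hz⟩
          · exact Or.inl ⟨h, by simp⟩
          · by_cases hqe : q = e
            · subst hqe
              rcases h with h | h
              · exact Or.inr ⟨p, ⟨hp.1, fun hh => hp.2 (Sum.inr_injective hh)⟩,
                  Or.inl (by rw [h, hpe])⟩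
              · exact (hz h).elim
            · exact Or.inr ⟨q, ⟨hq, fun hh => hqe (Sum.inr_injective hh)⟩, h⟩
    · refine gen (u e.1) (Or.inr ⟨e, heT, Or.inl rfl⟩) (fun h => ?_) ?_ (by rw [hJe]; exact hm)
      · rcases D.hCu _ heU.1 h with h | h
        · exact hb (a0, b1) ⟨hends.1, fun hh => hne1 (by cases hh; exact ⟨rfl, rfl⟩)⟩ h.symm
        · exact hb (a1, b0) ⟨hends.2, fun hh => hne2 (by cases hh; exact ⟨rfl, rfl⟩)⟩ h.symm
      · ext z
        constructor
        · intro hz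
          refine ⟨prj_mono Set.sdiff_subset hz, fun h => ?_⟩
          have h : z = u e.1 := h
          rw [h, mem_prj_u D hE heU.1] at hz
          obtain ⟨q, hq, hqe⟩ := hz
          exact hb q (by rw [← hJe]; exact hq) hqe
        · rintro ⟨h | ⟨q, hq, h⟩, hz⟩
          · exact Or.inl ⟨h, by simp⟩
          · by_cases hqe : q = e
            · subst hqe
              rcases h with h | h
              · exact (hz h).elim
              · exact Or.inr ⟨p, ⟨hp.1, fun hh => hp.2 (Sum.inr_injective hh)⟩,
                  Or.inr (by rw [h, hpe])⟩
            · exact Or.inr ⟨q, ⟨hq, fun hh => hqe (Sum.inr_injective hh)⟩, h⟩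

end

end

section

/-- The join of two complexes. -/
def FJoin {X Y : Type*} (F : Set X → Prop) (G : Set Y → Prop) (S : Set (X ⊕ Y)) : Prop :=
  F (Sum.inl ⁻¹' S) ∧ G (Sum.inr ⁻¹' S)

theorem pre_inl_ins_inl {X Y : Type*} (S : Set (X ⊕ Y)) (x : X) :
    Sum.inl ⁻¹' (insert (Sum.inl x) S) = insert x (Sum.inl ⁻¹' S) := by ext; simp
theorem pre_inl_ins_inr {X Y : Type*} (S : Set (X ⊕ Y)) (x : Y) :
    Sum.inl ⁻¹' (insert (Sum.inr x) S) = (Sum.inl ⁻¹' S) := by ext; simp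
theorem pre_inr_ins_inl {X Y : Type*} (S : Set (X ⊕ Y)) (x : X) :
    Sum.inr ⁻¹' (insert (Sum.inl x) S) = (Sum.inr ⁻¹' S) := by ext; simp
theorem pre_inr_ins_inr {X Y : Type*} (S : Set (X ⊕ Y)) (x : Y) :
    Sum.inr ⁻¹' (insert (Sum.inr x) S) = insert x (Sum.inr ⁻¹' S) := by ext; simp

theorem join_flip {X Y : Type*} {F : Set X → Prop} {G : Set Y → Prop} {C : Set X} {D : Set Y}
    (hF : FlipProp F C) (hG : FlipProp G D) :
    FlipProp (FJoin F G) {z | (∃ x ∈ C, z = Sum.inl x) ∨ ∃ x ∈ D, z = Sum.inr x} := by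
  intro T hT e he heC
  have hT1 : Facet F (Sum.inl ⁻¹' T) := by
    refine ⟨hT.1.1, fun x hx => hT.2 (Sum.inl x) ?_⟩
    refine ⟨?_, ?_⟩
    · rw [pre_inl_ins_inl]; exact hx
    · rw [pre_inr_ins_inl]; exact hT.1.2
  have hT2 : Facet G (Sum.inr ⁻¹' T) := by
    refine ⟨hT.1.2, fun x hx => hT.2 (Sum.inr x) ?_⟩
    refine ⟨?_, ?_⟩
    · rw [pre_inl_ins_inr]; exact hT.1.1
    · rw [pre_inr_ins_inr]; exact hx
  rcases e with e | e
  · have e1 : (Sum.inl ⁻¹' (T \ {Sum.inl e}) : Set X) = (Sum.inl ⁻¹' T) \ {e} := by ext; simp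
    have e2 : (Sum.inr ⁻¹' (T \ {Sum.inl e}) : Set Y) = (Sum.inr ⁻¹' T) := by ext; simp
    obtain ⟨f, hfe, hf⟩ := hF _ hT1 e he (fun h => heC (Or.inl ⟨e, h, rfl⟩))
    refine ⟨Sum.inl f, by simpa using hfe, ?_⟩
    rintro (y | y)
    · have := hf y
      simp only [FJoin, pre_inl_ins_inl, pre_inr_ins_inl, e1, e2, Sum.inl.injEq]
      rw [← this]
      have h2 := hT.1.2
      simp [h2]
    · simp only [FJoin, pre_inl_ins_inr, pre_inr_ins_inr, e1, e2, reduceCtorEq, or_self, iff_false]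
      rintro ⟨h1, h2, h3⟩
      exact h1 ⟨hT2.2 _ h3, by simp⟩
  · have e1 : (Sum.inr ⁻¹' (T \ {Sum.inr e}) : Set Y) = (Sum.inr ⁻¹' T) \ {e} := by ext; simp
    have e2 : (Sum.inl ⁻¹' (T \ {Sum.inr e}) : Set X) = (Sum.inl ⁻¹' T) := by ext; simp
    obtain ⟨f, hfe, hf⟩ := hG _ hT2 e he (fun h => heC (Or.inr ⟨e, h, rfl⟩))
    refine ⟨Sum.inr f, by simpa using hfe, ?_⟩
    rintro (y | y)
    · simp only [FJoin, pre_inl_ins_inl, pre_inr_ins_inl, e1, e2, reduceCtorEq, or_self, iff_false]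
      rintro ⟨h1, h2, h3⟩
      exact h1 ⟨hT1.2 _ h2, by simp⟩
    · have := hf y
      simp only [FJoin, pre_inl_ins_inr, pre_inr_ins_inr, e1, e2, Sum.inr.injEq]
      rw [← this]
      have h2 := hT.1.1
      simp [h2]

theorem link_flip_local {Y Z : Type*} {F : Set Z → Prop} {F' : Set Y → Prop} {φ : Y → Z}
    {VY : Set Y} {D : Set Z} (hmono : ∀ S S', S ⊆ S' → F S' → F S)
    (hinj : Set.InjOn φ VY) (hV : ∀ S, F' S → S ⊆ VY) (hD : ∀ y ∈ VY, φ y ∉ D)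
    (hiff : ∀ S, S ⊆ VY → (F' S ↔ F (D ∪ φ '' S)))
    (hsurj : ∀ z, F (insert z D) → z ∈ D ∪ φ '' VY)
    {T : Set Z} (hT : Facet F T) (hDT : D ⊆ T) {e : Z} (he : e ∈ T) (heD : e ∉ D)
    (hfl : ∀ S, Facet F' S → S = {y | y ∈ VY ∧ φ y ∈ T} → ∀ y0 ∈ S, φ y0 = e →
      ∃ f, f ≠ y0 ∧ ∀ y, (y ∉ S \ {y0} ∧ F' (insert y (S \ {y0}))) ↔ (y = y0 ∨ y = f)) :
    ∃ f, f ≠ e ∧ ∀ y, (y ∉ T \ {e} ∧ F (insert y (T \ {e}))) ↔ (y = e ∨ y = f) := by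
  classical
  set S : Set Y := {y | y ∈ VY ∧ φ y ∈ T} with hS
  have hSV : S ⊆ VY := fun y hy => hy.1
  have hTS : T = D ∪ φ '' S := by
    ext z
    constructor
    · intro hz
      rcases hsurj z (hmono _ T (Set.insert_subset hz hDT) hT.1) with h | ⟨y, hy, rfl⟩
      · exact Or.inl h
      · exact Or.inr ⟨y, ⟨hy, hz⟩, rfl⟩
    · rintro (h | ⟨y, hy, rfl⟩)
      · exact hDT h
      · exact hy.2
  have hSF : Facet F' S := by
    refine ⟨(hiff S hSV).2 (hTS ▸ hT.1), fun y hy => ?_⟩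
    have hyV : y ∈ VY := hV _ hy (Set.mem_insert _ _)
    refine ⟨hyV, hT.2 _ ?_⟩
    have := (hiff _ (Set.insert_subset hyV hSV)).1 hy
    rw [Set.image_insert_eq, Set.union_insert, ← hTS] at this
    exact this
  obtain ⟨y0, hy0, rfl⟩ : ∃ y ∈ S, φ y = e := by
    rw [hTS] at he
    rcases he with h | ⟨y, hy, rfl⟩
    · exact (heD h).elim
    · exact ⟨y, hy, rfl⟩
  obtain ⟨y1, hne, hy1⟩ := hfl S hSF hS y0 hy0 rfl
  have hy1' := (hy1 y1).2 (Or.inr rfl)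
  have hy1V : y1 ∈ VY := hV _ hy1'.2 (Set.mem_insert _ _)
  have hTS' : T \ {φ y0} = D ∪ φ '' (S \ {y0}) := by
    ext z
    rw [hTS]
    constructor
    · rintro ⟨h | ⟨y, hy, rfl⟩, h2⟩
      · exact Or.inl h
      · exact Or.inr ⟨y, ⟨hy, fun h => h2 (by rw [h]; rfl)⟩, rfl⟩
    · rintro (h | ⟨y, hy, rfl⟩)
      · exact ⟨Or.inl h, fun h' => heD (h' ▸ h)⟩
      · exact ⟨Or.inr ⟨y, hy.1, rfl⟩, fun h' => hy.2 (hinj hy.1.1 hy0.1 h')⟩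
  have key : ∀ y ∈ VY, (φ y ∉ T \ {φ y0} ∧ F (insert (φ y) (T \ {φ y0}))) ↔ (y = y0 ∨ y = y1) := by
    intro y hy
    rw [← hy1, hiff _ (Set.insert_subset hy (Set.sdiff_subset.trans hSV)), Set.image_insert_eq,
      Set.union_insert, ← hTS']
    refine and_congr_left fun _ => not_congr ?_
    rw [hTS']
    constructor
    · rintro (h | ⟨y', hy', h⟩)
      · exact (hD y hy h).elim
      · rwa [← hinj hy'.1.1 hy h]
    · intro h
      exact Or.inr ⟨y, h, rfl⟩
  refine ⟨φ y1, fun h => hne (hinj hy1V hy0.1 h), fun z => ?_⟩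
  constructor
  · rintro ⟨h1, h2⟩
    have hz : z ∈ D ∪ φ '' VY := by
      apply hsurj
      refine hmono _ _ (Set.insert_subset_insert ?_) h2
      rw [hTS']; exact Set.subset_union_left
    rcases hz with h | ⟨y, hy, rfl⟩
    · exact (h1 (by rw [hTS']; exact Or.inl h)).elim
    · rcases (key y hy).1 ⟨h1, h2⟩ with h | h
      · exact Or.inl (by rw [h])
      · exact Or.inr (by rw [h])
  · rintro (rfl | rfl)
    · exact (key y0 hy0.1).2 (Or.inl rfl)
    · exact (key y1 hy1V).2 (Or.inr rfl)

theorem link_flip {Y Z : Type*} {F : Set Z → Prop} {F' : Set Y → Prop} {C' : Set Y} {φ : Y → Z}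
    {VY : Set Y} {D : Set Z} (hmono : ∀ S S', S ⊆ S' → F S' → F S)
    (hinj : Set.InjOn φ VY) (hV : ∀ S, F' S → S ⊆ VY) (hD : ∀ y ∈ VY, φ y ∉ D)
    (hiff : ∀ S, S ⊆ VY → (F' S ↔ F (D ∪ φ '' S)))
    (hsurj : ∀ z, F (insert z D) → z ∈ D ∪ φ '' VY) (hfl : FlipProp F' C')
    {T : Set Z} (hT : Facet F T) (hDT : D ⊆ T) {e : Z} (he : e ∈ T) (heD : e ∉ D)
    (heC : ∀ y ∈ VY, φ y = e → y ∉ C') :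
    ∃ f, f ≠ e ∧ ∀ y, (y ∉ T \ {e} ∧ F (insert y (T \ {e}))) ↔ (y = e ∨ y = f) :=
  link_flip_local hmono hinj hV hD hiff hsurj hT hDT he heD fun S hS hS' y0 hy0 h =>
    hfl S hS y0 hy0 (heC y0 (by rw [hS'] at hy0; exact hy0.1) h)

theorem restrict_flip {X : Type*} {F : Set X → Prop} {C K W : Set X}
    (hmono : ∀ S S', S ⊆ S' → F S' → F S) (hK : ∀ S, F S → F (S ∪ K)) (hKC : K ⊆ C)
    (hW : ∀ x, F {x} → x ∈ W ∪ K) (hF : FlipProp F C) :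
    FlipProp (fun S => S ⊆ W ∧ F S) C := by
  intro T hT e he heC
  have heK : e ∉ K := fun h => heC (hKC h)
  have hT' : Facet F (T ∪ K) := by
    refine ⟨hK _ hT.1.2, fun x hx => ?_⟩
    rcases hW x (hmono _ _ (by simp) hx) with h | h
    · refine Or.inl (hT.2 x ⟨Set.insert_subset h hT.1.1, ?_⟩)
      exact hmono _ _ (Set.insert_subset_insert Set.subset_union_left) hx
    · exact Or.inr h
  have heq : (T ∪ K) \ {e} = T \ {e} ∪ K := by
    ext x
    simp only [Set.mem_sdiff, Set.mem_union, Set.mem_singleton_iff]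
    constructor
    · tauto
    · rintro (h | h)
      · tauto
      · exact ⟨Or.inr h, fun h' => heK (h' ▸ h)⟩
  obtain ⟨f, hfe, hf⟩ := hF _ hT' e (Or.inl he) heC
  rw [heq] at hf
  have key : ∀ y ∈ W, (y ∉ T \ {e} ∧ F (insert y (T \ {e}))) ↔ (y = e ∨ y = f) := by
    intro y hy
    rw [← hf]
    constructor
    · rintro ⟨h1, h2⟩
      have h3 : F (insert y (T \ {e} ∪ K)) := by
        have := hK _ h2
        rwa [Set.insert_union] at this
      refine ⟨?_, h3⟩
      rintro (h | h)
      · exact h1 h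
      · apply h1
        refine ⟨hT.2 y ⟨Set.insert_subset hy hT.1.1, ?_⟩, fun h' => heK (h' ▸ h)⟩
        exact hmono _ _ (Set.insert_subset (Or.inr h) Set.subset_union_left) (hK _ hT.1.2)
    · rintro ⟨h1, h2⟩
      exact ⟨fun h => h1 (Or.inl h), hmono _ _ (Set.insert_subset_insert Set.subset_union_left) h2⟩
  have hff := (hf f).2 (Or.inr rfl)
  have hfW : f ∈ W := by
    rcases hW f (hmono _ _ (by simp) hff.2) with h | h
    · exact h
    · exact (hff.1 (Or.inr h)).elim
  refine ⟨f, hfe, fun y => ?_⟩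
  constructor
  · rintro ⟨h1, h2⟩
    exact (key y (h2.1 (Set.mem_insert _ _))).1 ⟨h1, h2.2⟩
  · intro h
    have hy : y ∈ W := by
      rcases h with rfl | rfl
      · exact hT.1.1 he
      · exact hfW
    have := (key y hy).2 h
    exact ⟨this.1, Set.insert_subset hy (Set.sdiff_subset.trans hT.1.1), this.2⟩

end

section

/-- Three mutually crossing edges, in order. -/
def C3 (x y z : ℤ × ℤ) : Prop :=
  x.1 < y.1 ∧ y.1 < z.1 ∧ z.1 < x.2 ∧ x.2 < y.2 ∧ y.2 < z.2

/-- Edges of the `N`-gon. -/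
def vld (N : ℤ) : Set (ℤ × ℤ) := {p | 0 ≤ p.1 ∧ p.1 < p.2 ∧ p.2 < N}

/-- Irrelevant edges of the `N`-gon. -/
def irr (N : ℤ) : Set (ℤ × ℤ) := {p | p.2 - p.1 ≤ 2 ∨ N - 2 ≤ p.2 - p.1}

/-- The complex of 3-crossing-free sets of edges of the `N`-gon. -/
def FN (N : ℤ) (S : Set (ℤ × ℤ)) : Prop :=
  S ⊆ vld N ∧ ∀ x ∈ S, ∀ y ∈ S, ∀ z ∈ S, ¬ C3 x y z

theorem FN_mono {N : ℤ} : ∀ S S' : Set (ℤ × ℤ), S ⊆ S' → FN N S' → FN N S :=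
  fun _ _ h h' => ⟨h.trans h'.1, fun x hx y hy z hz => h'.2 x (h hx) y (h hy) z (h hz)⟩

theorem FN_fin {N : ℤ} (S : Set (ℤ × ℤ)) (h : FN N S) : S.Finite := by
  refine ((Set.finite_Icc (0 : ℤ) N).prod (Set.finite_Icc (0 : ℤ) N)).subset ?_
  intro p hp
  have := h.1 hp
  simp only [vld, Set.mem_ofPred_eq] at this
  simp only [Set.mem_prod, Set.mem_Icc]
  omega

theorem FN_cone {N : ℤ} (S : Set (ℤ × ℤ)) (h : FN N S) : FN N (S ∪ (vld N ∩ irr N)) := by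
  have hv : S ∪ (vld N ∩ irr N) ⊆ vld N := Set.union_subset h.1 Set.inter_subset_left
  refine ⟨hv, fun x hx y hy z hz hC => ?_⟩
  have h1 := hv hx
  have h2 := hv hy
  have h3 := hv hz
  simp only [vld, irr, C3, Set.mem_ofPred_eq, Set.mem_union, Set.mem_inter_iff] at *
  have hx' : x ∈ S := by
    rcases hx with hx | hx
    · exact hx
    · omega
  have hy' : y ∈ S := by
    rcases hy with hy | hy
    · exact hy
    · omega
  have hz' : z ∈ S := by
    rcases hz with hz | hz
    · exact hz
    · omega
  have := h.2 x hx' y hy' z hz'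
  simp only [C3] at this
  omega

theorem FN_cone_one {N : ℤ} {p : ℤ × ℤ} (hp : p ∈ vld N) (hp' : p ∈ irr N) (S : Set (ℤ × ℤ))
    (h : FN N S) : FN N (insert p S) :=
  FN_mono _ _ (Set.insert_subset (Or.inr ⟨hp, hp'⟩) Set.subset_union_left) (FN_cone S h)

/-- The complex restricted to a set of edges. -/
def FW (N : ℤ) (W : Set (ℤ × ℤ)) (S : Set (ℤ × ℤ)) : Prop := S ⊆ W ∧ FN N S

theorem FW_flip {N : ℤ} {W : Set (ℤ × ℤ)} (hW : ∀ p ∈ vld N, p ∉ irr N → p ∈ W)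
    (h : FlipProp (FN N) (irr N)) : FlipProp (FW N W) (irr N) := by
  refine restrict_flip (F := FN N) (K := vld N ∩ irr N) FN_mono FN_cone Set.inter_subset_right ?_ h
  intro x hx
  have hx' : x ∈ vld N := hx.1 rfl
  by_cases hi : x ∈ irr N
  · exact Or.inr ⟨hx', hi⟩
  · exact Or.inl (hW x hx' hi)

/-- Local flip statement. -/
def FlipAt {X : Type*} (F : Set X → Prop) (T : Set X) (e : X) : Prop :=
  ∃ f, f ≠ e ∧ ∀ y, (y ∉ T \ {e} ∧ F (insert y (T \ {e}))) ↔ (y = e ∨ y = f)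

/-- Inverse rotation. -/
def rotN (N : ℤ) (p : ℤ × ℤ) : ℤ × ℤ :=
  if p.2 = N - 1 then (0, p.1 + 1) else (p.1 + 1, p.2 + 1)

theorem rotN_cases (N : ℤ) (p : ℤ × ℤ) :
    (p.2 = N - 1 ∧ (rotN N p).1 = 0 ∧ (rotN N p).2 = p.1 + 1) ∨
    (p.2 ≠ N - 1 ∧ (rotN N p).1 = p.1 + 1 ∧ (rotN N p).2 = p.2 + 1) := by
  unfold rotN
  split_ifs <;> simp_all

theorem FN_rot {N : ℤ} {S : Set (ℤ × ℤ)} (hS : S ⊆ vld N) :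
    FN N S ↔ FN N (rotN N '' S) := by
  constructor
  · intro h
    refine ⟨?_, ?_⟩
    · rintro _ ⟨p, hp, rfl⟩
      have := hS hp
      have := rotN_cases N p
      simp only [vld, Set.mem_ofPred_eq] at *
      omega
    · rintro _ ⟨x, hx, rfl⟩ _ ⟨y, hy, rfl⟩ _ ⟨z, hz, rfl⟩ hC
      have h1 := h.2 x hx y hy z hz
      have h2 := h.2 y hy z hz x hx
      have := rotN_cases N x
      have := rotN_cases N y
      have := rotN_cases N z
      have := hS hx
      have := hS hy
      have := hS hz
      simp only [vld, Set.mem_ofPred_eq, C3] at *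
      omega
  · intro h
    refine ⟨hS, fun x hx y hy z hz hC => ?_⟩
    have h1 := h.2 _ ⟨x, hx, rfl⟩ _ ⟨y, hy, rfl⟩ _ ⟨z, hz, rfl⟩
    have h2 := h.2 _ ⟨z, hz, rfl⟩ _ ⟨x, hx, rfl⟩ _ ⟨y, hy, rfl⟩
    have := rotN_cases N x
    have := rotN_cases N y
    have := rotN_cases N z
    have := hS hx
    have := hS hy
    have := hS hz
    simp only [vld, Set.mem_ofPred_eq, C3] at *
    omega

theorem flipAt_rot {N : ℤ} (hbase : ∀ T, Facet (FN N) T → ∀ e ∈ T, e ∉ irr N →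
      ∀ e0 ∈ T, e0 ∉ irr N → e0 ≠ e → e0.1 = 0 → FlipAt (FN N) T e) :
    ∀ k : ℕ, ∀ T, Facet (FN N) T → ∀ e ∈ T, e ∉ irr N →
      ∀ e0 ∈ T, e0 ∉ irr N → e0 ≠ e → e0.1 = k → FlipAt (FN N) T e := by
  intro k
  induction k with
  | zero => 
    intro T hT e he hei e0 h0 h0i hne hk
    exact hbase T hT e he hei e0 h0 h0i hne (by simpa using hk)
  | succ k ih =>
    intro T hT e he hei e0 h0 h0i hne hk
    refine link_flip_local (F := FN N) (F' := FN N) (φ := rotN N) (VY := vld N) (D := ∅) FN_mono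
      ?_ (fun S hS => hS.1) (by simp) ?_ ?_ hT (by simp) he (by simp) ?_
    · intro p hp q hq h
      have := rotN_cases N p
      have := rotN_cases N q
      have h1 := congrArg Prod.fst h
      have h2 := congrArg Prod.snd h
      simp only [vld, Set.mem_ofPred_eq] at *
      ext <;> omega
    · intro S hS
      rw [Set.empty_union]
      exact FN_rot hS
    · intro z hz
      have hz := hz.1 (Set.mem_insert _ _)
      refine Or.inr ?_
      simp only [vld, Set.mem_ofPred_eq] at hz
      by_cases h : z.1 = 0
      · refine ⟨(z.2 - 1, N - 1), ?_, ?_⟩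
        · simp only [vld, Set.mem_ofPred_eq]; omega
        · have := rotN_cases N (z.2 - 1, N - 1)
          simp only at this
          ext <;> omega
      · refine ⟨(z.1 - 1, z.2 - 1), ?_, ?_⟩
        · simp only [vld, Set.mem_ofPred_eq]; omega
        · have := rotN_cases N (z.1 - 1, z.2 - 1)
          simp only at this
          ext <;> omega
    · intro S hS hST y0 hy0 hye
      have hv0 := hT.1.1 h0
      simp only [vld, Set.mem_ofPred_eq] at hv0
      have hr := rotN_cases N (e0.1 - 1, e0.2 - 1)
      have hr' := rotN_cases N y0
      have hvy := hS.1.1 hy0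
      push_cast at hk
      simp only [vld, Set.mem_ofPred_eq] at hr hvy
      have heq : rotN N (e0.1 - 1, e0.2 - 1) = e0 := by ext <;> omega
      refine ih S hS y0 hy0 ?_ (e0.1 - 1, e0.2 - 1) ?_ ?_ ?_ ?_
      · rw [← hye] at hei
        simp only [irr, Set.mem_ofPred_eq] at hei ⊢
        omega
      · rw [hST]
        refine ⟨?_, ?_⟩
        · simp only [vld, Set.mem_ofPred_eq]; omega
        · rw [heq]; exact h0
      · simp only [irr, Set.mem_ofPred_eq] at h0i ⊢; omega
      · rintro rfl
        exact hne (heq ▸ hye)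
      · simp only; omega

theorem exists_other {N : ℤ} {T : Set (ℤ × ℤ)} (hT : Facet (FN N) T) {e : ℤ × ℤ} (he : e ∈ T)
    (hei : e ∉ irr N) : ∃ e0 ∈ T, e0 ∉ irr N ∧ e0 ≠ e := by
  by_contra hc
  push Not at hc
  have hev := hT.1.1 he
  have key : ∀ g ∈ vld N, g ∈ T := by
    intro g hg
    refine hT.2 g ⟨Set.insert_subset hg hT.1.1, fun x hx y hy z hz hC => ?_⟩
    have hv : insert g T ⊆ vld N := Set.insert_subset hg hT.1.1
    have h1 := hv hx
    have h2 := hv hy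
    have h3 := hv hz
    have hx' : x = g ∨ x = e := by
      rcases hx with h | h
      · exact Or.inl h
      · refine Or.inr (hc x h ?_)
        simp only [vld, irr, Set.mem_ofPred_eq, C3] at *
        omega
    have hy' : y = g ∨ y = e := by
      rcases hy with h | h
      · exact Or.inl h
      · refine Or.inr (hc y h ?_)
        simp only [vld, irr, Set.mem_ofPred_eq, C3] at *
        omega
    have hz' : z = g ∨ z = e := by
      rcases hz with h | h
      · exact Or.inl h
      · refine Or.inr (hc z h ?_)
        simp only [vld, irr, Set.mem_ofPred_eq, C3] at *
        omega
    simp only [C3] at hC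
    rcases hx' with rfl | rfl <;> rcases hy' with rfl | rfl <;> rcases hz' with rfl | rfl <;> omega
  simp only [irr, vld, Set.mem_ofPred_eq] at hei hev
  have h1 := hc _ (key (0, 3) (by simp only [vld, Set.mem_ofPred_eq]; omega))
    (by simp only [irr, Set.mem_ofPred_eq]; omega)
  have h2 := hc _ (key (1, 4) (by simp only [vld, Set.mem_ofPred_eq]; omega))
    (by simp only [irr, Set.mem_ofPred_eq]; omega)
  rw [← h1] at h2
  simp at h2

end

section

def WL (q : ℤ) : Set (ℤ × ℤ) :=
  {p | (0 ≤ p.1 ∧ p.1 < p.2 ∧ p.2 ≤ q ∧ ¬ (p.1 = 0 ∧ p.2 = q)) ∨ (0 < p.1 ∧ p.1 < q ∧ p.2 = q + 1)}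

def WR (M : ℤ) : Set (ℤ × ℤ) :=
  {p | (p.1 = 0 ∧ 3 ≤ p.2 ∧ p.2 < M) ∨ (2 ≤ p.1 ∧ p.1 < p.2 ∧ p.2 < M) ∨
    (p.1 = 1 ∧ 3 ≤ p.2 ∧ p.2 < M)}

abbrev YY := ((ℤ × ℤ) ⊕ (ℤ × ℤ)) ⊕ (ℤ × ℤ)

def phiN (q : ℤ) : YY → ℤ × ℤ
  | Sum.inl (Sum.inl p) => p
  | Sum.inl (Sum.inr p) => (if p.1 = 0 then 0 else p.1 + q - 2, p.2 + q - 2)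
  | Sum.inr p => p

def VN (N q : ℤ) : Set YY := {y | match y with
  | Sum.inl (Sum.inl p) => 0 ≤ p.1 ∧ p.1 < p.2 ∧ p.2 ≤ q ∧ ¬ (p.1 = 0 ∧ p.2 = q)
  | Sum.inl (Sum.inr p) => (p.1 = 0 ∧ 3 ≤ p.2 ∧ p.2 < N - q + 2) ∨ 
      (2 ≤ p.1 ∧ p.1 < p.2 ∧ p.2 < N - q + 2)
  | Sum.inr p => 0 < p.1 ∧ p.1 < q ∧ q < p.2 ∧ p.2 < N}

def uN (q : ℤ) (a : ℤ) : (ℤ × ℤ) ⊕ (ℤ × ℤ) := Sum.inl (a, q + 1)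
def vN (q : ℤ) (b : ℤ) : (ℤ × ℤ) ⊕ (ℤ × ℤ) := Sum.inr (1, b - q + 2)

def FLR (N q : ℤ) : Set ((ℤ × ℤ) ⊕ (ℤ × ℤ)) → Prop :=
  FJoin (FW (q + 2) (WL q)) (FW (N - q + 2) (WR (N - q + 2)))

def CLR (N q : ℤ) : Set ((ℤ × ℤ) ⊕ (ℤ × ℤ)) :=
  {z | (∃ x ∈ irr (q + 2), z = Sum.inl x) ∨ ∃ x ∈ irr (N - q + 2), z = Sum.inr x}

theorem FW_cone_one {N : ℤ} {W : Set (ℤ × ℤ)} {p : ℤ × ℤ} (hW : p ∈ W) (hp : p ∈ vld N)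
    (hp' : p ∈ irr N) (S : Set (ℤ × ℤ)) (h : FW N W S) : FW N W (insert p S) :=
  ⟨Set.insert_subset hW h.1, FN_cone_one hp hp' S h.2⟩

theorem Dat_LR {N q : ℤ} (hq : 3 ≤ q) (hqN : q ≤ N - 3) :
    Dat (FLR N q) (CLR N q) (uN q) (vN q) (Set.Ioo 0 q) (Set.Ioo q N) 1 (q - 1) (q + 1) (N - 1) where
  mono := by
    rintro S S' h ⟨⟨h1, h2⟩, ⟨h3, h4⟩⟩
    have e1 : (Sum.inl ⁻¹' S : Set (ℤ × ℤ)) ⊆ Sum.inl ⁻¹' S' := Set.preimage_mono h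
    have e2 : (Sum.inr ⁻¹' S : Set (ℤ × ℤ)) ⊆ Sum.inr ⁻¹' S' := Set.preimage_mono h
    exact ⟨⟨e1.trans h1, FN_mono _ _ e1 h2⟩, ⟨e2.trans h3, FN_mono _ _ e2 h4⟩⟩
  fin := by
    rintro S ⟨⟨h1, h2⟩, ⟨h3, h4⟩⟩
    have := ((FN_fin _ h2).image Sum.inl).union ((FN_fin _ h4).image Sum.inr)
    refine this.subset ?_
    rintro (x | x) hx
    · exact Or.inl ⟨x, hx, rfl⟩
    · exact Or.inr ⟨x, hx, rfl⟩
  hu := by intro a b h; simpa [uN] using h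
  hv := by intro a b h; simpa [vN] using h
  huv := by intro a b; simp [uN, vN]
  ha0 := by simp only [Set.mem_Ioo]; omega
  ha1 := by simp only [Set.mem_Ioo]; omega
  hb0 := by simp only [Set.mem_Ioo]; omega
  hb1 := by simp only [Set.mem_Ioo]; omega
  hU := by intro a ha; simp only [Set.mem_Ioo] at ha; omega
  hV := by intro a ha; simp only [Set.mem_Ioo] at ha; omega
  ca0 := by
    rintro S ⟨h1, h2⟩
    refine ⟨?_, ?_⟩
    · rw [uN, pre_inl_ins_inl]
      refine FW_cone_one ?_ ?_ ?_ _ h1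
      · simp only [WL, Set.mem_ofPred_eq, true_and, and_true]; omega
      · simp only [vld, Set.mem_ofPred_eq]; omega
      · simp only [irr, Set.mem_ofPred_eq]; omega
    · rw [uN, pre_inr_ins_inl]; exact h2
  ca1 := by
    rintro S ⟨h1, h2⟩
    refine ⟨?_, ?_⟩
    · rw [uN, pre_inl_ins_inl]
      refine FW_cone_one ?_ ?_ ?_ _ h1
      · simp only [WL, Set.mem_ofPred_eq, true_and, and_true]; omega
      · simp only [vld, Set.mem_ofPred_eq]; omega
      · simp only [irr, Set.mem_ofPred_eq]; omega
    · rw [uN, pre_inr_ins_inl]; exact h2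
  cb0 := by
    rintro S ⟨h1, h2⟩
    refine ⟨?_, ?_⟩
    · rw [vN, pre_inl_ins_inr]; exact h1
    · rw [vN, pre_inr_ins_inr]
      refine FW_cone_one ?_ ?_ ?_ _ h2
      · simp only [WR, Set.mem_ofPred_eq, true_and, and_true]; omega
      · simp only [vld, Set.mem_ofPred_eq]; omega
      · simp only [irr, Set.mem_ofPred_eq]; omega
  cb1 := by
    rintro S ⟨h1, h2⟩
    refine ⟨?_, ?_⟩
    · rw [vN, pre_inl_ins_inr]; exact h1
    · rw [vN, pre_inr_ins_inr]
      refine FW_cone_one ?_ ?_ ?_ _ h2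
      · simp only [WR, Set.mem_ofPred_eq, true_and, and_true]; omega
      · simp only [vld, Set.mem_ofPred_eq]; omega
      · simp only [irr, Set.mem_ofPred_eq]; omega
  hCu := by
    rintro a ha (⟨x, hx, h⟩ | ⟨x, hx, h⟩)
    · simp only [uN, Sum.inl.injEq] at h
      subst h
      simp only [irr, Set.mem_ofPred_eq, Set.mem_Ioo] at hx ha
      omega
    · simp [uN] at h
  hCv := by
    rintro a ha (⟨x, hx, h⟩ | ⟨x, hx, h⟩)
    · simp [vN] at h
    · simp only [vN, Sum.inr.injEq] at h
      subst h
      simp only [irr, Set.mem_ofPred_eq, Set.mem_Ioo] at hx ha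
      omega

theorem LR_fwd {N q : ℤ} (hq : 3 ≤ q) (hqN : q ≤ N - 3) {S : Set YY} (hS : S ⊆ VN N q)
    (h : FJ (FLR N q) (uN q) (vN q) (Set.Ioo 0 q) (Set.Ioo q N) S) :
    FN N ({((0 : ℤ), q)} ∪ phiN q '' S) := by
  obtain ⟨-, -, ⟨⟨h1, h2⟩, ⟨h3, h4⟩⟩, h5⟩ := h
  set PL : Set (ℤ × ℤ) := Sum.inl ⁻¹' prj (uN q) (vN q) S with hPL
  set PR : Set (ℤ × ℤ) := Sum.inr ⁻¹' prj (uN q) (vN q) S with hPR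
  have key : ∀ x ∈ ({((0 : ℤ), q)} ∪ phiN q '' S), x ∈ vld N ∧
      (x.2 ≤ q → ¬ (x.1 = 0 ∧ x.2 = q) → x ∈ PL) ∧
      (0 < x.1 → x.1 < q → q < x.2 → (x.1, q + 1) ∈ PL ∧ (1, x.2 - q + 2) ∈ PR ∧
        Sum.inr x ∈ S) ∧
      (x.1 = 0 → q < x.2 → (0, x.2 - q + 2) ∈ PR) ∧
      (q ≤ x.1 → (x.1 - q + 2, x.2 - q + 2) ∈ PR) := by
    rintro x (rfl | ⟨((p | p) | p), hp, rfl⟩)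
    · refine ⟨?_, ?_, ?_, ?_, ?_⟩
      · simp only [vld, Set.mem_ofPred_eq]; omega
      all_goals intros; exfalso; first | omega | simp_all
    · have hv := hS hp
      simp only [VN, phiN, Set.mem_ofPred_eq] at hv ⊢
      refine ⟨?_, ?_, ?_, ?_, ?_⟩
      · simp only [vld, Set.mem_ofPred_eq]; omega
      · intro _ _
        exact Or.inl hp
      all_goals intros; exfalso; omega
    · have hv := hS hp
      simp only [VN, phiN, Set.mem_ofPred_eq] at hv ⊢
      have hp' : p ∈ PR := Or.inl hp
      split_ifs with h0
      · refine ⟨?_, ?_, ?_, ?_, ?_⟩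
        · simp only [vld, Set.mem_ofPred_eq]; omega
        · intros; exfalso; omega
        · intros; exfalso; omega
        · intro _ _
          convert hp' using 1
          ext <;> simp only <;> omega
        · intros; exfalso; omega
      · refine ⟨?_, ?_, ?_, ?_, ?_⟩
        · simp only [vld, Set.mem_ofPred_eq]; omega
        · intros; exfalso; omega
        · intros; exfalso; omega
        · intros; exfalso; omega
        · intro _
          convert hp' using 1
          ext <;> simp only <;> omega
    · have hv := hS hp
      simp only [VN, phiN, Set.mem_ofPred_eq] at hv ⊢
      refine ⟨?_, ?_, ?_, ?_, ?_⟩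
      · simp only [vld, Set.mem_ofPred_eq]; omega
      · intros; exfalso; omega
      · intro _ _ _
        exact ⟨Or.inr ⟨p, hp, Or.inl rfl⟩, Or.inr ⟨p, hp, Or.inr rfl⟩, hp⟩
      · intros; exfalso; omega
      · intros; exfalso; omega
  refine ⟨fun x hx => (key x hx).1, fun x hx y hy z hz hC => ?_⟩
  obtain ⟨hx1, hx2, hx3, hx4, hx5⟩ := key x hx
  obtain ⟨hy1, hy2, hy3, hy4, hy5⟩ := key y hy
  obtain ⟨hz1, hz2, hz3, hz4, hz5⟩ := key z hz
  simp only [vld, Set.mem_ofPred_eq, C3] at hx1 hy1 hz1 hC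
  by_cases c1 : z.2 ≤ q
  · refine h2.2 x (hx2 ?_ ?_) y (hy2 ?_ ?_) z (hz2 ?_ ?_) ?_ <;> (try simp only [C3]) <;> omega
  by_cases c2 : q ≤ x.1
  · refine h4.2 _ (hx5 ?_) _ (hy5 ?_) _ (hz5 ?_) ?_ <;> (try simp only [C3]) <;> omega
  by_cases c3 : y.2 ≤ q
  · refine h2.2 x (hx2 ?_ ?_) y (hy2 ?_ ?_) _ (hz3 ?_ ?_ ?_).1 ?_ <;> (try simp only [C3]) <;> omega
  by_cases c4 : q ≤ y.1
  · by_cases c5 : x.1 = 0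
    · refine h4.2 _ (hx4 ?_ ?_) _ (hy5 ?_) _ (hz5 ?_) ?_ <;> (try simp only [C3]) <;> omega
    · refine h4.2 _ (hx3 ?_ ?_ ?_).2.1 _ (hy5 ?_) _ (hz5 ?_) ?_ <;> (try simp only [C3]) <;> omega
  by_cases c5 : z.1 < q
  · refine h5 y (hy3 ?_ ?_ ?_).2.2 z (hz3 ?_ ?_ ?_).2.2 ?_ <;> omega
  by_cases c6 : x.1 = 0
  · refine h4.2 _ (hx4 ?_ ?_) _ (hy3 ?_ ?_ ?_).2.1 _ (hz5 ?_) ?_ <;> (try simp only [C3]) <;> omega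
  · refine h5 x (hx3 ?_ ?_ ?_).2.2 y (hy3 ?_ ?_ ?_).2.2 ?_ <;> omega

theorem LR_bwd {N q : ℤ} (hq : 3 ≤ q) (hqN : q ≤ N - 3) {S : Set YY} (hS : S ⊆ VN N q)
    (h : FN N ({((0 : ℤ), q)} ∪ phiN q '' S)) :
    FJ (FLR N q) (uN q) (vN q) (Set.Ioo 0 q) (Set.Ioo q N) S := by
  have e1 : ∀ p, Sum.inl (Sum.inl p) ∈ S → p ∈ ({((0 : ℤ), q)} ∪ phiN q '' S) :=
    fun p hp => Or.inr ⟨_, hp, rfl⟩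
  have e3 : ∀ p, Sum.inr p ∈ S → p ∈ ({((0 : ℤ), q)} ∪ phiN q '' S) :=
    fun p hp => Or.inr ⟨_, hp, rfl⟩
  set E := ({((0 : ℤ), q)} ∪ phiN q '' S) with hE
  have keyL : ∀ x ∈ (Sum.inl ⁻¹' prj (uN q) (vN q) S : Set (ℤ × ℤ)),
      (x ∈ E ∧ 0 ≤ x.1 ∧ x.1 < x.2 ∧ x.2 ≤ q ∧ ¬ (x.1 = 0 ∧ x.2 = q)) ∨
      (0 < x.1 ∧ x.1 < q ∧ x.2 = q + 1 ∧ ∃ b, q < b ∧ b < N ∧ (x.1, b) ∈ E) := by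
    rintro x (hx | ⟨p, hp, hx | hx⟩)
    · have := hS hx
      exact Or.inl ⟨e1 _ hx, this⟩
    · have := hS hp
      simp only [uN, Sum.inl.injEq] at hx
      subst hx
      simp only [VN, Set.mem_ofPred_eq] at this
      exact Or.inr ⟨this.1, this.2.1, rfl, p.2, this.2.2.1, this.2.2.2, e3 _ hp⟩
    · simp [vN] at hx
  have keyR : ∀ x ∈ (Sum.inr ⁻¹' prj (uN q) (vN q) S : Set (ℤ × ℤ)),
      (x.1 = 0 ∧ 3 ≤ x.2 ∧ x.2 < N - q + 2 ∧ (0, x.2 + q - 2) ∈ E) ∨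
      (2 ≤ x.1 ∧ x.1 < x.2 ∧ x.2 < N - q + 2 ∧ (x.1 + q - 2, x.2 + q - 2) ∈ E) ∨
      (x.1 = 1 ∧ 3 ≤ x.2 ∧ x.2 < N - q + 2 ∧ ∃ a, 0 < a ∧ a < q ∧ (a, x.2 + q - 2) ∈ E) := by
    rintro x (hx | ⟨p, hp, hx | hx⟩)
    · have := hS hx
      have h2 : phiN q (Sum.inl (Sum.inr x)) ∈ E := Or.inr ⟨_, hx, rfl⟩
      simp only [VN, Set.mem_ofPred_eq, phiN] at this h2
      rcases this with this | this
      · rw [if_pos this.1] at h2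
        tauto
      · rw [if_neg (by omega)] at h2
        tauto
    · simp [uN] at hx
    · have := hS hp
      simp only [vN, Sum.inr.injEq] at hx
      subst hx
      simp only [VN, Set.mem_ofPred_eq] at this ⊢
      refine Or.inr (Or.inr ⟨trivial, by omega, by omega, p.1, this.1, this.2.1, ?_⟩)
      convert e3 _ hp using 1
      ext <;> simp only <;> omega
  refine ⟨?_, ?_, ⟨⟨?_, ?_, ?_⟩, ⟨?_, ?_, ?_⟩⟩, ?_⟩
  · rintro (x | x) hx
    · have := hS hx
      simp only [VN, Set.mem_ofPred_eq] at this
      refine ⟨fun a _ h => ?_, fun b _ h => ?_⟩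
      · simp only [uN, Sum.inl.injEq] at h; subst h; simp only at this; omega
      · simp [vN] at h
    · have := hS hx
      simp only [VN, Set.mem_ofPred_eq] at this
      refine ⟨fun a _ h => ?_, fun b _ h => ?_⟩
      · simp [uN] at h
      · simp only [vN, Sum.inr.injEq] at h; subst h; simp only at this; omega
  · intro p hp
    have := hS hp
    simp only [VN, Set.mem_ofPred_eq, Set.mem_Ioo] at this ⊢
    omega
  · intro x hx
    rcases keyL x hx with h | ⟨h1, h2, h3, h4⟩
    · exact Or.inl h.2
    · exact Or.inr ⟨h1, h2, h3⟩
  · intro x hx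
    simp only [vld, Set.mem_ofPred_eq]
    rcases keyL x hx with h | ⟨h1, h2, h3, h4⟩ <;> omega
  · intro x hx y hy z hz hC
    simp only [C3] at hC
    rcases keyL x hx with hx | ⟨_, _, _, _⟩ <;> rcases keyL y hy with hy | ⟨_, _, _, _⟩ <;>
      rcases keyL z hz with hz | ⟨_, _, _, b, hb1, hb2, hb3⟩ <;> (try omega)
    · exact h.2 x hx.1 y hy.1 z hz.1 hC
    · refine h.2 x hx.1 y hy.1 _ hb3 ?_
      simp only [C3]; omega
  · intro x hx
    simp only [WR, Set.mem_ofPred_eq]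
    rcases keyR x hx with h | h | ⟨h1, h2, h3, h4⟩ <;> omega
  · intro x hx
    simp only [vld, Set.mem_ofPred_eq]
    rcases keyR x hx with h | h | ⟨h1, h2, h3, h4⟩ <;> omega
  · intro x hx y hy z hz hC
    simp only [C3] at hC
    rcases keyR x hx with ⟨_, _, _, hx'⟩ | ⟨_, _, _, hx'⟩ | ⟨_, _, _, a, _, _, hx'⟩ <;>
    rcases keyR y hy with ⟨_, _, _, hy'⟩ | ⟨_, _, _, hy'⟩ | ⟨_, _, _, a', _, _, hy'⟩ <;>
    rcases keyR z hz with ⟨_, _, _, hz'⟩ | ⟨_, _, _, hz'⟩ | ⟨_, _, _, a'', _, _, hz'⟩ <;> 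
      (first | omega | exact h.2 _ hx' _ hy' _ hz' (by simp only [C3]; omega))
  · intro r hr r' hr' hc
    have h1 := hS hr
    have h2 := hS hr'
    simp only [VN, Set.mem_ofPred_eq] at h1 h2
    refine h.2 (0, q) (Or.inl rfl) r (e3 _ hr) r' (e3 _ hr') ?_
    simp only [C3]; omega

theorem base_flip {N : ℤ} (ih : ∀ M < N, FlipProp (FN M) (irr M)) :
    ∀ T, Facet (FN N) T → ∀ e ∈ T, e ∉ irr N →
      ∀ e0 ∈ T, e0 ∉ irr N → e0 ≠ e → e0.1 = 0 → FlipAt (FN N) T e := by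
  rintro T hT e he hei ⟨z, q⟩ h0 h0i hne rfl
  simp only [irr, Set.mem_ofPred_eq] at h0i
  have hq : 3 ≤ q := by omega
  have hqN : q ≤ N - 3 := by omega
  clear h0i
  have hfl := FJ_flip (Dat_LR hq hqN) (join_flip
    (FW_flip (N := q + 2) (W := WL q) ?_ (ih _ (by omega)))
    (FW_flip (N := N - q + 2) (W := WR (N - q + 2)) ?_ (ih _ (by omega))))
  · refine link_flip (F := FN N) (φ := phiN q) (VY := VN N q) (D := {(0, q)}) FN_mono ?_ ?_ ?_ ?_ ?_
      hfl hT (by simpa using h0) he (fun h => hne h.symm) ?_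
    · rintro ((x | x) | x) hx ((y | y) | y) hy h <;> have h1 := congrArg Prod.fst h <;>
        have h2 := congrArg Prod.snd h <;>
        simp only [VN, Set.mem_ofPred_eq] at hx hy <;> simp only [phiN] at h1 h2 <;>
        (try split_ifs at h1) <;> (first | (exfalso; omega) | (rw [Prod.ext (x := x) (y := y) (by omega) (by omega)]))
    · rintro S ⟨h1, h2, ⟨⟨h3, -⟩, ⟨h4, -⟩⟩, -⟩ ((x | x) | x) hx
      · have := h3 (show Sum.inl x ∈ prj (uN q) (vN q) S from Or.inl hx)
        simp only [WL, VN, Set.mem_ofPred_eq] at this ⊢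
        rcases this with h | ⟨h, h', h''⟩
        · exact h
        · exact ((h1 _ hx).1 x.1 ⟨h, h'⟩ (by rw [uN, ← h''])).elim
      · have := h4 (show Sum.inr x ∈ prj (uN q) (vN q) S from Or.inl hx)
        simp only [WR, VN, Set.mem_ofPred_eq] at this ⊢
        rcases this with h | h | ⟨h, h', h''⟩
        · exact Or.inl h
        · exact Or.inr h
        · refine ((h1 _ hx).2 (x.2 + q - 2) ⟨by omega, by omega⟩ ?_).elim
          rw [vN]; congr 1; ext <;> simp only <;> omega
      · have := h2 x hx
        simp only [VN, Set.mem_ofPred_eq, Set.mem_Ioo] at this ⊢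
        omega
    · rintro ((x | x) | x) hx h <;> have h1 := congrArg Prod.fst h <;>
        have h2 := congrArg Prod.snd h <;>
        simp only [VN, Set.mem_ofPred_eq] at hx <;> simp only [phiN] at h1 h2 <;>
        (try split_ifs at h1) <;> omega
    · intro S hS
      exact ⟨LR_fwd hq hqN hS, LR_bwd hq hqN hS⟩
    · intro z hz
      have hv := hz.1 (Set.mem_insert _ _)
      simp only [vld, Set.mem_ofPred_eq] at hv
      by_cases c0 : z = (0, q)
      · exact Or.inl c0
      have c0' : ¬ (z.1 = 0 ∧ z.2 = q) := fun h => c0 (Prod.ext h.1 h.2)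
      refine Or.inr ?_
      by_cases c1 : z.2 ≤ q
      · exact ⟨Sum.inl (Sum.inl z), ⟨by omega, by omega, c1, c0'⟩, rfl⟩
      by_cases c2 : z.1 = 0
      · refine ⟨Sum.inl (Sum.inr (0, z.2 - q + 2)), ?_, ?_⟩
        · simp only [VN, Set.mem_ofPred_eq, true_and, and_true]; omega
        · simp only [phiN]; ext <;> simp <;> omega
      by_cases c3 : q ≤ z.1
      · refine ⟨Sum.inl (Sum.inr (z.1 - q + 2, z.2 - q + 2)), ?_, ?_⟩
        · simp only [VN, Set.mem_ofPred_eq, true_and, and_true]; omega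
        · simp only [phiN]; rw [if_neg (by omega)]; ext <;> simp only <;> omega
      · exact ⟨Sum.inr z, ⟨by omega, by omega, by omega, by omega⟩, rfl⟩
    · rintro ((x | x) | x) hx rfl hC
      · rcases hC with ⟨y, ⟨z, hz, rfl⟩ | ⟨z, hz, rfl⟩, h⟩ | h | h <;>
          simp only [reduceCtorEq, Sum.inl.injEq] at h
        subst h
        simp only [VN, Set.mem_ofPred_eq, irr, phiN] at *; omega
      · rcases hC with ⟨y, ⟨z, hz, rfl⟩ | ⟨z, hz, rfl⟩, h⟩ | h | h <;>
          simp only [reduceCtorEq, Sum.inl.injEq, Sum.inr.injEq] at h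
        subst h
        simp only [VN, Set.mem_ofPred_eq, irr, phiN] at *
        split_ifs at hei <;> omega
      · rcases hC with ⟨y, ⟨z, hz, rfl⟩ | ⟨z, hz, rfl⟩, h⟩ | h | h <;>
          simp only [reduceCtorEq, Sum.inl.injEq, Sum.inr.injEq] at h
        all_goals
          subst h
          simp only [VN, Set.mem_ofPred_eq, irr, phiN] at *
          omega
  · intro p hp hpi
    simp only [vld, irr, WL, Set.mem_ofPred_eq] at *
    omega
  · intro p hp hpi
    simp only [vld, irr, WR, Set.mem_ofPred_eq] at *
    omega

theorem polygon_flip (N : ℤ) : FlipProp (FN N) (irr N) := by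
  have : ∀ k : ℕ, ∀ M : ℤ, M < k → FlipProp (FN M) (irr M) := by
    intro k
    induction k with
    | zero =>
      intro M hM T hT e he hei
      have := hT.1.1 he
      simp only [vld, Set.mem_ofPred_eq] at this
      exfalso; push_cast at hM; omega
    | succ k ih =>
      intro M hM T hT e he hei
      obtain ⟨e0, h0, h0i, hne⟩ := exists_other hT he hei
      have hv := hT.1.1 h0
      simp only [vld, Set.mem_ofPred_eq] at hv
      push_cast at hM
      refine flipAt_rot (base_flip fun M' hM' => ih M' (by omega)) e0.1.toNat T hT e he hei e0 h0
        h0i hne (by omega)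
  exact this (N.toNat + 1) N (by push_cast; omega)

end

section

/-- Three mutually crossing edges on the cover of the `4n`-gon. -/
def Cy (n : ℤ) (x y z : ℤ × ℤ) : Prop :=
  x.1 < y.1 ∧ y.1 < z.1 ∧ z.1 < x.2 ∧ x.2 < y.2 ∧ y.2 < z.2 ∧ z.2 < x.1 + 4 * n

/-- Lifts of periodic sets of edges. -/
structure PS (n : ℤ) (L : Set (ℤ × ℤ)) : Prop where
  val : ∀ p ∈ L, p.1 < p.2 ∧ p.2 < p.1 + 4 * n
  per : ∀ p : ℤ × ℤ, p ∈ L ↔ (p.1 + n, p.2 + n) ∈ L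
  sig : ∀ p ∈ L, (p.2, p.1 + 4 * n) ∈ L

def FreeL (n : ℤ) (L : Set (ℤ × ℤ)) : Prop :=
  ∀ x ∈ L, ∀ y ∈ L, ∀ z ∈ L, ¬ Cy n x y z

def Wit (n : ℤ) (L : Set (ℤ × ℤ)) (p : ℤ × ℤ) : Prop := ∃ x ∈ L, ∃ y ∈ L, Cy n p x y

def MaxL (n : ℤ) (L : Set (ℤ × ℤ)) : Prop :=
  ∀ p : ℤ × ℤ, p.1 < p.2 → p.2 < p.1 + 4 * n → p ∉ L → Wit n L p

structure CT (n : ℤ) (L : Set (ℤ × ℤ)) : Prop extends PS n L where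
  free : FreeL n L
  max : MaxL n L

def orb (n : ℤ) (e : ℤ × ℤ) : Set (ℤ × ℤ) :=
  {p | ∃ k : ℤ, p = (e.1 + k * n, e.2 + k * n) ∨ p = (e.2 + k * n, e.1 + 4 * n + k * n)}

theorem PS.shift {n : ℤ} {L : Set (ℤ × ℤ)} (h : PS n L) (k : ℤ) :
    ∀ a b : ℤ, (a, b) ∈ L ↔ (a + k * n, b + k * n) ∈ L := by
  induction k using Int.induction_on with
  | zero => intro a b; simp
  | succ k ih =>
    intro a b
    rw [ih, h.per]
    simp only
    ring_nf
  | pred k ih =>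
    intro a b
    rw [ih, h.per (a + (-(k : ℤ) - 1) * n, _)]
    simp only
    rw [show a + (-(k : ℤ) - 1) * n + n = a + (-k) * n by ring,
      show b + (-(k : ℤ) - 1) * n + n = b + (-k) * n by ring]

theorem PS.mem_shift {n : ℤ} {L : Set (ℤ × ℤ)} (h : PS n L) (k : ℤ) {a b c d : ℤ}
    (hm : (a, b) ∈ L) (h1 : c = a + k * n) (h2 : d = b + k * n) : (c, d) ∈ L := by
  subst h1 h2
  exact (h.shift k a b).1 hm

theorem PS.sig' {n : ℤ} {L : Set (ℤ × ℤ)} (h : PS n L) {a b : ℤ} (hm : (a, b) ∈ L) :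
    (b - 4 * n, a) ∈ L :=
  h.mem_shift (-4) (h.sig _ hm) (by simp only; ring) (by simp only; ring)

theorem orb_subset {n : ℤ} {L : Set (ℤ × ℤ)} (h : PS n L) {e : ℤ × ℤ} (he : e ∈ L) :
    orb n e ⊆ L := by
  rintro p ⟨k, rfl | rfl⟩
  · exact (h.shift k _ _).1 he
  · exact (h.shift k _ _).1 (h.sig _ he)

theorem mem_orb_self (n : ℤ) (e : ℤ × ℤ) : e ∈ orb n e := ⟨0, Or.inl (by simp)⟩

theorem PS_orb {n : ℤ} {e : ℤ × ℤ} (h1 : e.1 < e.2) (h2 : e.2 < e.1 + 4 * n) : PS n (orb n e) where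
  val := by
    rintro p ⟨k, rfl | rfl⟩ <;> simp only <;> constructor <;> linarith
  per := by
    rintro ⟨a, b⟩
    constructor
    · rintro ⟨k, h | h⟩ <;> simp only [Prod.mk.injEq] at h <;> refine ⟨k + 1, ?_⟩
      · left; ext <;> simp only <;> linarith
      · right; ext <;> simp only <;> linarith
    · rintro ⟨k, h | h⟩ <;> simp only [Prod.mk.injEq] at h <;> refine ⟨k - 1, ?_⟩
      · left; ext <;> simp only <;> linarith
      · right; ext <;> simp only <;> linarith
  sig := by
    rintro p ⟨k, rfl | rfl⟩
    · refine ⟨k, Or.inr ?_⟩; ext <;> simp only; ring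
    · refine ⟨k + 4, Or.inl ?_⟩; ext <;> simp only <;> ring

theorem PS_union {n : ℤ} {L M : Set (ℤ × ℤ)} (h : PS n L) (h' : PS n M) : PS n (L ∪ M) where
  val := by rintro p (hp | hp); exacts [h.val p hp, h'.val p hp]
  per := by
    intro p
    exact or_congr (h.per p) (h'.per p)
  sig := by
    rintro p (hp | hp)
    · exact Or.inl (h.sig p hp)
    · exact Or.inr (h'.sig p hp)

theorem PS_diff {n : ℤ} {L M : Set (ℤ × ℤ)} (h : PS n L) (h' : PS n M) : PS n (L \ M) where
  val := fun p hp => h.val p hp.1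
  per := fun p => and_congr (h.per p) (not_congr (h'.per p))
  sig := by
    rintro ⟨a, b⟩ ⟨h1, h2⟩
    refine ⟨h.sig _ h1, fun h3 => h2 ?_⟩
    have := h'.sig' h3
    simpa using this

theorem orb_eq_of_mem {n : ℤ} {e f : ℤ × ℤ} (h1 : e.1 < e.2) (h2 : e.2 < e.1 + 4 * n)
    (hf : f ∈ orb n e) : orb n f = orb n e := by
  have h3 := (PS_orb h1 h2).val f hf
  apply Set.Subset.antisymm
  · exact orb_subset (PS_orb h1 h2) hf
  · refine orb_subset (PS_orb h3.1 h3.2) ?_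
    obtain ⟨k, rfl | rfl⟩ := hf
    · exact ⟨-k, Or.inl (by ext <;> simp only <;> ring)⟩
    · exact ⟨-k-4, Or.inr (by ext <;> simp only <;> ring)⟩

/-- normalization of crossing triples -/
theorem wit2 {n : ℤ} {L : Set (ℤ × ℤ)} (h : PS n L) {x p y : ℤ × ℤ} (hx : x ∈ L) (hy : y ∈ L)
    (hC : Cy n x p y) : Wit n L p := by
  refine ⟨y, hy, _, h.sig x hx, ?_⟩
  simp only [Cy] at *; omega

theorem wit3 {n : ℤ} {L : Set (ℤ × ℤ)} (h : PS n L) {x p y : ℤ × ℤ} (hx : x ∈ L) (hy : y ∈ L)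
    (hC : Cy n x y p) : Wit n L p := by
  refine ⟨_, h.sig x hx, _, h.sig y hy, ?_⟩
  simp only [Cy] at *; omega

theorem Wit_sig {n : ℤ} {L : Set (ℤ × ℤ)} (h : PS n L) {a b : ℤ}
    (hw : Wit n L (b, a + 4 * n)) : Wit n L (a, b) := by
  obtain ⟨x, hx, y, hy, hC⟩ := hw
  refine ⟨_, h.sig' hx, _, h.sig' hy, ?_⟩
  simp only [Cy] at *; omega

theorem Wit_shift {n : ℤ} {L : Set (ℤ × ℤ)} (h : PS n L) (k : ℤ) {a b : ℤ}
    (hw : Wit n L (a, b)) : Wit n L (a + k * n, b + k * n) := by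
  obtain ⟨x, hx, y, hy, hC⟩ := hw
  refine ⟨_, (h.shift k _ _).1 hx, _, (h.shift k _ _).1 hy, ?_⟩
  simp only [Cy] at *
  generalize k * n = m at *
  omega

theorem SSS {n : ℤ} {K : ℤ × ℤ → Prop} (hK : ∀ a b, K (a, b) → K (a + 4 * n, b + 4 * n))
    {x y z : ℤ × ℤ} (hC : Cy n x y z) (hx : K x ∨ K (x.2 - 4 * n, x.1))
    (hy : K y ∨ K (y.2 - 4 * n, y.1)) (hz : K z ∨ K (z.2 - 4 * n, z.1)) :
    (∃ x y z, K x ∧ K y ∧ K z ∧ Cy n x y z) ∨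
    (∃ x z w : ℤ × ℤ, K x ∧ K z ∧ K w ∧ x.1 < z.1 ∧ z.1 < x.2 ∧ x.2 < w.1 ∧ w.1 < z.2 ∧
      x.1 + 4 * n < w.2) := by
  have hs : ∀ a b, K (b - 4 * n, a) → K (b, a + 4 * n) := fun a b h => by
    have := hK _ _ h
    rwa [sub_add_cancel] at this
  obtain ⟨a, a'⟩ := x
  obtain ⟨b, b'⟩ := y
  obtain ⟨c, c'⟩ := z
  simp only [Cy] at *
  rcases hx with hx | hx <;> rcases hy with hy | hy <;> rcases hz with hz | hz
  · exact Or.inl ⟨_, _, _, hx, hy, hz, by simp only; omega⟩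
  · exact Or.inl ⟨_, _, _, hz, hx, hy, by simp only; omega⟩
  · exact Or.inr ⟨_, _, _, hx, hz, hs _ _ hy, by simp only; omega⟩
  · exact Or.inl ⟨_, _, _, hy, hz, hx, by simp only; omega⟩
  · exact Or.inl ⟨_, _, _, hy, hz, hs _ _ hx, by simp only; omega⟩
  · exact Or.inr ⟨_, _, _, hy, hs _ _ hx, hs _ _ hz, by simp only; omega⟩
  · exact Or.inl ⟨_, _, _, hz, hs _ _ hx, hs _ _ hy, by simp only; omega⟩
  · exact Or.inl ⟨_, _, _, hx, hy, hz, by simp only; omega⟩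

end

section

abbrev YC := (ℤ × ℤ) ⊕ (ℤ × ℤ)

def WC (n : ℤ) : Set (ℤ × ℤ) :=
  {p | (0 ≤ p.1 ∧ p.1 < p.2 ∧ p.2 ≤ n) ∨ (0 ≤ p.1 ∧ p.1 < n ∧ p.2 = n + 1) ∨
    (1 ≤ p.1 ∧ p.1 ≤ n ∧ p.2 = n + 2)}

def uC (n : ℤ) (a : ℤ) : ℤ × ℤ := (a, n + 1)
def vC (n : ℤ) (b : ℤ) : ℤ × ℤ := (b, n + 2)

def phiC (n : ℤ) : YC → ℤ × ℤ
  | Sum.inl p => p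
  | Sum.inr p => (p.1, n + p.2)

def VC (n : ℤ) : Set YC := {y | match y with
  | Sum.inl p => 0 ≤ p.1 ∧ p.1 < p.2 ∧ p.2 ≤ n
  | Sum.inr p => 0 ≤ p.1 ∧ p.1 < n ∧ 1 ≤ p.2 ∧ p.2 ≤ n}

def FJC (n : ℤ) (S : Set YC) : Prop :=
  FJ (FW (n + 3) (WC n)) (uC n) (vC n) (Set.Icc 0 (n - 1)) (Set.Icc 1 n) S

theorem Dat_C {n : ℤ} (hn : 1 ≤ n) : Dat (FW (n + 3) (WC n)) (irr (n + 3)) (uC n) (vC n)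
    (Set.Icc 0 (n - 1)) (Set.Icc 1 n) 0 (n - 1) 1 n where
  mono := fun S S' h h' => ⟨h.trans h'.1, FN_mono _ _ h h'.2⟩
  fin := fun S h => FN_fin S h.2
  hu := by intro a b h; simpa [uC] using h
  hv := by intro a b h; simpa [vC] using h
  huv := by intro a b; simp [uC, vC]
  ha0 := by simp only [Set.mem_Icc]; omega
  ha1 := by simp only [Set.mem_Icc]; omega
  hb0 := by simp only [Set.mem_Icc]; omega
  hb1 := by simp only [Set.mem_Icc]; omega
  hU := by intro a ha; simp only [Set.mem_Icc] at ha; omega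
  hV := by intro a ha; simp only [Set.mem_Icc] at ha; omega
  ca0 := by
    intro S hS
    refine FW_cone_one ?_ ?_ ?_ _ hS
    · simp only [WC, uC, Set.mem_ofPred_eq, and_true]; omega
    · simp only [vld, uC, Set.mem_ofPred_eq]; omega
    · simp only [irr, uC, Set.mem_ofPred_eq]; omega
  ca1 := by
    intro S hS
    refine FW_cone_one ?_ ?_ ?_ _ hS
    · simp only [WC, uC, Set.mem_ofPred_eq, and_true]; omega
    · simp only [vld, uC, Set.mem_ofPred_eq]; omega
    · simp only [irr, uC, Set.mem_ofPred_eq]; omega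
  cb0 := by
    intro S hS
    refine FW_cone_one ?_ ?_ ?_ _ hS
    · simp only [WC, vC, Set.mem_ofPred_eq, and_true]; omega
    · simp only [vld, vC, Set.mem_ofPred_eq]; omega
    · simp only [irr, vC, Set.mem_ofPred_eq]; omega
  cb1 := by
    intro S hS
    refine FW_cone_one ?_ ?_ ?_ _ hS
    · simp only [WC, vC, Set.mem_ofPred_eq, and_true]; omega
    · simp only [vld, vC, Set.mem_ofPred_eq]; omega
    · simp only [irr, vC, Set.mem_ofPred_eq]; omega
  hCu := by
    intro a ha h
    simp only [irr, uC, Set.mem_ofPred_eq, Set.mem_Icc] at *; omega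
  hCv := by
    intro a ha h
    simp only [irr, vC, Set.mem_ofPred_eq, Set.mem_Icc] at *; omega

theorem FJC_flip {n : ℤ} (hn : 1 ≤ n) : FlipProp (FJC n)
    {y | (∃ x ∈ irr (n + 3), y = Sum.inl x) ∨ y = Sum.inr (0, n) ∨ y = Sum.inr (n - 1, 1)} := by
  refine FJ_flip (Dat_C hn) (FW_flip ?_ (polygon_flip _))
  intro p hp hpi
  simp only [vld, irr, WC, Set.mem_ofPred_eq] at *
  omega

theorem FJC_V {n : ℤ} {S : Set YC} (h : FJC n S) : S ⊆ VC n := by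
  obtain ⟨h1, h2, ⟨h3, -⟩, -⟩ := h
  rintro (x | x) hx
  · have := h3 (show x ∈ prj (uC n) (vC n) S from Or.inl hx)
    simp only [WC, VC, Set.mem_ofPred_eq] at this ⊢
    rcases this with h | ⟨h, h', h''⟩ | ⟨h, h', h''⟩
    · exact h
    · exact ((h1 _ hx).1 x.1 ⟨h, by omega⟩ (by rw [uC, ← h''])).elim
    · exact ((h1 _ hx).2 x.1 ⟨h, by omega⟩ (by rw [vC, ← h''])).elim
  · have := h2 x hx
    simp only [VC, Set.mem_ofPred_eq, Set.mem_Icc] at this ⊢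
    omega

def Psi (n : ℤ) (S : Set YC) : Set (ℤ × ℤ) := {p | ∃ y ∈ S, p ∈ orb n (phiC n y)}

theorem phiC_val {n : ℤ} (hn : 1 ≤ n) {y : YC} (hy : y ∈ VC n) :
    0 ≤ (phiC n y).1 ∧ (phiC n y).1 < n ∧ (phiC n y).1 < (phiC n y).2 ∧ (phiC n y).2 ≤ 2 * n := by
  rcases y with y | y <;> simp only [VC, Set.mem_ofPred_eq, phiC] at * <;> omega

theorem PS_Psi {n : ℤ} (hn : 1 ≤ n) {S : Set YC} (hS : S ⊆ VC n) : PS n (Psi n S) := by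
  have h : ∀ y ∈ S, PS n (orb n (phiC n y)) := fun y hy => by
    have := phiC_val hn (hS hy)
    exact PS_orb (by omega) (by omega)
  constructor
  · rintro p ⟨y, hy, hp⟩
    exact (h y hy).val p hp
  · intro p
    exact exists_congr fun y => and_congr_right fun hy => (h y hy).per p
  · rintro p ⟨y, hy, hp⟩
    exact ⟨y, hy, (h y hy).sig p hp⟩

theorem blk {n t j lo hi : ℤ} (h0 : 0 ≤ t) (h1 : t < n) (h2 : lo * n ≤ t + j * n)
    (h3 : t + j * n < hi * n) : lo ≤ j ∧ j < hi := by
  constructor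
  · by_contra h
    have : j * n ≤ (lo - 1) * n := mul_le_mul_of_nonneg_right (by omega) (by omega)
    linarith
  · by_contra h
    have : hi * n ≤ j * n := mul_le_mul_of_nonneg_right (by omega) (by omega)
    linarith

def KS (n : ℤ) (S : Set YC) (p : ℤ × ℤ) : Prop :=
  ∃ y ∈ S, ∃ k : ℤ, p = ((phiC n y).1 + k * n, (phiC n y).2 + k * n)

theorem KS_shift {n : ℤ} {S : Set YC} (k : ℤ) {p : ℤ × ℤ} (h : KS n S p) :
    KS n S (p.1 + k * n, p.2 + k * n) := by
  obtain ⟨y, hy, j, rfl⟩ := h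
  exact ⟨y, hy, j + k, by ext <;> simp only <;> ring⟩

theorem mem_Psi {n : ℤ} {S : Set YC} {p : ℤ × ℤ} :
    p ∈ Psi n S ↔ KS n S p ∨ KS n S (p.2 - 4 * n, p.1) := by
  constructor
  · rintro ⟨y, hy, k, rfl | rfl⟩
    · exact Or.inl ⟨y, hy, k, rfl⟩
    · exact Or.inr ⟨y, hy, k, by ext <;> simp only; ring⟩
  · rintro (⟨y, hy, k, rfl⟩ | ⟨y, hy, k, h⟩)
    · exact ⟨y, hy, k, Or.inl rfl⟩
    · simp only [Prod.mk.injEq] at h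
      exact ⟨y, hy, k, Or.inr (by ext <;> simp only <;> linarith)⟩

/-- elements of `KS` with small starting point -/
theorem KS_blk {n : ℤ} (hn : 1 ≤ n) {S : Set YC} (hS : S ⊆ VC n) {p : ℤ × ℤ} (hp : KS n S p)
    (h0 : 0 ≤ p.1) (h1 : p.1 < 2 * n) : 
    (Sum.inl p ∈ S ∧ 0 ≤ p.1 ∧ p.1 < p.2 ∧ p.2 ≤ n) ∨
    (Sum.inr (p.1, p.2 - n) ∈ S ∧ p.1 < n ∧ n < p.2 ∧ p.2 ≤ 2 * n) ∨
    (Sum.inl (p.1 - n, p.2 - n) ∈ S ∧ n ≤ p.1 ∧ p.1 < p.2 ∧ p.2 ≤ 2 * n) ∨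
    (Sum.inr (p.1 - n, p.2 - 2 * n) ∈ S ∧ n ≤ p.1 ∧ 2 * n < p.2 ∧ p.2 ≤ 3 * n) := by
  obtain ⟨y, hy, k, rfl⟩ := hp
  have hv := phiC_val hn (hS hy)
  have hv' := hS hy
  simp only at h0 h1
  have hk := blk (lo := 0) (hi := 2) hv.1 hv.2.1 (by linarith) h1
  have hk' : k = 0 ∨ k = 1 := by omega
  rcases y with ⟨a, b⟩ | ⟨a, b⟩ <;> simp only [phiC, VC, Set.mem_ofPred_eq] at * <;>
    rcases hk' with rfl | rfl
  · left; simp only [zero_mul, add_zero]; exact ⟨hy, by omega⟩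
  · right; right; left; simp only [one_mul, add_sub_cancel_right]; exact ⟨hy, by omega⟩
  · right; left; simp only [zero_mul, add_zero]
    rw [show n + b - n = b by ring]; exact ⟨hy, by omega⟩
  · right; right; right; simp only [one_mul, add_sub_cancel_right]
    rw [show n + b + n - 2 * n = b by ring]; exact ⟨hy, by omega⟩

theorem psi_free {n : ℤ} (hn : 1 ≤ n) {S : Set YC} (h : FJC n S) : FreeL n (Psi n S) := by
  have hS := FJC_V h
  obtain ⟨-, -, ⟨-, -, hF⟩, hJ⟩ := h
  have cI : ∀ p, Sum.inl p ∈ S → p ∈ prj (uC n) (vC n) S := fun p hp => Or.inl hp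
  have cU : ∀ a b, Sum.inr (a, b) ∈ S → (a, n + 1) ∈ prj (uC n) (vC n) S :=
    fun a b hp => Or.inr ⟨_, hp, Or.inl rfl⟩
  have cV : ∀ a b, Sum.inr (a, b) ∈ S → (b, n + 2) ∈ prj (uC n) (vC n) S :=
    fun a b hp => Or.inr ⟨_, hp, Or.inr rfl⟩
  intro x hx y hy z hz hC
  have hsh : ∀ a b, KS n S (a, b) → KS n S (a + 4 * n, b + 4 * n) := fun a b h => KS_shift 4 h
  rcases SSS hsh hC (mem_Psi.1 hx) (mem_Psi.1 hy) (mem_Psi.1 hz) with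
    ⟨x, y, z, hx, hy, hz, hC⟩ | ⟨x, z, w, hx, hz, hw, hC⟩
  · obtain ⟨k, hk⟩ : ∃ k : ℤ, 0 ≤ x.1 + k * n ∧ x.1 + k * n < n := by
      obtain ⟨y, hy, k, rfl⟩ := hx
      have := phiC_val hn (hS hy)
      refine ⟨-k, ?_⟩
      simp only
      constructor <;> linarith
    obtain ⟨x, y, z, hx, hy, hz, hC, hx0, hx1⟩ : ∃ x y z, KS n S x ∧ KS n S y ∧ KS n S z ∧ 
        Cy n x y z ∧ 0 ≤ x.1 ∧ x.1 < n := by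
      refine ⟨_, _, _, KS_shift k hx, KS_shift k hy, KS_shift k hz, ?_, hk⟩
      simp only [Cy] at *
      generalize k * n = m at *
      omega
    obtain ⟨a, a'⟩ := x
    obtain ⟨b, b'⟩ := y
    obtain ⟨c, c'⟩ := z
    simp only [Cy] at hC hx0 hx1
    rcases KS_blk hn hS hx (by simp only; omega) (by simp only; omega) with
      ⟨hx, hx'⟩ | ⟨hx, hx'⟩ | ⟨hx, hx'⟩ | ⟨hx, hx'⟩ <;> simp only at hx hx' <;> try omega
    all_goals rcases KS_blk hn hS hy (by simp only; omega) (by simp only; omega) with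
      ⟨hy, hy'⟩ | ⟨hy, hy'⟩ | ⟨hy, hy'⟩ | ⟨hy, hy'⟩ <;> simp only at hy hy' <;> try omega
    all_goals rcases KS_blk hn hS hz (by simp only; omega) (by simp only; omega) with
      ⟨hz, hz'⟩ | ⟨hz, hz'⟩ | ⟨hz, hz'⟩ | ⟨hz, hz'⟩ <;> simp only at hz hz' <;> try omega
    · refine hF _ (cI _ hx) _ (cI _ hy) _ (cI _ hz) ?_
      simp only [C3]; omega
    · refine hF _ (cI _ hx) _ (cI _ hy) _ (cU _ _ hz) ?_
      simp only [C3]; omega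
    · exact hJ _ hy _ hz (by simp only; omega)
    · exact hJ _ hx _ hy (by simp only; omega)
    · exact hJ _ hx _ hy (by simp only; omega)
    · exact hJ _ hx _ hy (by simp only; omega)
    · refine hF _ (cI _ hy) _ (cI _ hz) _ (cV _ _ hx) ?_
      simp only [C3]; omega
    · refine hF _ (cI _ hy) _ (cU _ _ hz) _ (cV _ _ hx) ?_
      simp only [C3]; omega
    · exact hJ _ hy _ hz (by simp only; omega)
  · obtain ⟨sx, hsx, i, rfl⟩ := hx
    obtain ⟨sz, hsz, j, rfl⟩ := hz
    obtain ⟨sw, hsw, k, rfl⟩ := hw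
    have h1 := phiC_val hn (hS hsx)
    have h2 := phiC_val hn (hS hsz)
    have h3 := phiC_val hn (hS hsw)
    simp only at hC
    have hj := blk (j := j) (lo := i) (hi := i + 2) h2.1 h2.2.1 (by linarith) (by linarith)
    have hj' : j * n ≤ (i + 1) * n := mul_le_mul_of_nonneg_right (by omega) (by omega)
    have hk := blk (j := k) (lo := i) (hi := i + 3) h3.1 h3.2.1 (by linarith) (by linarith)
    have hk' : k * n ≤ (i + 2) * n := mul_le_mul_of_nonneg_right (by omega) (by omega)
    linarith

/-- lifts of polygon edges to the cover -/
def LiftRel (n : ℤ) (x p : ℤ × ℤ) : Prop :=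
  (0 ≤ x.1 ∧ x.1 < x.2 ∧ x.2 ≤ n ∧ p = x) ∨
  (x.2 = n + 1 ∧ 0 ≤ x.1 ∧ x.1 < n ∧ p.1 = x.1 ∧ n + 1 ≤ p.2 ∧ p.2 ≤ 2 * n) ∨
  (x.2 = n + 2 ∧ 1 ≤ x.1 ∧ x.1 ≤ n ∧ p.2 = x.1 ∧ -n ≤ p.1 ∧ p.1 < 0)

theorem lift_C3 {n : ℤ} {x y z p q r : ℤ × ℤ} (h : C3 x y z) (h1 : LiftRel n x p)
    (h2 : LiftRel n y q) (h3 : LiftRel n z r) : Cy n p q r ∨ Cy n r p q := by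
  simp only [C3, LiftRel, Cy, Prod.ext_iff] at *
  omega

theorem lift_ex {n : ℤ} {L : Set (ℤ × ℤ)} (hL : PS n L) {x : ℤ × ℤ}
    (hx : x ∈ prj (uC n) (vC n) {y | y ∈ VC n ∧ phiC n y ∈ L}) : ∃ p ∈ L, LiftRel n x p := by
  rcases hx with ⟨h1, h2⟩ | ⟨p, ⟨h1, h2⟩, rfl | rfl⟩
  · simp only [VC, phiC, Set.mem_ofPred_eq] at h1 h2
    exact ⟨x, h2, Or.inl ⟨h1.1, h1.2.1, h1.2.2, rfl⟩⟩
  · simp only [VC, phiC, Set.mem_ofPred_eq] at h1 h2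
    refine ⟨_, h2, Or.inr (Or.inl ?_)⟩
    simp only [uC, true_and, and_true]; omega
  · simp only [VC, phiC, Set.mem_ofPred_eq] at h1 h2
    refine ⟨(p.1 - n, p.2), hL.mem_shift (-1) h2 (by ring) (by ring), Or.inr (Or.inr ?_)⟩
    simp only [vC, true_and, and_true]; omega

theorem prj_sub_WC {n : ℤ} {S : Set YC} (hS : S ⊆ VC n) : prj (uC n) (vC n) S ⊆ WC n := by
  rintro x (h | ⟨p, h, rfl | rfl⟩) <;> have := hS h <;>
    simp only [VC, uC, vC, WC, Set.mem_ofPred_eq, and_true] at * <;> omega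

theorem FJC_of {n : ℤ} {S : Set YC} (hS : S ⊆ VC n)
    (h1 : ∀ x ∈ prj (uC n) (vC n) S, ∀ y ∈ prj (uC n) (vC n) S, ∀ z ∈ prj (uC n) (vC n) S,
      ¬ C3 x y z) (h2 : NC (Sum.inr ⁻¹' S)) : FJC n S := by
  refine ⟨?_, ?_, ⟨prj_sub_WC hS, (prj_sub_WC hS).trans ?_, h1⟩, h2⟩
  · intro x hx
    have := hS hx
    simp only [VC, Set.mem_ofPred_eq] at this
    refine ⟨fun a ha h => ?_, fun a ha h => ?_⟩ <;> subst h <;> simp only [uC, vC] at this <;> omega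
  · intro p hp
    have := hS hp
    simp only [VC, Set.mem_ofPred_eq, Set.mem_Icc] at *; omega
  · intro p hp
    simp only [WC, vld, Set.mem_ofPred_eq] at *; omega

theorem D_mem {n : ℤ} {L : Set (ℤ × ℤ)} (hL : PS n L) (h0 : (0, 2 * n) ∈ L) (k : ℤ) :
    (k * n, 2 * n + k * n) ∈ L := hL.mem_shift k h0 (by ring) (by ring)

theorem free_FJC {n : ℤ} {L : Set (ℤ × ℤ)} (hL : PS n L) (hf : FreeL n L)
    (h0 : (0, 2 * n) ∈ L) : FJC n {y | y ∈ VC n ∧ phiC n y ∈ L} := by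
  refine FJC_of (fun y hy => hy.1) ?_ ?_
  · intro x hx y hy z hz hC
    obtain ⟨p, hp, hp'⟩ := lift_ex hL hx
    obtain ⟨q, hq, hq'⟩ := lift_ex hL hy
    obtain ⟨r, hr, hr'⟩ := lift_ex hL hz
    rcases lift_C3 hC hp' hq' hr' with h | h
    · exact hf _ hp _ hq _ hr h
    · exact hf _ hr _ hp _ hq h
  · rintro p ⟨hp, hp'⟩ q ⟨hq, hq'⟩ h
    refine hf _ hp' _ hq' _ (D_mem hL h0 1) ?_
    simp only [VC, phiC, Cy, Set.mem_ofPred_eq] at *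
    omega

/-- Classification of edges which do not cross both diameters. -/
theorem classify {n : ℤ} (hn : 1 ≤ n) {L : Set (ℤ × ℤ)} (hL : PS n L) (h0 : (0, 2 * n) ∈ L)
    {p : ℤ × ℤ} (h1 : p.1 < p.2) (h2 : p.2 < p.1 + 4 * n) (hw : ¬ Wit n L p) :
    ∃ y ∈ VC n, ∃ k : ℤ, p = ((phiC n y).1 + k * n, (phiC n y).2 + k * n) ∨
      (p.2 - 4 * n, p.1) = ((phiC n y).1 + k * n, (phiC n y).2 + k * n) := by
  obtain ⟨k, t, hk, ht0, ht1⟩ : ∃ k t : ℤ, p.1 = t + k * n ∧ 0 ≤ t ∧ t < n :=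
    ⟨p.1 / n, p.1 % n, by rw [mul_comm]; exact (Int.emod_add_mul_ediv _ _).symm, Int.emod_nonneg _ (by omega),
      Int.emod_lt_of_pos _ (by omega)⟩
  obtain ⟨s, hs⟩ : ∃ s : ℤ, p.2 = s + k * n := ⟨p.2 - k * n, by ring⟩
  obtain ⟨a, b⟩ := p
  simp only at hk hs h1 h2
  subst hk hs
  have hw' : ¬ Wit n L (t, s) := fun h => hw (Wit_shift hL k h)
  have d0 := D_mem hL h0 0
  have d1 := D_mem hL h0 1
  have d2 := D_mem hL h0 2
  have d3 := D_mem hL h0 3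
  have e12 : ¬ Cy n (t, s) (1 * n, 2 * n + 1 * n) (2 * n, 2 * n + 2 * n) :=
    fun h => hw' ⟨_, d1, _, d2, h⟩
  simp only [Cy] at e12
  by_cases c1 : s ≤ n
  · exact ⟨Sum.inl (t, s), by simp only [VC, Set.mem_ofPred_eq]; omega, k, Or.inl rfl⟩
  by_cases c2 : s ≤ 2 * n
  · refine ⟨Sum.inr (t, s - n), by simp only [VC, Set.mem_ofPred_eq]; omega, k, Or.inl ?_⟩
    simp only [phiC]; ext <;> simp only <;> ring
  by_cases c3 : 4 * n ≤ s
  · refine ⟨Sum.inl (s - 4 * n, t), ?_, k, Or.inr ?_⟩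
    · simp only [VC, Set.mem_ofPred_eq]; omega
    · simp only [phiC]; ext <;> simp only; ring
  by_cases c4 : t = 0
  · subst c4
    by_cases c5 : 3 * n ≤ s
    · refine ⟨Sum.inl (s - 3 * n, n), ?_, k - 1, Or.inr ?_⟩
      · simp only [VC, Set.mem_ofPred_eq]; omega
      · simp only [phiC]; ext <;> simp only <;> ring
    · refine ⟨Sum.inr (s - 2 * n, n), ?_, k - 2, Or.inr ?_⟩
      · simp only [VC, Set.mem_ofPred_eq]; omega
      · simp only [phiC]; ext <;> simp only <;> ring
  have c5 : 3 * n ≤ s := by omega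
  · refine ⟨Sum.inr (s - 3 * n, t), ?_, k - 1, Or.inr ?_⟩
    · simp only [VC, Set.mem_ofPred_eq]; omega
    · simp only [phiC]; ext <;> simp only <;> ring

theorem not_wit {n : ℤ} {L : Set (ℤ × ℤ)} (hf : FreeL n L) {p : ℤ × ℤ} (hp : p ∈ L) :
    ¬ Wit n L p := fun ⟨x, hx, y, hy, h⟩ => hf p hp x hx y hy h

theorem Psi_eq {n : ℤ} (hn : 1 ≤ n) {L : Set (ℤ × ℤ)} (hL : PS n L) (hf : FreeL n L)
    (h0 : (0, 2 * n) ∈ L) : Psi n {y | y ∈ VC n ∧ phiC n y ∈ L} = L := by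
  apply Set.Subset.antisymm
  · rintro p ⟨y, hy, hp⟩
    exact orb_subset hL hy.2 hp
  · intro p hp
    have hv := hL.val p hp
    obtain ⟨y, hy, k, h | h⟩ := classify hn hL h0 hv.1 hv.2 (not_wit hf hp)
    · refine mem_Psi.2 (Or.inl ⟨y, ⟨hy, ?_⟩, k, h⟩)
      rw [h] at hp
      exact (hL.shift k _ _).2 hp
    · refine mem_Psi.2 (Or.inr ⟨y, ⟨hy, ?_⟩, k, h⟩)
      have := hL.sig' hp
      rw [h] at this
      exact (hL.shift k _ _).2 this

theorem CT_facet {n : ℤ} (hn : 1 ≤ n) {L : Set (ℤ × ℤ)} (hL : CT n L)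
    (h0 : (0, 2 * n) ∈ L) : Facet (FJC n) {y | y ∈ VC n ∧ phiC n y ∈ L} := by
  refine ⟨free_FJC hL.toPS hL.free h0, fun y hy => ?_⟩
  have hyV := FJC_V hy (Set.mem_insert _ _)
  refine ⟨hyV, ?_⟩
  by_contra hc
  have hv := phiC_val hn hyV
  obtain ⟨p, hp, q, hq, hC⟩ := hL.max _ (by omega) (by omega) hc
  have hfr := psi_free hn hy
  have hsub : L ⊆ Psi n (insert y {y | y ∈ VC n ∧ phiC n y ∈ L}) := by
    intro p hp
    rw [← Psi_eq hn hL.toPS hL.free h0] at hp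
    obtain ⟨z, hz, hz'⟩ := hp
    exact ⟨z, Or.inr hz, hz'⟩
  exact hfr _ ⟨y, Or.inl rfl, mem_orb_self _ _⟩ _ (hsub hp) _ (hsub hq) hC

theorem phi_orb_inj {n : ℤ} (hn : 1 ≤ n) {y y' : YC} (hy : y ∈ VC n) (hy' : y' ∈ VC n)
    (h : phiC n y ∈ orb n (phiC n y')) : y = y' := by
  have h1 := phiC_val hn hy
  have h2 := phiC_val hn hy'
  have key : phiC n y = phiC n y' := by
    obtain ⟨k, hk | hk⟩ := h
    · have e1 := congrArg Prod.fst hk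
      simp only at e1
      have := blk (lo := 0) (hi := 1) (j := k) h2.1 h2.2.1 (by linarith) (by linarith)
      have hk0 : k = 0 := by omega
      subst hk0
      simpa using hk
    · have e1 := congrArg Prod.fst hk
      have e2 := congrArg Prod.snd hk
      simp only at e1 e2
      ext <;> generalize k * n = m at * <;> omega
  rcases y with y | y <;> rcases y' with y' | y' <;>
    simp only [phiC, VC, Set.mem_ofPred_eq] at key hy hy'
  · rw [key]
  · have := congrArg Prod.snd key; simp only at this; omega
  · have := congrArg Prod.snd key; simp only at this; omega
  · simp only [Prod.mk.injEq, add_right_inj] at key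
    rw [Prod.ext (x := y) (y := y') key.1 key.2]

theorem Psi_section {n : ℤ} (hn : 1 ≤ n) {S : Set YC} (hS : S ⊆ VC n) :
    {y | y ∈ VC n ∧ phiC n y ∈ Psi n S} = S := by
  ext y
  constructor
  · rintro ⟨hy, z, hz, h⟩
    rwa [phi_orb_inj hn hy (hS hz) h]
  · intro hy
    exact ⟨hS hy, y, hy, mem_orb_self _ _⟩

theorem facet_wit {n : ℤ} (hn : 1 ≤ n) {S : Set YC} (hS : Facet (FJC n) S) {y : YC}
    (hyV : y ∈ VC n) (hy : y ∉ S) : Wit n (Psi n S) (phiC n y) := by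
  by_contra hw
  have hSV := FJC_V hS.1
  have hL := PS_Psi hn hSV
  have h0 : ((0 : ℤ), 2 * n) ∈ Psi n S := by
    refine ⟨_, (facet_ends (Dat_C hn) hS).1, ?_⟩
    convert mem_orb_self _ _ using 1
    simp only [phiC]; ext <;> simp only; ring
  have hlift : ∀ x ∈ prj (uC n) (vC n) S, ∃ p ∈ Psi n S, LiftRel n x p := by
    intro x hx
    rw [← Psi_section hn hSV] at hx
    exact lift_ex hL hx
  have hP := facet_prj (Dat_C hn) hS
  have hFx : ∀ x p, LiftRel n x p → ¬ Wit n (Psi n S) p → x ∈ WC n →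
      FW (n + 3) (WC n) (insert x (prj (uC n) (vC n) S)) := by
    intro x p hxp hw hxW
    have hsub : insert x (prj (uC n) (vC n) S) ⊆ WC n := Set.insert_subset hxW (prj_sub_WC hSV)
    refine ⟨hsub, hsub.trans ?_, ?_⟩
    · intro p hp
      simp only [WC, vld, Set.mem_ofPred_eq] at *; omega
    · rintro a (rfl | ha) b (rfl | hb) c (rfl | hc) hC
      · simp only [C3] at hC; omega
      · simp only [C3] at hC; omega
      · simp only [C3] at hC; omega
      · obtain ⟨q, hq, hq'⟩ := hlift _ hb
        obtain ⟨r, hr, hr'⟩ := hlift _ hc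
        rcases lift_C3 hC hxp hq' hr' with h | h
        · exact hw ⟨q, hq, r, hr, h⟩
        · exact hw (wit2 hL hr hq h)
      · simp only [C3] at hC; omega
      · obtain ⟨q, hq, hq'⟩ := hlift _ ha
        obtain ⟨r, hr, hr'⟩ := hlift _ hc
        rcases lift_C3 hC hq' hxp hr' with h | h
        · exact hw (wit2 hL hq hr h)
        · exact hw (wit3 hL hr hq h)
      · obtain ⟨q, hq, hq'⟩ := hlift _ ha
        obtain ⟨r, hr, hr'⟩ := hlift _ hb
        rcases lift_C3 hC hq' hr' hxp with h | h
        · exact hw (wit3 hL hq hr h)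
        · exact hw ⟨q, hq, r, hr, h⟩
      · exact hP.1.2.2 a ha b hb c hc hC
  apply hy
  apply hS.2
  rcases y with x | ⟨a, b⟩
  · simp only [VC, phiC, Set.mem_ofPred_eq] at hyV hw
    refine FJ_insert_inl hS.1 ?_ ?_ (hFx x x (Or.inl ⟨hyV.1, hyV.2.1, hyV.2.2, rfl⟩) hw (Or.inl hyV))
    · rintro c hc rfl; simp only [uC] at hyV; omega
    · rintro c hc rfl; simp only [vC] at hyV; omega
  · simp only [VC, phiC, Set.mem_ofPred_eq] at hyV hw
    have hu : uC n a ∈ prj (uC n) (vC n) S := by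
      refine hP.2 _ (hFx _ (a, n + b) (Or.inr (Or.inl ?_)) hw ?_)
      · simp only [uC, true_and, and_true]; omega
      · simp only [uC, WC, Set.mem_ofPred_eq, and_true]; omega
    have hv : vC n b ∈ prj (uC n) (vC n) S := by
      refine hP.2 _ (hFx _ (a - n, b) (Or.inr (Or.inr ?_)) (fun h => hw ?_) ?_)
      · simp only [vC, true_and, and_true]; omega
      · convert Wit_shift hL 1 h using 1; ext <;> simp only <;> ring
      · simp only [vC, WC, Set.mem_ofPred_eq, and_true]; omega
    refine FJ_insert_inr hS.1 ⟨by simp only; omega, by simp only; omega⟩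
      ⟨by simp only; omega, by simp only; omega⟩ ?_ ?_
    · rw [Set.insert_eq_of_mem (a := vC n _) hv, Set.insert_eq_of_mem (a := uC n _) hu]
      exact hS.1.2.2.1
    · refine NC_insert hS.1.2.2.2 fun q hq => ?_
      have hq' : (q.1, n + q.2) ∈ Psi n S := ⟨_, hq, mem_orb_self _ _⟩
      have hqV := hSV hq
      simp only [VC, Set.mem_ofPred_eq] at hqV
      have d1 := D_mem hL h0 1
      constructor
      · intro h
        refine hw ⟨_, hq', _, d1, ?_⟩
        simp only [Cy] at *; omega
      · intro h
        refine hw (wit2 hL hq' d1 ?_)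
        simp only [Cy] at *; omega

theorem facet_CT {n : ℤ} (hn : 1 ≤ n) {S : Set YC} (hS : Facet (FJC n) S) : CT n (Psi n S) := by
  have hSV := FJC_V hS.1
  have hL := PS_Psi hn hSV
  have h0 : ((0 : ℤ), 2 * n) ∈ Psi n S := by
    refine ⟨_, (facet_ends (Dat_C hn) hS).1, ?_⟩
    convert mem_orb_self _ _ using 1
    simp only [phiC]; ext <;> simp only; ring
  refine ⟨hL, psi_free hn hS.1, ?_⟩
  rintro ⟨a, b⟩ h1 h2 hp
  by_contra hw
  obtain ⟨y, hy, k, h | h⟩ := classify hn hL h0 h1 h2 hw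
  · by_cases hyS : y ∈ S
    · exact hp (mem_Psi.2 (Or.inl ⟨y, hyS, k, h⟩))
    · have this : Wit n (Psi n S) ((phiC n y).1 + k * n, (phiC n y).2 + k * n) :=
        Wit_shift hL k (facet_wit hn hS hy hyS)
      rw [← h] at this
      exact hw this
  · by_cases hyS : y ∈ S
    · exact hp (mem_Psi.2 (Or.inr ⟨y, hyS, k, h⟩))
    · have this : Wit n (Psi n S) ((phiC n y).1 + k * n, (phiC n y).2 + k * n) :=
        Wit_shift hL k (facet_wit hn hS hy hyS)
      rw [← h] at this
      simp only at this
      refine hw (Wit_sig hL ?_)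
      convert Wit_shift hL 4 this using 1; ext <;> simp only <;> ring

end

section

theorem facet_sub {X : Type*} {F : Set X → Prop} (mono : ∀ S S', S ⊆ S' → F S' → F S)
    {T T' : Set X} (hT : Facet F T) (hT' : Facet F T') (h : T ⊆ T') : T' = T := by
  apply Set.Subset.antisymm _ h
  intro x hx
  exact hT.2 x (mono _ _ (Set.insert_subset hx h) hT'.1)

theorem flip_facet {X : Type*} {F : Set X → Prop} (mono : ∀ S S', S ⊆ S' → F S' → F S)
    {T : Set X} (hT : Facet F T) {e f : X} (he : e ∈ T) (hfe : f ≠ e)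
    (hf : ∀ y, (y ∉ T \ {e} ∧ F (insert y (T \ {e}))) ↔ (y = e ∨ y = f)) :
    f ∉ T ∧ Facet F (insert f (T \ {e})) ∧
      ∀ T', Facet F T' → T \ {e} ⊆ T' → T' = T ∨ T' = insert f (T \ {e}) := by
  have h1 := (hf f).2 (Or.inr rfl)
  have hfT : f ∉ T := fun h => h1.1 ⟨h, hfe⟩
  have hTe : insert e (T \ {e}) = T := by
    rw [Set.insert_sdiff_singleton, Set.insert_eq_of_mem he]
  have h3 : Facet F (insert f (T \ {e})) := by
    refine ⟨h1.2, fun x hx => ?_⟩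
    by_contra hxn
    have h2 : x = e ∨ x = f := by
      refine (hf x).1 ⟨fun h => hxn (Or.inr h), mono _ _ ?_ hx⟩
      exact Set.insert_subset_insert (Set.subset_insert _ _)
    rcases h2 with rfl | rfl
    · refine hfT (hT.2 _ (mono _ _ ?_ hx))
      rw [Set.insert_comm, hTe]
    · exact hxn (Or.inl rfl)
  refine ⟨hfT, h3, fun T' hT' hs => ?_⟩
  obtain ⟨y, hy, hyn⟩ : ∃ y ∈ T', y ∉ T \ {e} := by
    by_contra hc
    push Not at hc
    have h4 : T' = T \ {e} := Set.Subset.antisymm hc hs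
    have h5 : e ∈ T' := hT'.2 e (by rw [h4, hTe]; exact hT.1)
    exact (hc e h5).2 rfl
  have h6 := (hf y).1 ⟨hyn, mono _ _ (Set.insert_subset hy hs) hT'.1⟩
  rcases h6 with rfl | rfl
  · left
    refine facet_sub mono hT hT' ?_
    rw [← hTe]; exact Set.insert_subset hy hs
  · right
    exact facet_sub mono h3 hT' (Set.insert_subset hy hs)

/-- The flip property on the cover. -/
def FlipC (n : ℤ) (L : Set (ℤ × ℤ)) (e : ℤ × ℤ) : Prop :=
  ∃ f : ℤ × ℤ, f.1 < f.2 ∧ f.2 < f.1 + 4 * n ∧ f ∉ L ∧ CT n (L \ orb n e ∪ orb n f) ∧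
    ∀ L', CT n L' → L \ orb n e ⊆ L' → L' = L ∨ L' = L \ orb n e ∪ orb n f

theorem FJC_mono {n : ℤ} (hn : 1 ≤ n) : ∀ S S' : Set YC, S ⊆ S' → FJC n S' → FJC n S :=
  fun _ _ h h' => FJ_mono (Dat_C hn) h h'

theorem case_A {n : ℤ} (hn : 1 ≤ n) {L : Set (ℤ × ℤ)} (hL : CT n L) (h0 : (0, 2 * n) ∈ L)
    {e : ℤ × ℤ} (he : e ∈ L) (h3 : 3 ≤ e.2 - e.1) (h4 : e.2 - e.1 ≤ 4 * n - 3)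
    (h5 : e ∉ orb n (0, 2 * n)) : FlipC n L e := by
  have hS := CT_facet hn hL h0
  have hP := Psi_eq hn hL.toPS hL.free h0
  set S : Set YC := {y | y ∈ VC n ∧ phiC n y ∈ L} with hSdef
  have hSV := FJC_V hS.1
  have he' := he
  rw [← hP] at he'
  obtain ⟨y0, hy0, hey⟩ := he'
  have hv0 := phiC_val hn (hSV hy0)
  have horb : orb n e = orb n (phiC n y0) := orb_eq_of_mem hv0.2.2.1 (by omega) hey
  have hcone : y0 ∉ {y | (∃ x ∈ irr (n + 3), y = Sum.inl x) ∨ y = Sum.inr (0, n) ∨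
      y = Sum.inr (n - 1, 1)} := by
    have hyV := hSV hy0
    rintro (⟨x, hx, rfl⟩ | rfl | rfl)
    · simp only [irr, VC, Set.mem_ofPred_eq] at hx hyV
      obtain ⟨k, rfl | rfl⟩ := hey
      · simp only [phiC] at h3 h4
        generalize k * n = m at *
        omega
      · simp only [phiC] at h3 h4
        generalize k * n = m at *
        omega
    · apply h5
      convert hey using 2
      simp only [phiC]; ext <;> simp only; ring
    · obtain ⟨k, rfl | rfl⟩ := hey
      · simp only [phiC] at h3 h4
        generalize k * n = m at *
        omega
      · simp only [phiC] at h3 h4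
        generalize k * n = m at *
        omega
  obtain ⟨y1, hy1, hf⟩ := FJC_flip hn S hS y0 hy0 hcone
  obtain ⟨g1, g2, g3⟩ := flip_facet (FJC_mono hn) hS hy0 hy1 hf
  have hS1V := FJC_V g2.1
  have hv1 := phiC_val hn (hS1V (Set.mem_insert _ _))
  have hdiff : Psi n (S \ {y0}) = L \ orb n e := by
    rw [horb]
    ext p
    constructor
    · rintro ⟨y, hy, hp⟩
      refine ⟨orb_subset hL.toPS (hy.1.2) hp, fun h => hy.2 ?_⟩
      refine phi_orb_inj hn (hSV hy.1) (hSV hy0) ?_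
      have hvy := phiC_val hn (hSV hy.1)
      have e1 := orb_eq_of_mem hvy.2.2.1 (by omega) hp
      have e2 := orb_eq_of_mem hv0.2.2.1 (by omega) h
      rw [← e2, e1]
      exact mem_orb_self _ _
    · rintro ⟨hp, hpn⟩
      rw [← hP] at hp
      obtain ⟨y, hy, hp⟩ := hp
      refine ⟨y, ⟨hy, ?_⟩, hp⟩
      rintro rfl
      exact hpn hp
  have hS1 : Psi n (insert y1 (S \ {y0})) = L \ orb n e ∪ orb n (phiC n y1) := by
    rw [← hdiff]
    ext p
    constructor
    · rintro ⟨y, rfl | hy, hp⟩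
      · exact Or.inr hp
      · exact Or.inl ⟨y, hy, hp⟩
    · rintro (⟨y, hy, hp⟩ | hp)
      · exact ⟨y, Or.inr hy, hp⟩
      · exact ⟨y1, Or.inl rfl, hp⟩
  refine ⟨phiC n y1, hv1.2.2.1, by omega, ?_, ?_, ?_⟩
  · intro h
    exact g1 ⟨hS1V (Set.mem_insert _ _), h⟩
  · rw [← hS1]; exact facet_CT hn g2
  · intro L' hL' hs
    have h0' : ((0:ℤ), 2 * n) ∈ L' := by
      apply hs
      refine ⟨h0, fun h => h5 ?_⟩
      have e1 : e.1 < e.2 := (hL.val e he).1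
      have e2 := (hL.val e he).2
      rw [orb_eq_of_mem e1 e2 h]
      exact mem_orb_self _ _
    have hS' := CT_facet hn hL' h0'
    have hP' := Psi_eq hn hL'.toPS hL'.free h0'
    have hsub : S \ {y0} ⊆ {y | y ∈ VC n ∧ phiC n y ∈ L'} := by
      intro y hy
      refine ⟨hy.1.1, hs ?_⟩
      rw [← hdiff]
      exact ⟨y, hy, mem_orb_self _ _⟩
    rcases g3 _ hS' hsub with h | h
    · left; rw [← hP', h, hP]
    · right; rw [← hP', h, hS1]

theorem CT_sub {n : ℤ} {L L' : Set (ℤ × ℤ)} (hL : CT n L) (hL' : CT n L') (h : L ⊆ L') :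
    L' = L := by
  apply Set.Subset.antisymm _ h
  intro p hp
  by_contra hn
  obtain ⟨x, hx, y, hy, hC⟩ := hL.max p (hL'.val p hp).1 (hL'.val p hp).2 hn
  exact hL'.free p hp x (h hx) y (h hy) hC

/-- every triangulation has a diameter -/
theorem diam_ex {n : ℤ} (hn : 1 ≤ n) {L : Set (ℤ × ℤ)} (hL : CT n L) :
    ∃ a, (a, a + 2 * n) ∈ L := by
  -- maximal length
  obtain ⟨l, ⟨hl0, hl, a, hal⟩, hmax⟩ : ∃ l : ℤ, (0 ≤ l ∧ l ≤ 2 * n ∧ ∃ a, (a, a + l) ∈ L) ∧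
      ∀ m : ℤ, (0 ≤ m ∧ m ≤ 2 * n ∧ ∃ a, (a, a + m) ∈ L) → m ≤ l := by
    refine Int.exists_greatest_of_bdd ⟨2 * n, fun z h => h.2.1⟩ ⟨1, by omega, by omega, 0, ?_⟩
    by_contra hc
    obtain ⟨x, hx, y, hy, hC⟩ := hL.max (0, 0 + 1) (by simp only; omega) (by simp only; omega) hc
    simp only [Cy] at hC
    omega
  have hmax' : ∀ x y : ℤ, (x, y) ∈ L → y - x ≤ l ∨ 2 * n < y - x := by
    intro x y h
    by_cases h2 : y - x ≤ 2 * n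
    · left
      have := hL.val _ h
      simp only at this
      exact hmax _ ⟨by omega, h2, x, by convert h using 2; ring⟩
    · right; omega
  by_cases hl2 : l = 2 * n
  · subst hl2; exact ⟨a, hal⟩
  refine ⟨a, ?_⟩
  by_contra hc
  obtain ⟨⟨x1, x2⟩, hx, ⟨y1, y2⟩, hy, hC⟩ := hL.max _ (by simp only; omega) (by simp only; omega) hc
  have sx := hL.sig _ hx
  have sy := hL.sig _ hy
  have sx' := hL.sig' hx
  have sy' := hL.sig' hy
  have m1 := hmax' _ _ hx
  have m2 := hmax' _ _ hy
  have m3 := hmax' _ _ sx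
  have m4 := hmax' _ _ sy
  have hal1 := hL.mem_shift (-1) hal rfl rfl
  have hal2 := hL.mem_shift 2 hal rfl rfl
  simp only [Cy] at hC m1 m2 m3 m4
  have hf := hL.free
  simp only [FreeL, Cy] at hf
  by_cases c1 : x2 - x1 ≤ l <;> by_cases c2 : y2 - y1 ≤ l
  · exact hf _ hx _ hy _ hal2 (by simp only; omega)
  · by_cases c3 : x1 < a + n
    · exact hf _ (hL.mem_shift (-1) hx rfl rfl) _ hal _ hx (by simp only; omega)
    · exact hf _ sy' _ hal _ (hL.mem_shift 1 sy' rfl rfl) (by simp only; omega)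
  · by_cases c3 : y1 < a + n
    · exact hf _ (hL.mem_shift (-1) hy rfl rfl) _ hal _ hy (by simp only; omega)
    · by_cases c4 : y2 > a + 3 * n
      · exact hf _ (hL.mem_shift (-1) hy rfl rfl) _ hy _ hal2 (by simp only; omega)
      · exact hf _ sx' _ (hL.mem_shift 1 sx' rfl rfl) _ hal (by simp only; omega)
  · exact hf _ sx' _ sy' _ hal (by simp only; omega)

end

section

theorem mem_orbD {n c : ℤ} {p : ℤ × ℤ} :
    p ∈ orb n (c, c + 2 * n) ↔ ∃ k : ℤ, p = (c + k * n, c + 2 * n + k * n) := by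
  constructor
  · rintro ⟨k, rfl | rfl⟩
    · exact ⟨k, rfl⟩
    · exact ⟨k + 2, by ext <;> simp only <;> ring⟩
  · rintro ⟨k, rfl⟩
    exact ⟨k, Or.inl rfl⟩

/-- Data for the flip of a diameter. -/
structure CB (n c : ℤ) (L : Set (ℤ × ℤ)) : Prop where
  ct : CT n L
  d0 : (0, 2 * n) ∈ L
  c0 : 0 < c
  cn : c < n
  hc : (c, 2 * n) ∈ L
  mn : ∀ t b, 0 < t → t < c → n + 1 ≤ b → b ≤ 2 * n → (t, b) ∉ L

variable {n c : ℤ} {L : Set (ℤ × ℤ)}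

theorem CB.f3 (h : CB n c L) {a b x y z w : ℤ} (h1 : (a, b) ∈ L) (h2 : (x, y) ∈ L)
    (h3 : (z, w) ∈ L) (g : a < x ∧ x < z ∧ z < b ∧ b < y ∧ y < w ∧ w < a + 4 * n) : False :=
  h.ct.free _ h1 _ h2 _ h3 g

theorem CB.dk (h : CB n c L) (k : ℤ) : (k * n, 2 * n + k * n) ∈ L := D_mem h.ct.toPS h.d0 k

theorem CB.d1 (h : CB n c L) : (n, 3 * n) ∈ L :=
  h.ct.mem_shift 1 h.d0 (by ring) (by ring)

theorem CB.dm (h : CB n c L) : (-n, n) ∈ L :=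
  h.ct.mem_shift (-1) h.d0 (by ring) (by ring)

theorem CB.d2 (h : CB n c L) : (2 * n, 4 * n) ∈ L :=
  h.ct.mem_shift 2 h.d0 (by ring) (by ring)

theorem red_mod {n : ℤ} (hn : 1 ≤ n) (x : ℤ) : ∃ k t : ℤ, x = t + k * n ∧ 0 ≤ t ∧ t < n :=
  ⟨x / n, x % n, by linarith [Int.emod_add_mul_ediv x n, mul_comm n (x / n)],
    Int.emod_nonneg _ (by omega), Int.emod_lt_of_pos _ (by omega)⟩

theorem CB.n1 (h : CB n c L) : 1 ≤ n := by have := h.c0; have := h.cn; omega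

theorem CB.diam_uniq (h : CB n c L) {x y : ℤ} (hx : (x, y) ∈ L) (hy : y - x = 2 * n) :
    ∃ k : ℤ, x = k * n ∧ y = 2 * n + k * n := by
  obtain ⟨k, t, rfl, h1, h2⟩ := red_mod h.n1 x
  by_cases ht : t = 0
  · exact ⟨k, by rw [ht]; ring, by rw [ht] at hy; linarith⟩
  exfalso
  have h3 : (t, t + 2 * n) ∈ L := h.ct.mem_shift (-k) hx (by ring) (by linarith)
  exact h.f3 h.d0 h3 h.d1 (by omega)

theorem CB.mem_diff (h : CB n c L) {p : ℤ × ℤ} :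
    p ∈ L \ orb n (0, 2 * n) ↔ p ∈ L ∧ p.2 - p.1 ≠ 2 * n := by
  obtain ⟨x, y⟩ := p
  have e0 : ((0 : ℤ), 2 * n) = (0, 0 + 2 * n) := by rw [zero_add]
  rw [e0]
  constructor
  · rintro ⟨h1, h2⟩
    refine ⟨h1, fun h3 => h2 ?_⟩
    obtain ⟨k, rfl, rfl⟩ := h.diam_uniq h1 h3
    exact mem_orbD.2 ⟨k, by ext <;> simp only <;> ring⟩
  · rintro ⟨h1, h2⟩
    refine ⟨h1, fun h3 => h2 ?_⟩
    obtain ⟨k, h4⟩ := mem_orbD.1 h3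
    simp only [Prod.mk.injEq] at h4
    simp only
    linarith

theorem CB.Bk (h : CB n c L) {t : ℤ} (h0 : 0 < t) (ht : t < c) : ∃ g1 g2 h1 h2 : ℤ,
    (g1, g2) ∈ L ∧ (h1, h2) ∈ L ∧ -n ≤ g1 ∧ g1 < h1 ∧ h1 < t ∧ t < g2 ∧ g2 < h2 ∧ h2 ≤ n := by
  have hn := h.n1
  have hcn := h.cn
  have hL := h.ct
  obtain ⟨⟨x1, x2⟩, hx, ⟨y1, y2⟩, hy, hC⟩ := hL.max (t, 2 * n) (by simp only; omega)
    (by simp only; omega) (h.mn _ _ h0 ht (by omega) (by omega))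
  simp only [Cy] at hC
  have key : ∀ x1 x2 : ℤ, (x1, x2) ∈ L → t < x1 → x1 < 2 * n → 2 * n < x2 → x2 < t + 4 * n →
      (n ≤ x1 ∧ x2 ≤ 3 * n) ∨ (x1 ≤ n ∧ 3 * n ≤ x2) := by
    intro x1 x2 hx g1 g2 g3 g4
    have hx' := hL.sig' hx
    by_contra hcon
    by_cases e1 : x1 < n
    · exact h.f3 h.d0 hx h.d1 (by omega)
    · by_cases e2 : x2 < 4 * n
      · exact h.f3 h.d1 hx h.d2 (by omega)
      · by_cases e3 : x2 = 4 * n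
        · exact h.f3 hx' h.hc h.d1 (by omega)
        · exact h.mn _ _ (by omega) (by omega) (by omega) (by omega) hx'
  rcases key _ _ hx (by omega) (by omega) (by omega) (by omega) with k1 | k1
  · exact (h.f3 h.hc hx hy (by omega)).elim
  · rcases key _ _ hy (by omega) (by omega) (by omega) (by omega) with k2 | k2
    · omega
    · exact ⟨_, _, _, _, hL.sig' hx, hL.sig' hy, by omega, by omega, by omega, by omega, by omega,
        by omega⟩

theorem CB.claim1 (h : CB n c L) {x y : ℤ} (hx : (x, y) ∈ L) (hl : y - x ≠ 2 * n)
    (h1 : c - n < x) (h2 : x < c) (h3 : c + n < y) (h4 : y < c + 2 * n) : False := by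
  have hL := h.ct
  have hn := h.n1
  have hcn := h.cn
  have hc0 := h.c0
  have hx' : (y - 2 * n, x + 2 * n) ∈ L :=
    hL.mem_shift 2 (hL.sig' hx) (by ring) (by ring)
  rcases lt_trichotomy x 0 with e | e | e
  · rcases lt_trichotomy y (2 * n) with g | g | g
    · exact h.f3 h.dm hx h.d0 (by omega)
    · exact h.f3 hx' h.hc h.d1 (by omega)
    · exact h.mn _ _ (by omega) (by omega) (by omega) (by omega) hx'
  · rcases lt_trichotomy y (2 * n) with g | g | g
    · exact h.f3 hx h.hc h.d1 (by omega)
    · omega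
    · exact h.mn _ _ (by omega) (by omega) (by omega) (by omega) hx'
  · by_cases g : y ≤ 2 * n
    · exact h.mn _ _ (by omega) (by omega) (by omega) (by omega) hx
    · exact h.f3 h.d0 hx h.d1 (by omega)

def L1 (n c : ℤ) (L : Set (ℤ × ℤ)) : Set (ℤ × ℤ) := L \ orb n (0, 2 * n) ∪ orb n (c, c + 2 * n)

theorem CB.PS1 (h : CB n c L) : PS n (L1 n c L) := by
  have := h.n1
  exact PS_union (PS_diff h.ct.toPS (PS_orb (by simp only; omega) (by simp only; omega)))
    (PS_orb (by simp only; omega) (by simp only; omega))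

theorem CB.Dc (h : CB n c L) : (c, c + 2 * n) ∈ L1 n c L := Or.inr (mem_orb_self _ _)

theorem CB.Dc1 (h : CB n c L) : (c + n, c + 3 * n) ∈ L1 n c L :=
  h.PS1.mem_shift 1 h.Dc (by ring) (by ring)

theorem CB.m1 (h : CB n c L) {x y : ℤ} (hx : (x, y) ∈ L) (hl : y - x ≠ 2 * n) :
    (x, y) ∈ L1 n c L := Or.inl (h.mem_diff.2 ⟨hx, hl⟩)

/-- the new diameter is not crossed by two crossing edges -/
theorem CB.noWitD (h : CB n c L) : ¬ Wit n (L1 n c L) (c, c + 2 * n) := by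
  have hL := h.ct
  have hn := h.n1
  have hcn := h.cn
  have hc0 := h.c0
  rintro ⟨⟨x1, x2⟩, hx, ⟨y1, y2⟩, hy, hC⟩
  simp only [Cy] at hC
  have key : ∀ x1 x2 : ℤ, (x1, x2) ∈ L1 n c L → c < x1 → x1 < c + 2 * n →
      (x1 = c + n ∧ x2 = c + 3 * n) ∨ ((x1, x2) ∈ L ∧ x2 - x1 ≠ 2 * n) := by
    rintro x1 x2 (hx | hx) g1 g2
    · exact Or.inr (h.mem_diff.1 hx)
    · left
      obtain ⟨k, hk⟩ := mem_orbD.1 hx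
      simp only [Prod.mk.injEq] at hk
      have k0 : 0 < k := by by_contra hk0; nlinarith
      have k2 : k < 2 := by by_contra hk0; nlinarith
      have k1 : k = 1 := by omega
      subst k1
      omega
  have cl : ∀ x1 x2 : ℤ, (x1, x2) ∈ L → x2 - x1 ≠ 2 * n → c < x1 → x1 < c + 2 * n →
      c + 2 * n < x2 → x2 < c + 4 * n → (c + n ≤ x1 ∧ x2 ≤ c + 3 * n) ∨
      (x1 ≤ c + n ∧ c + 3 * n ≤ x2) := by
    intro x1 x2 hx hl g1 g2 g3 g4
    by_contra hcon
    by_cases e : x1 < c + n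
    · exact h.claim1 (hL.mem_shift (-1) hx rfl rfl) (by omega) (by omega) (by omega) (by omega)
        (by omega)
    · exact h.claim1 (hL.mem_shift (-2) hx rfl rfl) (by omega) (by omega) (by omega) (by omega)
        (by omega)
  rcases key _ _ hx (by omega) (by omega) with ⟨e1, e2⟩ | ⟨hx, lx⟩ <;>
    rcases key _ _ hy (by omega) (by omega) with ⟨e3, e4⟩ | ⟨hy, ly⟩
  · omega
  · have := cl _ _ hy ly (by omega) (by omega) (by omega) (by omega)
    omega
  · have := cl _ _ hx lx (by omega) (by omega) (by omega) (by omega)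
    omega
  · have c1 := cl _ _ hx lx (by omega) (by omega) (by omega) (by omega)
    have c2 := cl _ _ hy ly (by omega) (by omega) (by omega) (by omega)
    rcases c1 with c1 | c1
    · exact h.f3 hx hy (hL.mem_shift 2 h.hc rfl rfl) (by omega)
    · exact h.f3 (hL.sig' hx) (hL.sig' hy) h.hc (by omega)

theorem CB.free1 (h : CB n c L) : FreeL n (L1 n c L) := by
  have hn := h.n1
  have nw : ∀ p ∈ orb n (c, c + 2 * n), ¬ Wit n (L1 n c L) p := by
    intro p hp hw
    obtain ⟨k, rfl⟩ := mem_orbD.1 hp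
    apply h.noWitD
    convert Wit_shift h.PS1 (-k) hw using 1
    ext <;> simp only <;> ring
  intro x hx y hy z hz hC
  by_cases h1 : x ∈ orb n (c, c + 2 * n)
  · exact nw x h1 ⟨y, hy, z, hz, hC⟩
  by_cases h2 : y ∈ orb n (c, c + 2 * n)
  · exact nw y h2 (wit2 h.PS1 hx hz hC)
  by_cases h3 : z ∈ orb n (c, c + 2 * n)
  · exact nw z h3 (wit3 h.PS1 hx hy hC)
  exact h.ct.free x (hx.resolve_right h1).1 y (hy.resolve_right h2).1 z (hz.resolve_right h3).1 hC

theorem CB.sub1 (h : CB n c L) {x y : ℤ} (h1 : c ≤ x) (h2 : x < n) (h3 : 2 * n < y)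
    (h4 : y ≤ c + 2 * n) (hp : (x, y) ∉ L1 n c L) : Wit n (L1 n c L) (x, y) := by
  have hL := h.ct
  have hn := h.n1
  have hcn := h.cn
  have hc0 := h.c0
  by_cases e : x = c
  · subst e
    by_cases e : y = x + 2 * n
    · subst e; exact (hp h.Dc).elim
    · obtain ⟨g1, g2, k1, k2, hg, hk, hh⟩ := h.Bk (t := y - 2 * n) (by omega) (by omega)
      have sg := h.PS1.sig _ (h.m1 hg (by omega))
      have sk := h.PS1.sig _ (h.m1 hk (by omega))
      apply Wit_sig h.PS1
      have : Wit n (L1 n x L) (y - 2 * n, x + 2 * n) :=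
        ⟨_, sg, _, sk, by simp only [Cy]; omega⟩
      convert Wit_shift h.PS1 2 this using 1
      ext <;> simp only <;> ring
  · refine wit2 h.PS1 (h.m1 h.hc (by omega)) h.Dc1 ?_
    simp only [Cy]; omega

theorem CB.sub2 (h : CB n c L) {x y : ℤ} (h1 : 0 < x) (h2 : x < n) (h3 : 2 * n < y)
    (h4 : y < 3 * n) (hp : (x, y) ∉ L1 n c L) : Wit n (L1 n c L) (x, y) := by
  have hL := h.ct
  have hn := h.n1
  have hcn := h.cn
  have hc0 := h.c0
  by_cases e1 : x < c ∧ y < c + 2 * n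
  · exact ⟨_, h.Dc, _, h.Dc1, by simp only [Cy]; omega⟩
  by_cases e2 : c < x ∧ c + 2 * n < y
  · exact wit2 h.PS1 h.Dc h.Dc1 (by simp only [Cy]; omega)
  by_cases e3 : c ≤ x ∧ y ≤ c + 2 * n
  · exact h.sub1 e3.1 h2 h3 e3.2 hp
  · apply Wit_sig h.PS1
    have : Wit n (L1 n c L) (y - 2 * n, x + 2 * n) := by
      refine h.sub1 (by omega) (by omega) (by omega) (by omega) (fun hq => hp ?_)
      exact h.PS1.mem_shift 2 (h.PS1.sig' hq) (by ring) (by ring)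
    convert Wit_shift h.PS1 2 this using 1
    ext <;> simp only <;> ring

theorem CB.sub3 (h : CB n c L) {p1 p2 h1 h2 : ℤ} (hh : (h1, h2) ∈ L) (a1 : -2 * n < p1)
    (a2 : p1 < 0) (a3 : 0 < p2) (a4 : p2 < 2 * n) (b1 : -2 * n < h1) (b2 : h1 < 0) (b3 : 0 < h2)
    (b4 : h2 < 2 * n) (hX : (p1 < h1 ∧ p2 < h2) ∨ (h1 < p1 ∧ h2 < p2))
    (hp : (p1, p2) ∉ L1 n c L) : Wit n (L1 n c L) (p1, p2) := by
  have hL := h.ct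
  have hn := h.n1
  have hcn := h.cn
  have hc0 := h.c0
  have hM := h.m1 hh
  by_cases e1 : p1 < -n ∧ p2 < n
  · have := h.sub2 (x := p1 + 2 * n) (y := p2 + 2 * n) (by omega) (by omega) (by omega) (by omega)
      (fun hq => hp (h.PS1.mem_shift (-2) hq (by ring) (by ring)))
    convert Wit_shift h.PS1 (-2) this using 1
    ext <;> simp only <;> ring
  by_cases e2 : -n < p1 ∧ n < p2
  · have := h.sub2 (x := p1 + n) (y := p2 + n) (by omega) (by omega) (by omega) (by omega)
      (fun hq => hp (h.PS1.mem_shift (-1) hq (by ring) (by ring)))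
    convert Wit_shift h.PS1 (-1) this using 1
    ext <;> simp only <;> ring
  have f1 : ¬ (h1 < -n ∧ h2 < n) := fun e =>
    h.f3 (hL.mem_shift (-2) h.d0 rfl rfl) hh h.dm (by omega)
  have f2 : ¬ (-n < h1 ∧ n < h2) := fun e => h.f3 h.dm hh h.d0 (by omega)
  have hM' := hM (by omega)
  have hcM := h.m1 h.hc (by omega)
  by_cases e3 : -n ≤ p1 ∧ p2 ≤ n
  · have hcM2 := h.PS1.mem_shift (-2) hcM rfl rfl
    rcases hX with hX | hX
    · exact wit2 h.PS1 hcM2 hM' (by simp only [Cy]; omega)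
    · exact wit3 h.PS1 hcM2 hM' (by simp only [Cy]; omega)
  · apply Wit_sig h.PS1
    have sM := h.PS1.sig _ hM'
    rcases hX with hX | hX
    · exact wit2 h.PS1 hcM sM (by simp only [Cy]; omega)
    · exact wit3 h.PS1 hcM sM (by simp only [Cy]; omega)

theorem CB.max1 (h : CB n c L) : MaxL n (L1 n c L) := by
  have hL := h.ct
  have hn := h.n1
  have hcn := h.cn
  have hc0 := h.c0
  rintro ⟨a, b⟩ v1 v2 hp
  simp only at v1 v2
  by_cases hpL : (a, b) ∈ L
  · have hl : b - a = 2 * n := by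
      by_contra hl
      exact hp (h.m1 hpL hl)
    obtain ⟨k, rfl, rfl⟩ := h.diam_uniq hpL hl
    have : Wit n (L1 n c L) (0, 2 * n) := ⟨_, h.Dc, _, h.Dc1, by simp only [Cy]; omega⟩
    convert Wit_shift h.PS1 k this using 1
    ext <;> simp only; ring
  · obtain ⟨⟨x1, x2⟩, hx, ⟨y1, y2⟩, hy, hC⟩ := hL.max (a, b) v1 v2 hpL
    simp only [Cy] at hC
    by_cases lx : x2 - x1 = 2 * n
    · obtain ⟨k, rfl, rfl⟩ := h.diam_uniq hx lx
      have hy' := hL.mem_shift (-k) (hL.sig' hy) rfl rfl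
      have := h.sub3 (p1 := a + (-k) * n) (p2 := b + (-k) * n) hy' (by linarith) (by linarith)
        (by linarith) (by linarith) (by linarith) (by linarith) (by linarith) (by linarith)
        (Or.inr ⟨by linarith, by linarith⟩)
        (fun hq => hp (h.PS1.mem_shift k hq (by ring) (by ring)))
      convert Wit_shift h.PS1 k this using 1
      ext <;> simp only <;> ring
    by_cases ly : y2 - y1 = 2 * n
    · obtain ⟨k, rfl, rfl⟩ := h.diam_uniq hy ly
      have hx' := hL.mem_shift (-k) hx rfl rfl
      have := h.sub3 (p1 := a + (-k) * n) (p2 := b + (-k) * n) hx' (by linarith) (by linarith)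
        (by linarith) (by linarith) (by linarith) (by linarith) (by linarith) (by linarith)
        (Or.inl ⟨by linarith, by linarith⟩)
        (fun hq => hp (h.PS1.mem_shift k hq (by ring) (by ring)))
      convert Wit_shift h.PS1 k this using 1
      ext <;> simp only <;> ring
    exact ⟨_, h.m1 hx lx, _, h.m1 hy ly, hC⟩

theorem CB.flip (h : CB n c L) : FlipC n L (0, 2 * n) := by
  have hL := h.ct
  have hn := h.n1
  have hcn := h.cn
  have hc0 := h.c0
  have h1 : CT n (L1 n c L) := ⟨h.PS1, h.free1, h.max1⟩
  refine ⟨(c, c + 2 * n), by simp only; omega, by simp only; omega, ?_, h1, ?_⟩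
  · intro hm
    exact h.f3 h.d0 hm h.d1 (by omega)
  · intro L' hL' hs
    have hM : ∀ x y : ℤ, (x, y) ∈ L → y - x ≠ 2 * n → (x, y) ∈ L' := fun x y h1 h2 =>
      hs (h.mem_diff.2 ⟨h1, h2⟩)
    obtain ⟨a, ha⟩ := diam_ex hn hL'
    obtain ⟨k, t, rfl, t0, tn⟩ := red_mod hn a
    have ht : (t, t + 2 * n) ∈ L' := hL'.mem_shift (-k) ha (by ring) (by ring)
    rcases eq_or_lt_of_le t0 with e | e
    · left
      refine CT_sub hL hL' ?_
      intro p hp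
      by_cases hpo : p ∈ orb n (0, 2 * n)
      · refine orb_subset hL'.toPS ?_ hpo
        rw [← e, zero_add] at ht
        exact ht
      · exact hs ⟨hp, hpo⟩
    · right
      rcases lt_trichotomy t c with g | g | g
      · exfalso
        obtain ⟨g1, g2, k1, k2, hg, hk, hh⟩ := h.Bk e g
        have sg := hL'.sig _ (hM _ _ hg (by omega))
        have sk := hL'.sig _ (hM _ _ hk (by omega))
        exact hL'.free _ ht _ sg _ sk (by simp only [Cy]; omega)
      · refine CT_sub h1 hL' ?_
        rintro p (hp | hp)
        · exact hs hp
        · rw [g] at ht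
          exact orb_subset hL'.toPS ht hp
      · exfalso
        exact hL'.free _ (hL'.mem_shift (-1) ht rfl rfl) _ (hM _ _ h.hc (by omega)) _ ht
          (by simp only [Cy]; omega)

end

section

theorem flip_transport {n : ℤ} {φ : ℤ × ℤ → ℤ × ℤ} (hs : Function.Surjective φ)
    (hct : ∀ L, CT n L ↔ CT n (φ ⁻¹' L)) (ho : ∀ e p, φ p ∈ orb n (φ e) ↔ p ∈ orb n e)
    (hv : ∀ f, f.1 < f.2 → f.2 < f.1 + 4 * n → (φ f).1 < (φ f).2 ∧ (φ f).2 < (φ f).1 + 4 * n)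
    {L : Set (ℤ × ℤ)} {e : ℤ × ℤ} (h : FlipC n (φ ⁻¹' L) e) : FlipC n L (φ e) := by
  obtain ⟨f, f1, f2, f3, f4, f5⟩ := h
  have key : φ ⁻¹' (L \ orb n (φ e) ∪ orb n (φ f)) = φ ⁻¹' L \ orb n e ∪ orb n f := by
    ext p
    simp only [Set.mem_preimage, Set.mem_union, Set.mem_sdiff, ho]
  refine ⟨φ f, (hv f f1 f2).1, (hv f f1 f2).2, f3, ?_, ?_⟩
  · rw [hct, key]; exact f4
  · intro L' hL' hsub
    have hsub' : φ ⁻¹' L \ orb n e ⊆ φ ⁻¹' L' := fun p hp =>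
      hsub ⟨hp.1, fun h => hp.2 ((ho _ _).1 h)⟩
    rcases f5 (φ ⁻¹' L') ((hct _).1 hL') hsub' with h | h
    · left
      exact hs.preimage_injective h
    · right
      rw [← key] at h
      exact hs.preimage_injective h

def trn (c : ℤ) (p : ℤ × ℤ) : ℤ × ℤ := (p.1 + c, p.2 + c)

theorem trn_CT {n c : ℤ} {L : Set (ℤ × ℤ)} (h : CT n L) : CT n (trn c ⁻¹' L) where
  val := by
    intro p hp
    have := h.val _ hp
    simp only [trn] at this
    omega
  per := by
    intro p
    have := h.per (trn c p)
    simp only [Set.mem_preimage, trn] at *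
    rw [this, add_right_comm p.1, add_right_comm p.2]
  sig := by
    intro p hp
    have := h.sig _ hp
    simp only [Set.mem_preimage, trn] at *
    rwa [add_right_comm p.1]
  free := by
    intro x hx y hy z hz hC
    refine h.free _ hx _ hy _ hz ?_
    simp only [Cy, trn] at *
    omega
  max := by
    intro p h1 h2 hp
    obtain ⟨x, hx, y, hy, hC⟩ := h.max (trn c p) (by simp only [trn]; omega)
      (by simp only [trn]; omega) hp
    refine ⟨(x.1 - c, x.2 - c), by simpa [trn] using hx, (y.1 - c, y.2 - c),
      by simpa [trn] using hy, ?_⟩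
    simp only [Cy, trn] at *
    omega

theorem trn_trn (c : ℤ) (L : Set (ℤ × ℤ)) : trn (-c) ⁻¹' (trn c ⁻¹' L) = L := by
  ext p; simp [trn]

theorem trn_flip {n c : ℤ} {L : Set (ℤ × ℤ)} {e : ℤ × ℤ} (h : FlipC n (trn c ⁻¹' L) e) :
    FlipC n L (trn c e) := by
  refine flip_transport ?_ ?_ ?_ ?_ h
  · intro p; exact ⟨trn (-c) p, by simp [trn]⟩
  · intro L
    refine ⟨fun h => trn_CT h, fun h => ?_⟩
    have := trn_CT (c := -c) h
    rwa [trn_trn] at this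
  · intro e p
    constructor
    · rintro ⟨k, h | h⟩ <;> simp only [trn, Prod.mk.injEq] at h <;> refine ⟨k, ?_⟩
      · left; ext <;> simp only <;> linarith
      · right; ext <;> simp only <;> linarith
    · rintro ⟨k, h | h⟩ <;> simp only [trn, Prod.ext_iff] at h ⊢ <;> refine ⟨k, ?_⟩
      · left; ext <;> simp only <;> linarith
      · right; ext <;> simp only <;> linarith
  · intro f h1 h2
    simp only [trn]; omega

def rfx (n : ℤ) (p : ℤ × ℤ) : ℤ × ℤ := (2 * n - p.2, 2 * n - p.1)

theorem rfx_rfx (n : ℤ) (p : ℤ × ℤ) : rfx n (rfx n p) = p := by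
  simp [rfx]

theorem rfx_CT {n : ℤ} {L : Set (ℤ × ℤ)} (h : CT n L) : CT n (rfx n ⁻¹' L) := by
  have hps : PS n (rfx n ⁻¹' L) :=
    { val := by
        intro p hp
        have := h.val _ hp
        simp only [rfx] at this
        omega
      per := by
        rintro ⟨a, b⟩
        have := h.per (rfx n (a + n, b + n))
        simp only [Set.mem_preimage, rfx] at *
        rw [this]
        ring_nf
      sig := by
        rintro ⟨a, b⟩ hp
        have := h.sig' hp
        simp only [Set.mem_preimage, rfx] at *
        convert this using 2; ring }
  refine ⟨hps, ?_, ?_⟩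
  · intro x hx y hy z hz hC
    refine h.free _ hz _ hy _ hx ?_
    simp only [Cy, rfx] at *
    omega
  · intro p h1 h2 hp
    obtain ⟨x, hx, y, hy, hC⟩ := h.max (rfx n p) (by simp only [rfx]; omega)
      (by simp only [rfx]; omega) hp
    refine wit3 hps (x := rfx n y) (y := rfx n x) (by simpa [rfx_rfx] using hy)
      (by simpa [rfx_rfx] using hx) ?_
    simp only [Cy, rfx] at *
    omega

theorem rfx_flip {n : ℤ} {L : Set (ℤ × ℤ)} {e : ℤ × ℤ} (h : FlipC n (rfx n ⁻¹' L) e) :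
    FlipC n L (rfx n e) := by
  refine flip_transport ?_ ?_ ?_ ?_ h
  · intro p; exact ⟨rfx n p, rfx_rfx _ _⟩
  · intro L
    refine ⟨fun h => rfx_CT h, fun h => ?_⟩
    have := rfx_CT h
    have e : rfx n ⁻¹' (rfx n ⁻¹' L) = L := by
      ext p; simp [rfx_rfx]
    rwa [e] at this
  · intro e p
    constructor
    · rintro ⟨k, h | h⟩ <;> simp only [rfx, Prod.mk.injEq] at h
      · refine ⟨-k, ?_⟩
        left; ext <;> simp only <;> linarith
      · refine ⟨-k-4, ?_⟩
        right; ext <;> simp only <;> linarith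
    · rintro ⟨k, h | h⟩ <;> simp only [rfx, Prod.ext_iff] at h ⊢
      · refine ⟨-k, ?_⟩
        left; ext <;> simp only <;> linarith
      · refine ⟨-k-4, ?_⟩
        right; ext <;> simp only <;> linarith
  · intro f h1 h2
    simp only [rfx]; omega

theorem case_B {n : ℤ} (hn : 2 ≤ n) {L : Set (ℤ × ℤ)} (hL : CT n L) (h0 : (0, 2 * n) ∈ L) :
    FlipC n L (0, 2 * n) := by
  have hn1 : 1 ≤ n := by omega
  have hS := CT_facet hn1 hL h0
  have hE := facet_ends (Dat_C hn1) hS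
  have hM := facet_maxJ (Dat_C hn1) hS
  have hN := hS.1.2.2.2
  have hJm : ∀ a b : ℤ, (a, b) ∈ (Sum.inr ⁻¹' {y | y ∈ VC n ∧ phiC n y ∈ L} : Set (ℤ × ℤ)) ↔
      (0 ≤ a ∧ a < n ∧ 1 ≤ b ∧ b ≤ n) ∧ (a, n + b) ∈ L := fun a b => Iff.rfl
  have hE1 := (hJm _ _).1 hE.1
  have hE2 := (hJm _ _).1 hE.2
  set J : Set (ℤ × ℤ) := Sum.inr ⁻¹' {y | y ∈ VC n ∧ phiC n y ∈ L} with hJ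
  obtain ⟨c, ⟨c0, b0, hcb⟩, hcm⟩ := Int.exists_least_of_bdd
    (P := fun a => 0 < a ∧ ∃ b, (a, b) ∈ J) ⟨0, fun z h => h.1.le⟩ ⟨n - 1, by omega, _, hE.2⟩
  obtain ⟨d, ⟨d0, a0, hda⟩, hdm⟩ := Int.exists_greatest_of_bdd
    (P := fun b => b < n ∧ ∃ a, (a, b) ∈ J) ⟨n, fun z h => h.1.le⟩ ⟨1, by omega, _, hE.2⟩
  have hcb' := (hJm _ _).1 hcb
  have hda' := (hJm _ _).1 hda
  have key : (c, n) ∈ J ∨ (0, d) ∈ J := by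
    by_cases hA : ∃ q ∈ J, q.1 = 0 ∧ q.2 < n
    · right
      obtain ⟨⟨q1, q2⟩, hq, hq1, hq2⟩ := hA
      simp only at hq1 hq2
      subst hq1
      refine hM _ hE.1 _ hda (NC_insert hN ?_)
      rintro ⟨r1, r2⟩ hr
      have hr' := (hJm _ _).1 hr
      constructor
      · rintro ⟨k1, k2⟩
        simp only at k1 k2
        have : ¬ r2 < n := fun h => by have := hdm r2 ⟨h, r1, hr⟩; omega
        exact hN _ hq _ hr ⟨k1, by simp only; omega⟩
      · rintro ⟨k1, k2⟩
        simp only at k1 k2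
        omega
    · left
      push Not at hA
      refine hM _ hcb _ hE.1 (NC_insert hN ?_)
      rintro ⟨r1, r2⟩ hr
      have hr' := (hJm _ _).1 hr
      constructor
      · rintro ⟨k1, k2⟩
        simp only at k1 k2
        omega
      · rintro ⟨k1, k2⟩
        simp only at k1 k2
        have : ¬ 0 < r1 := fun h => by have := hcm r1 ⟨h, r2, hr⟩; omega
        have := hA _ hr (by simp only; omega)
        simp only at this
        omega
  rcases key with hk | hk
  · have hk' := ((hJm _ _).1 hk).2
    refine CB.flip (c := c) ⟨hL, h0, c0, by omega, by convert hk' using 2; ring, ?_⟩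
    intro t b t0 tc b1 b2 ht
    have : (t, b - n) ∈ J := by
      rw [hJm]
      refine ⟨by omega, ?_⟩
      convert ht using 2; ring
    have := hcm t ⟨t0, _, this⟩
    omega
  · have hk' := ((hJm _ _).1 hk).2
    have e0 : rfx n (0, 2 * n) = (0, 2 * n) := by simp [rfx]
    rw [← e0]
    apply rfx_flip
    refine CB.flip (c := n - d) ⟨rfx_CT hL, ?_, by omega, by omega, ?_, ?_⟩
    · rw [Set.mem_preimage, e0]; exact h0
    · rw [Set.mem_preimage]
      convert hk' using 1
      simp only [rfx]; ext <;> simp only <;> ring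
    · intro t b t0 tc b1 b2 ht
      simp only [rfx, Set.mem_preimage] at ht
      have : (2 * n - b, n - t) ∈ J := by
        rw [hJm]
        refine ⟨by omega, ?_⟩
        convert ht using 2; ring
      have := hdm (n - t) ⟨by omega, _, this⟩
      omega

/-- The flip theorem on the cover. -/
theorem cover_flip {n : ℤ} (hn : 1 ≤ n) {L : Set (ℤ × ℤ)} (hL : CT n L) {e : ℤ × ℤ} (he : e ∈ L)
    (h3 : 3 ≤ e.2 - e.1) (h4 : e.2 - e.1 ≤ 4 * n - 3) : FlipC n L e := by
  obtain ⟨a, ha⟩ := diam_ex hn hL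
  have e1 : trn a (trn (-a) e) = e := by simp [trn]
  rw [← e1]
  apply trn_flip
  have hL' := trn_CT (c := a) hL
  have h0 : ((0 : ℤ), 2 * n) ∈ trn a ⁻¹' L := by
    rw [Set.mem_preimage]
    convert ha using 1
    simp only [trn]; ext <;> simp only <;> ring
  have he' : trn (-a) e ∈ trn a ⁻¹' L := by rw [Set.mem_preimage, e1]; exact he
  by_cases h5 : trn (-a) e ∈ orb n (0, 2 * n)
  · have e2 := orb_eq_of_mem (by simp only; omega) (by simp only; omega) h5
    have hlen : e.2 - e.1 = 2 * n := by
      obtain ⟨k, h | h⟩ := h5 <;> simp only [trn, Prod.mk.injEq] at h <;> linarith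
    have := case_B (by omega) hL' h0
    unfold FlipC
    rw [e2]
    exact this
  · exact case_A hn hL' h0 he' (by simp only [trn]; omega) (by simp only [trn]; omega) h5

end

/-- the projection from the cover to the polygon -/
def qq (n : ℕ) (p : ℤ × ℤ) : Sym2 (ZMod (4 * n)) := s((p.1 : ZMod (4 * n)), (p.2 : ZMod (4 * n)))

def lft (n : ℕ) (T : Set (Sym2 (ZMod (4 * n)))) : Set (ℤ × ℤ) :=
  {p | p.1 < p.2 ∧ p.2 < p.1 + 4 * n ∧ qq n p ∈ T}

theorem cast_eq {n : ℕ} {a b : ℤ} :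
    (a : ZMod (4 * n)) = (b : ZMod (4 * n)) ↔ ∃ k : ℤ, b = a + 4 * k * n := by
  rw [ZMod.intCast_eq_intCast_iff_dvd_sub]
  constructor
  · rintro ⟨k, hk⟩
    push_cast at hk
    exact ⟨k, by linarith⟩
  · rintro ⟨k, hk⟩
    exact ⟨k, by push_cast; linarith⟩

theorem mul_range {n : ℕ} {k lo hi : ℤ} (h1 : lo * n < k * n) (h2 : k * n < hi * n) :
    lo < k ∧ k < hi := by
  have hn : (0 : ℤ) ≤ n := by positivity
  exact ⟨lt_of_mul_lt_mul_right h1 hn, lt_of_mul_lt_mul_right h2 hn⟩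

theorem qq_eq {n : ℕ} {a b c d : ℤ} (h1 : a < b) (h2 : b < a + 4 * n) (h3 : c < d)
    (h4 : d < c + 4 * n) : qq n (a, b) = qq n (c, d) ↔
    ∃ k : ℤ, (c = a + 4 * k * n ∧ d = b + 4 * k * n) ∨
      (c = b + 4 * k * n ∧ d = a + 4 * n + 4 * k * n) := by
  simp only [qq, Sym2.eq_iff, cast_eq]
  constructor
  · rintro (⟨⟨k, hk⟩, ⟨l, hl⟩⟩ | ⟨⟨k, hk⟩, ⟨l, hl⟩⟩)
    · refine ⟨k, Or.inl ⟨hk, ?_⟩⟩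
      have := mul_range (n := n) (k := l - k) (lo := -1) (hi := 1) (by linarith) (by linarith)
      have : l = k := by omega
      rw [hl, this]
    · refine ⟨l, Or.inr ⟨hl, ?_⟩⟩
      have := mul_range (n := n) (k := k - l) (lo := 0) (hi := 2) (by linarith) (by linarith)
      have : k = l + 1 := by omega
      rw [hk, this]; ring
  · rintro ⟨k, ⟨rfl, rfl⟩ | ⟨rfl, rfl⟩⟩
    · exact Or.inl ⟨⟨k, rfl⟩, ⟨k, rfl⟩⟩
    · exact Or.inr ⟨⟨k + 1, by ring⟩, ⟨k, rfl⟩⟩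

theorem qq_shift (n : ℕ) (a b k : ℤ) : qq n (a + 4 * k * n, b + 4 * k * n) = qq n (a, b) := by
  simp only [qq, Sym2.eq_iff, cast_eq]
  exact Or.inl ⟨⟨-k, by ring⟩, ⟨-k, by ring⟩⟩

theorem qq_sig (n : ℕ) (a b : ℤ) : qq n (b, a + 4 * n) = qq n (a, b) := by
  exact Sym2.eq_iff.2 (Or.inr ⟨rfl, cast_eq.2 ⟨-1, by ring⟩⟩)

theorem qq_nd {n : ℕ} {a b : ℤ} (h1 : a < b) (h2 : b < a + 4 * n) : ¬ (qq n (a, b)).IsDiag := by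
  simp only [qq, Sym2.mk_isDiag_iff, cast_eq]
  rintro ⟨k, hk⟩
  have := mul_range (n := n) (k := k) (lo := 0) (hi := 1) (by linarith) (by linarith)
  omega

theorem std_ex {n : ℕ} (hn : 1 ≤ n) (e : Sym2 (ZMod (4 * n))) (he : ¬ e.IsDiag) :
    ∃ a b : ℤ, 0 ≤ a ∧ a < b ∧ b < 4 * n ∧ e = qq n (a, b) := by
  haveI : NeZero (4 * n) := ⟨by omega⟩
  induction e using Sym2.ind with
  | _ x y =>
    rw [Sym2.mk_isDiag_iff] at he
    have hx := ZMod.val_lt x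
    have hy := ZMod.val_lt y
    have hxy : x.val ≠ y.val := fun h => he (ZMod.val_injective _ h)
    rcases lt_or_gt_of_ne hxy with h | h
    · refine ⟨x.val, y.val, by omega, by omega, by omega, ?_⟩
      simp [qq]
    · refine ⟨y.val, x.val, by omega, by omega, by omega, ?_⟩
      simp [qq, Sym2.eq_swap]

theorem val_std {n : ℕ} {a : ℤ} (h0 : 0 ≤ a) (h1 : a < 4 * n) :
    ((a : ZMod (4 * n)).val : ℤ) = a := by
  haveI : NeZero (4 * n) := ⟨by omega⟩
  rw [ZMod.val_intCast]
  exact Int.emod_eq_of_lt h0 (by push_cast; exact h1)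

theorem cross_std {n : ℕ} {a b c d : ℤ} (h1 : 0 ≤ a) (h2 : a < b) (h3 : b < 4 * n)
    (h4 : 0 ≤ c) (h5 : c < d) (h6 : d < 4 * n) :
    PolyCrosses (qq n (a, b)) (qq n (c, d)) ↔ (a < c ∧ c < b ∧ b < d) ∨ (c < a ∧ a < d ∧ d < b) := by
  have va := val_std (n := n) h1 (by omega)
  have vb := val_std (n := n) (a := b) (by omega) (by omega)
  have vc := val_std (n := n) h4 (by omega)
  have vd := val_std (n := n) (a := d) (by omega) (by omega)
  constructor
  · rintro ⟨x, y, z, w, e1, e2, hc⟩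
    simp only [qq, Sym2.eq_iff] at e1 e2
    simp only [crossIndex] at hc
    rcases e1 with ⟨rfl, rfl⟩ | ⟨rfl, rfl⟩ <;> rcases e2 with ⟨rfl, rfl⟩ | ⟨rfl, rfl⟩ <;> omega
  · intro h
    refine ⟨_, _, _, _, rfl, rfl, ?_⟩
    simp only [crossIndex]
    omega

theorem cross_irr {n : ℕ} (hn : 1 ≤ n) {e : Sym2 (ZMod (4 * n))} (he : ¬ e.IsDiag) :
    ¬ PolyCrosses e e := by
  obtain ⟨a, b, h1, h2, h3, rfl⟩ := std_ex hn e he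
  rw [cross_std h1 h2 h3 h1 h2 h3]
  omega

theorem cross_symm {m : ℕ} {e f : Sym2 (ZMod m)} (h : PolyCrosses e f) : PolyCrosses f e := by
  obtain ⟨x, y, z, w, h1, h2, h3⟩ := h
  exact ⟨z, w, x, y, h2, h1, h3.symm⟩

theorem std_of {n : ℕ} {a b : ℤ} (h1 : a < b) (h2 : b < a + 4 * n) (h3 : 0 ≤ a) (h4 : a < 8 * n) :
    ∃ c d : ℤ, qq n (a, b) = qq n (c, d) ∧ 0 ≤ c ∧ c < d ∧ d < 4 * n ∧
      ((b < 4 * n ∧ c = a ∧ d = b) ∨ (a < 4 * n ∧ 4 * n ≤ b ∧ c = b - 4 * n ∧ d = a) ∨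
       (4 * n ≤ a ∧ b < 8 * n ∧ c = a - 4 * n ∧ d = b - 4 * n) ∨
       (8 * n ≤ b ∧ c = b - 8 * n ∧ d = a - 4 * n)) := by
  by_cases e1 : b < 4 * n
  · exact ⟨a, b, rfl, by omega, by omega, by omega, by omega⟩
  by_cases e2 : a < 4 * n
  · refine ⟨b - 4 * n, a, ?_, by omega, by omega, by omega, by omega⟩
    rw [qq_eq h1 h2 (by omega) (by omega)]
    exact ⟨-1, Or.inr ⟨by ring, by ring⟩⟩
  by_cases e3 : b < 8 * n
  · refine ⟨a - 4 * n, b - 4 * n, ?_, by omega, by omega, by omega, by omega⟩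
    rw [qq_eq h1 h2 (by omega) (by omega)]
    exact ⟨-1, Or.inl ⟨by ring, by ring⟩⟩
  · refine ⟨b - 8 * n, a - 4 * n, ?_, by omega, by omega, by omega, by omega⟩
    rw [qq_eq h1 h2 (by omega) (by omega)]
    exact ⟨-2, Or.inr ⟨by ring, by ring⟩⟩

theorem cross_of {n : ℕ} (hn : 1 ≤ n) {a b c d : ℤ} (h1 : a < c) (h2 : c < b) (h3 : b < d)
    (h4 : d < a + 4 * n) : PolyCrosses (qq n (a, b)) (qq n (c, d)) := by
  obtain ⟨k, t, ht, ht0, ht1⟩ := red_mod (n := 4 * n) (by omega) a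
  rw [← qq_shift n a b (-k), ← qq_shift n c d (-k)]
  have e1 : k * (4 * (n : ℤ)) = -(4 * (-k) * n) := by ring
  rw [e1] at ht
  generalize 4 * (-k) * (n : ℤ) = m at *
  obtain ⟨x, y, e, g1, g2, g3, g4⟩ := std_of (n := n) (a := a + m) (b := b + m) (by omega) (by omega)
    (by omega) (by omega)
  obtain ⟨z, w, e', k1, k2, k3, k4⟩ := std_of (n := n) (a := c + m) (b := d + m) (by omega)
    (by omega) (by omega) (by omega)
  rw [e, e', cross_std g1 g2 g3 k1 k2 k3]
  omega

theorem free_iff {n : ℕ} (hn : 1 ≤ n) {T : Set (Sym2 (ZMod (4 * n)))} (hT : PolyValid T) :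
    PolyCrossingFree 3 T ↔ FreeL n (lft n T) := by
  classical
  constructor
  · rintro h ⟨x1, x2⟩ ⟨v1, v2, hx⟩ ⟨y1, y2⟩ ⟨v3, v4, hy⟩ ⟨z1, z2⟩ ⟨v5, v6, hz⟩ hC
    simp only [Cy] at hC v1 v2 v3 v4 v5 v6
    apply h
    have c1 := cross_of hn (a := x1) (b := x2) (c := y1) (d := y2) (by omega) (by omega) (by omega)
      (by omega)
    have c2 := cross_of hn (a := x1) (b := x2) (c := z1) (d := z2) (by omega) (by omega) (by omega)
      (by omega)
    have c3 := cross_of hn (a := y1) (b := y2) (c := z1) (d := z2) (by omega) (by omega) (by omega)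
      (by omega)
    have n1 : qq n (x1, x2) ≠ qq n (y1, y2) := fun e => by
      rw [e] at c1; exact cross_irr hn (hT _ hy) c1
    have n2 : qq n (x1, x2) ≠ qq n (z1, z2) := fun e => by
      rw [e] at c2; exact cross_irr hn (hT _ hz) c2
    have n3 : qq n (y1, y2) ≠ qq n (z1, z2) := fun e => by
      rw [e] at c3; exact cross_irr hn (hT _ hz) c3
    refine ⟨{qq n (x1, x2), qq n (y1, y2), qq n (z1, z2)}, ?_,
      Finset.card_eq_three.2 ⟨_, _, _, n1, n2, n3, rfl⟩, ?_⟩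
    · intro e he
      simp only [Finset.coe_insert, Finset.coe_singleton, Set.mem_insert_iff,
        Set.mem_singleton_iff] at he
      rcases he with rfl | rfl | rfl <;> assumption
    · intro e he f hf hne
      simp only [Finset.mem_insert, Finset.mem_singleton] at he hf
      rcases he with rfl | rfl | rfl <;> rcases hf with rfl | rfl | rfl <;>
        first
        | exact absurd rfl hne
        | assumption
        | (apply cross_symm; assumption)
  · rintro h ⟨S, hS, hcard, hcr⟩
    obtain ⟨x, y, z, n1, n2, n3, rfl⟩ := Finset.card_eq_three.1 hcard
    have mx : x ∈ T := hS (by simp)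
    have my : y ∈ T := hS (by simp)
    have mz : z ∈ T := hS (by simp)
    have c1 := hcr x (by simp) y (by simp) n1
    have c2 := hcr x (by simp) z (by simp) n2
    have c3 := hcr y (by simp) z (by simp) n3
    obtain ⟨x1, x2, a1, a2, a3, rfl⟩ := std_ex hn x (hT _ mx)
    obtain ⟨y1, y2, b1, b2, b3, rfl⟩ := std_ex hn y (hT _ my)
    obtain ⟨z1, z2, d1, d2, d3, rfl⟩ := std_ex hn z (hT _ mz)
    rw [cross_std a1 a2 a3 b1 b2 b3] at c1
    rw [cross_std a1 a2 a3 d1 d2 d3] at c2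
    rw [cross_std b1 b2 b3 d1 d2 d3] at c3
    have lx : (x1, x2) ∈ lft n T := ⟨a2, by simp only; omega, mx⟩
    have ly : (y1, y2) ∈ lft n T := ⟨b2, by simp only; omega, my⟩
    have lz : (z1, z2) ∈ lft n T := ⟨d2, by simp only; omega, mz⟩
    have key : ∀ p q r : ℤ × ℤ, p ∈ lft n T → q ∈ lft n T → r ∈ lft n T → 0 ≤ p.1 → r.2 < 4 * n →
        p.1 < q.1 → q.1 < r.1 → r.1 < p.2 → p.2 < q.2 → q.2 < r.2 → False := by
      intro p q r hp hq hr g1 g2 g3 g4 g5 g6 g7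
      exact h p hp q hq r hr ⟨g3, g4, g5, g6, g7, by omega⟩
    rcases c1 with c1 | c1 <;> rcases c2 with c2 | c2 <;> rcases c3 with c3 | c3
    · exact key _ _ _ lx ly lz a1 d3 c1.1 c3.1 c2.2.1 c1.2.2 c3.2.2
    · exact key _ _ _ lx lz ly a1 b3 c2.1 c3.1 c1.2.1 c2.2.2 c3.2.2
    · omega
    · exact key _ _ _ lz lx ly d1 b3 c2.1 c1.1 c3.2.1 c2.2.2 c1.2.2
    · exact key _ _ _ ly lx lz b1 d3 c1.1 c2.1 c3.2.1 c1.2.2 c2.2.2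
    · omega
    · exact key _ _ _ ly lz lx b1 a3 c3.1 c2.1 c1.2.1 c3.2.2 c2.2.2
    · exact key _ _ _ lz ly lx d1 a3 c3.1 c1.1 c2.2.1 c3.2.2 c1.2.2

theorem qq_map (n : ℕ) (a b : ℤ) (j : ℕ) :
    Sym2.map (· + ((j : ℕ) : ZMod (4 * n))) (qq n (a, b)) = qq n (a + j, b + j) := by
  simp [qq]

theorem PS_lft {n : ℕ} {T : Set (Sym2 (ZMod (4 * n)))} (hp : PolyPeriodic n T) :
    PS n (lft n T) where
  val := fun p hp => ⟨hp.1, hp.2.1⟩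
  per := by
    rintro ⟨a, b⟩
    have := hp (qq n (a, b))
    rw [qq_map] at this
    simp only [lft, Set.mem_ofPred_eq, this]
    constructor
    · rintro ⟨h1, h2, h3⟩; exact ⟨by omega, by omega, h3⟩
    · rintro ⟨h1, h2, h3⟩; exact ⟨by omega, by omega, h3⟩
  sig := by
    rintro ⟨a, b⟩ ⟨h1, h2, h3⟩
    simp only at h1 h2
    refine ⟨by simp only; omega, by simp only; omega, ?_⟩
    rw [qq_sig]; exact h3

theorem lft_CT {n : ℕ} (hn : 1 ≤ n) {T : Set (Sym2 (ZMod (4 * n)))}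
    (hT : IsPeriodicPolyTriangulation n T) : CT n (lft n T) := by
  obtain ⟨⟨hv, hf, hm⟩, hp⟩ := hT
  have hps := PS_lft hp
  have hfr := (free_iff hn hv).1 hf
  refine ⟨hps, hfr, ?_⟩
  rintro ⟨a, b⟩ h1 h2 hpn
  simp only at h1 h2
  have hq : qq n (a, b) ∉ T := fun h => hpn ⟨h1, h2, h⟩
  have hv' : PolyValid (insert (qq n (a, b)) T) := by
    rintro e (rfl | he)
    · exact qq_nd h1 h2
    · exact hv e he
  have hnf : ¬ PolyCrossingFree 3 (insert (qq n (a, b)) T) := by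
    intro h
    have := hm _ hv' h (Set.subset_insert _ _)
    rw [← this] at hq
    exact hq (Set.mem_insert _ _)
  rw [free_iff hn hv'] at hnf
  simp only [FreeL] at hnf
  push Not at hnf
  obtain ⟨x, hx, y, hy, z, hz, hC⟩ := hnf
  have c1 := cross_of hn (a := x.1) (b := x.2) (c := y.1) (d := y.2) (by simp only [Cy] at hC; omega)
    (by simp only [Cy] at hC; omega) (by simp only [Cy] at hC; omega)
    (by simp only [Cy] at hC; omega)
  have c2 := cross_of hn (a := x.1) (b := x.2) (c := z.1) (d := z.2) (by simp only [Cy] at hC; omega)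
    (by simp only [Cy] at hC; omega) (by simp only [Cy] at hC; omega)
    (by simp only [Cy] at hC; omega)
  have c3 := cross_of hn (a := y.1) (b := y.2) (c := z.1) (d := z.2) (by simp only [Cy] at hC; omega)
    (by simp only [Cy] at hC; omega) (by simp only [Cy] at hC; omega)
    (by simp only [Cy] at hC; omega)
  have irr := cross_irr hn (qq_nd h1 h2)
  have cl : ∀ r : ℤ × ℤ, r ∈ lft n (insert (qq n (a, b)) T) →
      qq n (r.1, r.2) = qq n (a, b) ∨ r ∈ lft n T := by
    rintro r ⟨r1, r2, r3 | r3⟩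
    · exact Or.inl r3
    · exact Or.inr ⟨r1, r2, r3⟩
  have fin : ∀ r : ℤ × ℤ, r ∈ lft n (insert (qq n (a, b)) T) → qq n (r.1, r.2) = qq n (a, b) →
      Wit n (lft n T) r → Wit n (lft n T) (a, b) := by
    rintro ⟨r1, r2⟩ hr he hw
    rw [qq_eq hr.1 hr.2.1 h1 h2] at he
    obtain ⟨k, ⟨rfl, rfl⟩ | ⟨rfl, rfl⟩⟩ := he
    · exact Wit_shift hps (4 * k) hw
    · apply Wit_sig hps
      convert Wit_shift hps (4 + 4 * k) hw using 1
      ext <;> simp only <;> ring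
  rcases cl x hx with ex | lx <;> rcases cl y hy with ey | ly
  · rw [ex, ey] at c1; exact (irr c1).elim
  · rcases cl z hz with ez | lz
    · rw [ex, ez] at c2; exact (irr c2).elim
    · exact fin x hx ex ⟨y, ly, z, lz, hC⟩
  · rcases cl z hz with ez | lz
    · rw [ey, ez] at c3; exact (irr c3).elim
    · exact fin y hy ey (wit2 hps lx lz hC)
  · rcases cl z hz with ez | lz
    · exact fin z hz ez (wit3 hps lx ly hC)
    · exact (hfr x lx y ly z lz hC).elim

theorem of_CT {n : ℕ} (hn : 1 ≤ n) {T : Set (Sym2 (ZMod (4 * n)))} (hv : PolyValid T)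
    (h : CT n (lft n T)) : IsPeriodicPolyTriangulation n T := by
  refine ⟨⟨hv, (free_iff hn hv).2 h.free, ?_⟩, ?_⟩
  · intro T' hv' hf' hs
    rw [free_iff hn hv'] at hf'
    apply Set.Subset.antisymm _ hs
    intro e he
    by_contra heT
    obtain ⟨a, b, h1, h2, h3, rfl⟩ := std_ex hn e (hv' e he)
    have hsub : lft n T ⊆ lft n T' := fun p hp => ⟨hp.1, hp.2.1, hs hp.2.2⟩
    obtain ⟨x, hx, y, hy, hC⟩ := h.max (a, b) h2 (by simp only; omega) (fun hp => heT hp.2.2)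
    exact hf' (a, b) ⟨h2, by simp only; omega, he⟩ x (hsub hx) y (hsub hy) hC
  · intro e
    by_cases he : e.IsDiag
    · have h1 : (Sym2.map (· + (n : ZMod (4 * n))) e).IsDiag := by
        induction e using Sym2.ind with
        | _ x y =>
          rw [Sym2.mk_isDiag_iff] at he
          subst he
          simp
      exact ⟨fun h => (hv e h he).elim, fun h => (hv _ h h1).elim⟩
    · obtain ⟨a, b, h1, h2, h3, rfl⟩ := std_ex hn e he
      rw [qq_map]
      have := h.per (a, b)
      simp only [lft, Set.mem_ofPred_eq] at this
      constructor
      · intro g; exact (this.1 ⟨by omega, by omega, g⟩).2.2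
      · intro g; exact (this.2 ⟨by omega, by omega, g⟩).2.2

theorem mem_tilde {n : ℕ} {a b : ℤ} {x : Sym2 (ZMod (4 * n))} :
    x ∈ tilde n (qq n (a, b)) ↔ ∃ k : ℤ, x = qq n (a + k * n, b + k * n) := by
  simp only [tilde, qq_map, Set.mem_insert_iff, Set.mem_singleton_iff]
  constructor
  · rintro (rfl | rfl | rfl | rfl)
    · exact ⟨0, by simp⟩
    · exact ⟨1, by simp⟩
    · exact ⟨2, by simp⟩
    · exact ⟨3, by simp⟩
  · rintro ⟨k, rfl⟩
    obtain ⟨j, hj⟩ : ∃ j : ℤ, k = 4 * j ∨ k = 1 + 4 * j ∨ k = 2 + 4 * j ∨ k = 3 + 4 * j :=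
      ⟨k / 4, by omega⟩
    push_cast
    rcases hj with rfl | rfl | rfl | rfl
    · left; exact qq_shift n a b j
    · right; left
      rw [← qq_shift n (a + n) (b + n) j]; ring_nf
    · right; right; left
      rw [← qq_shift n (a + 2 * n) (b + 2 * n) j]; ring_nf
    · right; right; right
      rw [← qq_shift n (a + 3 * n) (b + 3 * n) j]; ring_nf

theorem lft_tilde {n : ℕ} {a b : ℤ} (h1 : a < b) (h2 : b < a + 4 * n) :
    lft n (tilde n (qq n (a, b))) = orb n (a, b) := by
  ext ⟨c, d⟩
  simp only [lft, Set.mem_ofPred_eq, mem_tilde, orb, Prod.mk.injEq]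
  constructor
  · rintro ⟨h3, h4, k, hk⟩
    rw [qq_eq h3 h4 (by omega) (by omega)] at hk
    obtain ⟨j, ⟨e1, e2⟩ | ⟨e1, e2⟩⟩ := hk
    · exact ⟨k - 4 * j, Or.inl ⟨by linarith, by linarith⟩⟩
    · exact ⟨k - 4 - 4 * j, Or.inr ⟨by linarith, by linarith⟩⟩
  · rintro ⟨k, ⟨rfl, rfl⟩ | ⟨rfl, rfl⟩⟩
    · exact ⟨by omega, by omega, k, rfl⟩
    · refine ⟨by omega, by omega, k, ?_⟩
      rw [← qq_sig n (a + k * n)]; ring_nf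

theorem lft_inj {n : ℕ} (hn : 1 ≤ n) {A B : Set (Sym2 (ZMod (4 * n)))} (hA : PolyValid A)
    (hB : PolyValid B) (h : lft n A = lft n B) : A = B := by
  ext e
  constructor
  · intro he
    obtain ⟨a, b, h1, h2, h3, rfl⟩ := std_ex hn e (hA e he)
    have : (a, b) ∈ lft n A := ⟨h2, by simp only; omega, he⟩
    rw [h] at this
    exact this.2.2
  · intro he
    obtain ⟨a, b, h1, h2, h3, rfl⟩ := std_ex hn e (hB e he)
    have : (a, b) ∈ lft n B := ⟨h2, by simp only; omega, he⟩
    rw [← h] at this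
    exact this.2.2

theorem lft_mix {n : ℕ} (A B C : Set (Sym2 (ZMod (4 * n)))) :
    lft n (A \ B ∪ C) = lft n A \ lft n B ∪ lft n C := by
  ext p
  simp only [lft, Set.mem_ofPred_eq, Set.mem_union, Set.mem_sdiff]
  tauto

/-- For every 2-relevant edge `e` of an `n`-periodic
2-triangulation `T` on the `4n`-gon, with rotation orbit `ẽ`, there are
exactly two `n`-periodic 2-triangulations containing `T ∖ ẽ`: namely `T`
itself and `(T ∖ ẽ) ∪ f̃`, where `f ∉ T` is an edge such that the latter is
an `n`-periodic 2-triangulation. -/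
theorem flip_unique (n : ℕ) (hn : 1 ≤ n)
    (T : Set (Sym2 (ZMod (4 * n)))) (hT : IsPeriodicPolyTriangulation n T)
    (e : Sym2 (ZMod (4 * n))) (he : e ∈ T) (hrel : PolyRelevant n e) :
    ∃ f : Sym2 (ZMod (4 * n)), f ∉ T ∧
      IsPeriodicPolyTriangulation n ((T \ tilde n e) ∪ tilde n f) ∧
      ∀ T' : Set (Sym2 (ZMod (4 * n))), IsPeriodicPolyTriangulation n T' →
        T \ tilde n e ⊆ T' → T' = T ∨ T' = (T \ tilde n e) ∪ tilde n f := by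
  obtain ⟨a, b, h1, h2, h3, h4, h5⟩ := hrel
  have he' : e = qq n (a, b) := by rw [h3]; simp [qq]
  subst he'
  have hL := lft_CT hn hT
  obtain ⟨⟨c, d⟩, v1, v2, f3, f4, f5⟩ := cover_flip (n := n) (by omega) hL
    (e := ((a : ℤ), (b : ℤ))) ⟨by simp only; omega, by simp only; omega, he⟩ (by simp only; omega)
    (by simp only; omega)
  simp only at v1 v2
  have hv : PolyValid (T \ tilde n (qq n (a, b)) ∪ tilde n (qq n (c, d))) := by
    rintro x (hx | hx)
    · exact hT.1.1 x hx.1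
    · obtain ⟨k, rfl⟩ := mem_tilde.1 hx
      exact qq_nd (by omega) (by omega)
  have key : lft n (T \ tilde n (qq n (a, b)) ∪ tilde n (qq n (c, d))) =
      lft n T \ orb n (a, b) ∪ orb n (c, d) := by
    rw [lft_mix, lft_tilde v1 v2, lft_tilde (by omega) (by omega)]
  refine ⟨qq n (c, d), fun h => f3 ⟨v1, v2, h⟩, of_CT hn hv (by rw [key]; exact f4), ?_⟩
  intro T' hT' hs
  rcases f5 (lft n T') (lft_CT hn hT') (by
    rw [← lft_tilde (by omega) (by omega)]
    rintro p ⟨hp, hpn⟩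
    exact ⟨hp.1, hp.2.1, hs ⟨hp.2.2, fun h => hpn ⟨hp.1, hp.2.1, h⟩⟩⟩) with h | h
  · exact Or.inl (lft_inj hn hT'.1.1 hT.1.1 h)
  · right
    rw [← key] at h
    exact lft_inj hn hT'.1.1 hv h

end Multitriangulation
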